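/- Let n ∈ ℕ, and let Z be a compact, Ahlfors n-regular metric space of topological (Lebesgue covering) dimension n. Suppose there exist δ > 0 and a homeomorphism η : [0,∞) → [0,∞) such that every triple of pairwise distinct points in Z can be mapped by some η-quasi-Möbius homeomorphism of Z onto itself to a triple whose pairwise distances are at least δ. Then Z is quasi-symmetrically homeomorphic to the standard sphere Sⁿ. -/

import Mathlib

open Metric Set MeasureTheory Filter Topology

noncomputable section

/-- Cross-ratio of a four-tuple of points in a metric space. -/
def crossRatio {Z : Type*} [MetricSpace Z] (z₁ z₂ z₃ z₄ : Z) : NNReal :=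
  nndist z₁ z₃ * nndist z₂ z₄ / (nndist z₁ z₄ * nndist z₂ z₃)

/-- `f : X → Y` is `η`-quasi-Möbius. -/
def IsQuasiMobius {X Y : Type*} [MetricSpace X] [MetricSpace Y]
    (η : NNReal ≃ₜ NNReal) (f : X → Y) : Prop :=
  Function.Injective f ∧
  ∀ x₁ x₂ x₃ x₄ : X, x₁ ≠ x₂ → x₁ ≠ x₃ → x₁ ≠ x₄ → x₂ ≠ x₃ → x₂ ≠ x₄ → x₃ ≠ x₄ →
    crossRatio (f x₁) (f x₂) (f x₃) (f x₄) ≤ η (crossRatio x₁ x₂ x₃ x₄)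

/-- `f : X → Y` is `η`-quasi-symmetric. -/
def IsQuasiSymmetric {X Y : Type*} [MetricSpace X] [MetricSpace Y]
    (η : NNReal ≃ₜ NNReal) (f : X → Y) : Prop :=
  Function.Injective f ∧
  ∀ x₁ x₂ x₃ : X, x₁ ≠ x₂ → x₁ ≠ x₃ → x₂ ≠ x₃ →
    nndist (f x₁) (f x₂) / nndist (f x₁) (f x₃) ≤ η (nndist x₁ x₂ / nndist x₁ x₃)

/-- Lebesgue covering dimension is at most `n`. -/
def covDimLE (X : Type*) [TopologicalSpace X] (n : ℕ) : Prop :=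
  ∀ 𝒰 : Set (Set X), (∀ U ∈ 𝒰, IsOpen U) → ⋃₀ 𝒰 = univ →
    ∃ 𝒱 : Set (Set X), (∀ V ∈ 𝒱, IsOpen V) ∧ ⋃₀ 𝒱 = univ ∧
      (∀ V ∈ 𝒱, ∃ U ∈ 𝒰, V ⊆ U) ∧
      ∀ x : X, {V ∈ 𝒱 | x ∈ V}.encard ≤ (n + 1 : ℕ)

/-- Lebesgue covering (topological) dimension. -/
noncomputable def topDim (X : Type*) [TopologicalSpace X] : ℕ∞ :=
  ⨅ (n : ℕ) (_ : covDimLE X n), (n : ℕ∞)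

/-- Ahlfors `Q`-regularity. -/
def AhlforsRegular (Q : ℝ) (Z : Type*) [MetricSpace Z] [MeasurableSpace Z] [BorelSpace Z] :
    Prop :=
  0 < Q ∧ CompleteSpace Z ∧ 0 < Metric.diam (univ : Set Z) ∧
  ∃ C : ℝ, 1 ≤ C ∧ ∀ (z : Z) (R : ℝ), 0 < R → R ≤ Metric.diam (univ : Set Z) →
    ENNReal.ofReal (R ^ Q / C) ≤ μH[Q] (Metric.ball z R) ∧
    μH[Q] (Metric.ball z R) ≤ ENNReal.ofReal (C * R ^ Q)

/-- The action of `G` on `Z` is by homeomorphisms, each `η`-quasi-Möbius. -/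
def QMAction (η : NNReal ≃ₜ NNReal) (G Z : Type*) [Group G] [MulAction G Z]
    [MetricSpace Z] : Prop :=
  (∀ g : G, Continuous fun z : Z => g • z) ∧
  ∀ g : G, IsQuasiMobius η (fun z : Z => g • z)

/-- Cocompactness of the induced action on distinct triples (for compact `Z`). -/
def TriplesCocompact (G Z : Type*) [Group G] [MulAction G Z] [MetricSpace Z] : Prop :=
  ∃ δ > (0:ℝ), ∀ z₁ z₂ z₃ : Z, z₁ ≠ z₂ → z₁ ≠ z₃ → z₂ ≠ z₃ →
    ∃ g : G, δ ≤ dist (g • z₁) (g • z₂) ∧ δ ≤ dist (g • z₁) (g • z₃) ∧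
      δ ≤ dist (g • z₂) (g • z₃)

def IsStableValue {X Y : Type*} [TopologicalSpace X] [MetricSpace Y]
    (f : X → Y) (y : Y) : Prop :=
  ∃ ε > (0:ℝ), ∀ g : X → Y, Continuous g → (∀ x, dist (f x) (g x) < ε) → y ∈ range g

def IsStableValueOn {X Y : Type*} [TopologicalSpace X] [MetricSpace Y]
    (f : X → Y) (s : Set X) (y : Y) : Prop :=
  IsStableValue (fun x : s => f x) y

def IsStablePoint {X Y : Type*} [TopologicalSpace X] [MetricSpace Y]
    (f : X → Y) (x : X) : Prop :=
  ∀ U ∈ nhds x, IsStableValueOn f U (f x)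

/-- `f` is a regular map. -/
def IsRegularMap {X Y : Type*} [MetricSpace X] [MetricSpace Y] (f : X → Y) : Prop :=
  (∃ L : NNReal, LipschitzWith L f) ∧
  ∃ N : ℕ, ∀ (y : Y) (r : ℝ), 0 < r → ∃ t : Finset X, t.card ≤ N ∧
    f ⁻¹' Metric.ball y r ⊆ ⋃ c ∈ t, Metric.ball c r

/-- A metric space is doubling. -/
def MetricDoubling (Y : Type*) [MetricSpace Y] : Prop :=
  ∃ M : ℕ, ∀ (y : Y) (R : ℝ), ∃ t : Finset Y, t.card ≤ M ∧
    Metric.ball y R ⊆ ⋃ c ∈ t, Metric.ball c (R / 2)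

/-- A metric space is uniformly perfect. -/
def UniformlyPerfect (Z : Type*) [MetricSpace Z] : Prop :=
  ∃ lam : ℝ, 1 ≤ lam ∧ ∀ (z : Z) (R : ℝ), 0 < R → R ≤ Metric.diam (univ : Set Z) →
    (Metric.closedBall z R \ Metric.ball z (R / lam)).Nonempty

/-- `(S, q)` is a weak tangent of `Z`: `S` is complete and some rescalings
`(λ_k Z, p_k)` converge to `(S, q)` in the pointed Gromov–Hausdorff sense. -/
def PointedWeakTangent (Z : Type*) [MetricSpace Z] (S : Type*) [MetricSpace S]
    (q : S) : Prop :=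
  CompleteSpace S ∧
  ∃ (lam : ℕ → ℝ) (p : ℕ → Z), (∀ k, 0 < lam k) ∧ Tendsto lam atTop atTop ∧
    ∀ R > (0:ℝ), ∀ ε > (0:ℝ), ∃ (N : ℕ) (M : Set S),
      q ∈ M ∧ M ⊆ Metric.ball q R ∧ (∀ s ∈ Metric.ball q R, ∃ m ∈ M, dist s m ≤ ε) ∧
      ∀ k ≥ N, ∃ (Mk : Set Z) (F : Z → S),
        p k ∈ Mk ∧ (∀ z ∈ Mk, lam k * dist z (p k) < R) ∧
        (∀ z : Z, lam k * dist z (p k) < R → ∃ w ∈ Mk, lam k * dist z w ≤ ε) ∧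
        F (p k) = q ∧ Set.BijOn F Mk M ∧
        ∀ a ∈ Mk, ∀ b ∈ Mk, |lam k * dist a b - dist (F a) (F b)| < ε

/-- The unit sphere `Sⁿ ⊆ ℝⁿ⁺¹` with the restricted Euclidean metric. -/
abbrev StdSphere (n : ℕ) : Type :=
  (Metric.sphere (0 : EuclideanSpace ℝ (Fin (n + 1))) 1 : Set (EuclideanSpace ℝ (Fin (n + 1))))

/-- A gauge: a continuous monotone control function vanishing at `0`. -/
def IsGauge (θ : ℝ → ℝ) : Prop := Monotone θ ∧ Continuous θ ∧ θ 0 = 0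

lemma IsGauge.id : IsGauge (fun t => t) := ⟨monotone_id, continuous_id, rfl⟩

lemma IsGauge.comp {θ θ' : ℝ → ℝ} (h : IsGauge θ) (h' : IsGauge θ') : IsGauge (θ ∘ θ') :=
  ⟨h.1.comp h'.1, h.2.1.comp h'.2.1, by simp [h.2.2, h'.2.2]⟩

lemma IsGauge.nonneg {θ : ℝ → ℝ} (h : IsGauge θ) {t : ℝ} (ht : 0 ≤ t) : 0 ≤ θ t :=
  h.2.2 ▸ h.1 ht

lemma IsGauge.exists_small {θ : ℝ → ℝ} (h : IsGauge θ) {A ε : ℝ} (hε : 0 < ε) :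
    ∃ κ > 0, ∀ t, 0 ≤ t → t < κ → θ (A * t) < ε := by
  have hc : Continuous fun t => θ (A * t) := h.2.1.comp (continuous_const.mul continuous_id)
  have h0 : (fun t => θ (A * t)) 0 < ε := by simpa [h.2.2] using hε
  obtain ⟨κ, hκ, hb⟩ := Metric.eventually_nhds_iff.1 (hc.continuousAt.eventually (gt_mem_nhds h0))
  exact ⟨κ, hκ, fun t h0t ht => hb (by rw [Real.dist_eq, sub_zero, abs_of_nonneg h0t]; exact ht)⟩

/-- Cross-ratio of four points with respect to a distance function. -/
def realCross {Z : Type*} (ρ : Z → Z → ℝ) (a b c e : Z) : ℝ :=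
  ρ a c * ρ b e / (ρ a e * ρ b c)

/-- `ρ` is a metric on `Z \ {o}` whose cross-ratios are comparable to those of the given metric
of `Z`, with controls `θ₁` and `θ₂`. -/
structure QMMetric {Z : Type*} [MetricSpace Z] (o : Z) (ρ : Z → Z → ℝ) (θ₁ θ₂ : ℝ → ℝ) :
    Prop where
  self : ∀ u, u ≠ o → ρ u u = 0
  comm : ∀ u v, u ≠ o → v ≠ o → ρ u v = ρ v u
  tri : ∀ u v w, u ≠ o → v ≠ o → w ≠ o → ρ u w ≤ ρ u v + ρ v w
  pos : ∀ u v, u ≠ o → v ≠ o → u ≠ v → 0 < ρ u v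
  lower : ∀ a b c e, a ≠ o → b ≠ o → c ≠ o → e ≠ o → a ≠ b → a ≠ e → b ≠ c → c ≠ e →
    realCross dist a b c e ≤ θ₁ (realCross ρ a b c e)
  upper : ∀ a b c e, a ≠ o → b ≠ o → c ≠ o → e ≠ o → a ≠ b → a ≠ e → b ≠ c → c ≠ e →
    realCross ρ a b c e ≤ θ₂ (realCross dist a b c e)

/-- A triple normalised with respect to both `ρ` and the metric of `Z`. -/
structure NormTriple {Z : Type*} [MetricSpace Z] (o : Z) (ρ : Z → Z → ℝ) (C δ : ℝ)
    (t : Fin 3 → Z) : Prop where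
  ne : ∀ i, t i ≠ o
  low : ∀ i j, i ≠ j → 1 / C ≤ ρ (t i) (t j)
  high : ∀ i j, i ≠ j → ρ (t i) (t j) ≤ C
  sep : ∀ i j, i ≠ j → δ ≤ dist (t i) (t j)

section static

variable {Z : Type*} [MetricSpace Z] {o : Z} {ρ : Z → Z → ℝ} {θ₁ θ₂ : ℝ → ℝ} {C δ D : ℝ}
  {t : Fin 3 → Z}

lemma QMMetric.nonneg (h : QMMetric o ρ θ₁ θ₂) {u v : Z} (hu : u ≠ o) (hv : v ≠ o) :
    0 ≤ ρ u v := by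
  by_cases huv : u = v
  · subst huv; exact (h.self u hu).ge
  · exact (h.pos u v hu hv huv).le

lemma exists_pair_far {φ : Fin 3 → ℝ} {c : ℝ} (h : ∀ i j, i ≠ j → c ≤ φ i + φ j) :
    ∃ i j, i ≠ j ∧ c / 2 ≤ φ i ∧ c / 2 ≤ φ j := by
  have h01 := h 0 1 (by decide)
  have h02 := h 0 2 (by decide)
  have h12 := h 1 2 (by decide)
  rcases le_or_gt (c / 2) (φ 0) with h0 | h0
  · rcases le_or_gt (c / 2) (φ 1) with h1 | h1
    · exact ⟨0, 1, by decide, h0, h1⟩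
    · exact ⟨0, 2, by decide, h0, by linarith⟩
  · exact ⟨1, 2, by decide, by linarith, by linarith⟩

lemma QMMetric.ne_of_pos (h : QMMetric o ρ θ₁ θ₂) {u v : Z} (hu : u ≠ o)
    (hp : 0 < ρ u v) : u ≠ v := by
  rintro rfl
  rw [h.self u hu] at hp
  exact lt_irrefl _ hp

/-- Points that are `ρ`-close are close. -/
lemma exists_dist_lt_of_rho_lt (hθ : IsGauge θ₁) (hC : 0 < C) (hδ : 0 < δ)
    (hD : ∀ u v : Z, dist u v ≤ D) {ε : ℝ} (hε : 0 < ε) :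
    ∃ κ > 0, ∀ (o : Z) (ρ : Z → Z → ℝ) (t : Fin 3 → Z), QMMetric o ρ θ₁ θ₂ →
      NormTriple o ρ C δ t → ∀ u v, u ≠ o → v ≠ o → ρ u v < κ → dist u v < ε := by
  obtain ⟨κ, hκ, hsmall⟩ := hθ.exists_small (A := C * (8 * C ^ 2))
    (ε := ε * δ / (D ^ 2 + 1)) (by positivity)
  refine ⟨min κ (1 / (4 * C)), by positivity, fun o ρ t h ht u v hu hv huv => ?_⟩
  have huv1 := huv.trans_le (min_le_left _ _)
  have huv2 := huv.trans_le (min_le_right _ _)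
  have h0 := h.nonneg hu hv
  obtain ⟨i, j, hij, hi, hj⟩ := exists_pair_far (φ := fun i => ρ u (t i)) (c := 1 / C)
    (fun i j hij => by
      have := h.tri (t i) u (t j) (ht.ne i) hu (ht.ne j)
      rw [h.comm (t i) u (ht.ne i) hu] at this
      linarith [ht.low i j hij])
  set w := t i with hw
  set w' := t j with hw'
  have hc2 : 1 / C / 2 = 2 * (1 / (4 * C)) := by field_simp; norm_num
  have hpos4 : 0 < 1 / (4 * C) := by positivity
  rw [hc2] at hi hj
  have hvw : 1 / (4 * C) ≤ ρ w v := by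
    have := h.tri u v w hu hv (ht.ne i)
    rw [h.comm v w hv (ht.ne i)] at this
    linarith
  have hvw' : 1 / (4 * C) ≤ ρ w' v := by
    have := h.tri u v w' hu hv (ht.ne j)
    rw [h.comm v w' hv (ht.ne j)] at this
    linarith
  have huw : u ≠ w := h.ne_of_pos hu (by linarith)
  have huw' : u ≠ w' := h.ne_of_pos hu (by linarith)
  have hwv : w ≠ v := h.ne_of_pos (ht.ne i) (by linarith)
  have hwv' : w' ≠ v := h.ne_of_pos (ht.ne j) (by linarith)
  have hcr := h.lower u w v w' hu (ht.ne i) hv (ht.ne j) huw huw' hwv hwv'.symm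
  have hρ : realCross ρ u w v w' ≤ C * (8 * C ^ 2) * ρ u v := by
    unfold realCross
    have hden : 1 / (8 * C ^ 2) ≤ ρ u w' * ρ w v := by
      calc 1 / (8 * C ^ 2) = 2 * (1 / (4 * C)) * (1 / (4 * C)) := by field_simp; norm_num
        _ ≤ ρ u w' * ρ w v := mul_le_mul hj hvw hpos4.le (by linarith)
    have hden0 : 0 < 1 / (8 * C ^ 2) := by positivity
    rw [div_le_iff₀ (hden0.trans_le hden)]
    calc ρ u v * ρ w w' ≤ ρ u v * C := by gcongr; exact ht.high i j hij
      _ = C * (8 * C ^ 2) * ρ u v * (1 / (8 * C ^ 2)) := by field_simp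
      _ ≤ _ := by gcongr
  have hlt : realCross dist u w v w' < ε * δ / (D ^ 2 + 1) :=
    hcr.trans_lt ((hθ.1 hρ).trans_lt (hsmall _ h0 huv1))
  unfold realCross at hlt
  have hden : 0 < dist u w' * dist w v := mul_pos (dist_pos.2 huw') (dist_pos.2 hwv)
  have hD0 : 0 ≤ D := dist_nonneg.trans (hD u v)
  have hdle : dist u w' * dist w v ≤ D ^ 2 := by
    rw [sq]; exact mul_le_mul (hD _ _) (hD _ _) dist_nonneg hD0
  rw [div_lt_iff₀ hden] at hlt
  have h1 : dist u v * δ ≤ dist u v * dist w w' := by gcongr; exact ht.sep i j hij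
  have h2 : ε * δ / (D ^ 2 + 1) * (dist u w' * dist w v) < ε * δ := by
    rw [div_mul_eq_mul_div, div_lt_iff₀ (by positivity)]
    have : 0 < ε * δ := by positivity
    nlinarith
  exact lt_of_mul_lt_mul_right (by linarith) hδ.le

/-- Points that are close are `ρ`-close, as long as one of them stays bounded. -/
lemma exists_rho_lt_of_dist_lt (hθ : IsGauge θ₂) (hC : 0 < C) (hδ : 0 < δ)
    (hD : ∀ u v : Z, dist u v ≤ D) {M ε : ℝ} (hM : 0 ≤ M) (hε : 0 < ε) :
    ∃ κ > 0, ∀ (o : Z) (ρ : Z → Z → ℝ) (t : Fin 3 → Z), QMMetric o ρ θ₁ θ₂ →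
      NormTriple o ρ C δ t → ∀ u v, u ≠ o → v ≠ o → ρ u (t 0) ≤ M → dist u v < κ →
      ρ u v < ε := by
  set M' := M + C with hM'
  have hM'0 : 0 < M' := by positivity
  obtain ⟨κ, hκ, hsmall⟩ := hθ.exists_small (A := D * 8 / δ ^ 2)
    (ε := min (1 / (2 * C * M')) (ε / (2 * C * M' ^ 2))) (by positivity)
  refine ⟨min κ (δ / 4), by positivity, fun o ρ t h ht u v hu hv huM huv => ?_⟩
  have huv1 := huv.trans_le (min_le_left _ _)
  have huv2 := huv.trans_le (min_le_right _ _)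
  have hMi : ∀ i, ρ u (t i) ≤ M' := by
    intro i
    by_cases hi : i = 0
    · subst hi; linarith
    · have := h.tri u (t 0) (t i) hu (ht.ne 0) (ht.ne i)
      linarith [ht.high 0 i (Ne.symm hi)]
  obtain ⟨i, j, hij, hi, hj⟩ := exists_pair_far (φ := fun i => dist u (t i)) (c := δ)
    (fun i j hij => by
      have := dist_triangle_left (t i) (t j) u
      linarith [ht.sep i j hij])
  have hMi' := hMi i
  have hMj' := hMi j
  have hwwC := ht.low i j hij
  have hnei := ht.ne i
  have hnej := ht.ne j
  generalize t i = w at *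
  generalize t j = w' at *
  have hvw : δ / 4 ≤ dist w v := by
    have := dist_triangle u v w
    rw [dist_comm v w] at this
    linarith
  have hvw' : δ / 4 ≤ dist w' v := by
    have := dist_triangle u v w'
    rw [dist_comm v w'] at this
    linarith
  have huw : u ≠ w := dist_pos.1 (by linarith)
  have huw' : u ≠ w' := dist_pos.1 (by linarith)
  have hwv : w ≠ v := dist_pos.1 (by linarith)
  have hwv' : w' ≠ v := dist_pos.1 (by linarith)
  have hcr := h.upper u w v w' hu hnei hv hnej huw huw' hwv hwv'.symm
  have hd : realCross dist u w v w' ≤ D * 8 / δ ^ 2 * dist u v := by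
    unfold realCross
    have hden : δ ^ 2 / 8 ≤ dist u w' * dist w v := by
      calc δ ^ 2 / 8 = δ / 2 * (δ / 4) := by ring
        _ ≤ _ := by gcongr
    have hden0 : 0 < δ ^ 2 / 8 := by positivity
    rw [div_le_iff₀ (hden0.trans_le hden)]
    have hD0 : 0 ≤ D := dist_nonneg.trans (hD u v)
    calc dist u v * dist w w' ≤ dist u v * D := by gcongr; exact hD _ _
      _ = D * 8 / δ ^ 2 * dist u v * (δ ^ 2 / 8) := by field_simp
      _ ≤ _ := by gcongr
  have hlt := (hθ.1 hd).trans_lt (hsmall _ dist_nonneg huv1)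
  set s := θ₂ (realCross dist u w v w') with hs
  have hs0 : 0 ≤ s := hθ.nonneg (by unfold realCross; positivity)
  have hs1 : s ≤ 1 / (2 * C * M') := (hlt.trans_le (min_le_left _ _)).le
  have hs2 : s < ε / (2 * C * M' ^ 2) := hlt.trans_le (min_le_right _ _)
  unfold realCross at hcr
  have hpw' := h.pos u w' hu hnej huw'
  have hpw := h.pos w v hnei hv hwv
  rw [div_le_iff₀ (mul_pos hpw' hpw)] at hcr
  have h0 := h.nonneg hu hv
  have htri : ρ w v ≤ M' + ρ u v := by
    have := h.tri w u v hnei hu hv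
    rw [h.comm w u hnei hu] at this
    linarith
  have hA : ρ u v * (1 / C) ≤ s * (M' * (M' + ρ u v)) := by
    calc ρ u v * (1 / C) ≤ ρ u v * ρ w w' := by gcongr
      _ ≤ s * (ρ u w' * ρ w v) := hcr
      _ ≤ _ := by gcongr
  have hB : s * M' ≤ 1 / C / 2 := by
    calc s * M' ≤ 1 / (2 * C * M') * M' := by gcongr
      _ = _ := by field_simp
  have hE : s * M' ^ 2 < ε * (1 / C / 2) := by
    calc s * M' ^ 2 < ε / (2 * C * M' ^ 2) * M' ^ 2 := by gcongr
      _ = _ := by field_simp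
  have hC' : 0 < 1 / C / 2 := by positivity
  have : ρ u v * (1 / C / 2) < ε * (1 / C / 2) := by nlinarith
  exact lt_of_mul_lt_mul_right this hC'.le

/-- Points far from a `ρ`-distant point are `ρ`-bounded. -/
lemma exists_rho_le_of_far (hθ : IsGauge θ₂) (hC : 0 < C) (hδ : 0 < δ)
    (hD : ∀ u v : Z, dist u v ≤ D) {τ : ℝ} (hτ : 0 < τ) :
    ∃ M > 0, ∀ (o : Z) (ρ : Z → Z → ℝ) (t : Fin 3 → Z), QMMetric o ρ θ₁ θ₂ →
      NormTriple o ρ C δ t → ∀ u q, u ≠ o → q ≠ o → M < ρ q (t 0) → τ ≤ dist u q →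
      ρ u (t 0) ≤ M := by
  set s := θ₂ (D ^ 2 / (τ * δ)) with hs
  have hs0 : 0 ≤ s := hθ.nonneg (by positivity)
  refine ⟨2 * C + 4 * s * C, by positivity, fun o ρ t h ht u q hu hq hM huq => ?_⟩
  have hsC : 0 ≤ s * C := by positivity
  have hx := ht.ne 0
  have ha := ht.ne 1
  have hxa := ht.high 1 0 (by decide)
  have hxa' := ht.sep 1 0 (by decide)
  by_contra! hX
  have hua : u ≠ t 1 := by
    rintro rfl
    linarith
  have huq' : u ≠ q := dist_pos.1 (hτ.trans_le huq)
  have hax : t 1 ≠ t 0 := dist_pos.1 (hδ.trans_le hxa')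
  have hxq : t 0 ≠ q := (h.ne_of_pos hq (by linarith)).symm
  have hcr := h.upper u (t 1) (t 0) q hu ha hx hq hua huq' hax hxq
  have hd : realCross dist u (t 1) (t 0) q ≤ D ^ 2 / (τ * δ) := by
    unfold realCross
    have hD0 : 0 ≤ D := dist_nonneg.trans (hD u q)
    rw [sq]
    gcongr <;> exact hD _ _
  replace hcr := hcr.trans (hθ.1 hd)
  rw [← hs] at hcr
  unfold realCross at hcr
  have hpq := h.pos u q hu hq huq'
  have hpa := h.pos (t 1) (t 0) ha hx hax
  rw [div_le_iff₀ (mul_pos hpq hpa)] at hcr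
  have h1 : ρ u q ≤ ρ u (t 0) + ρ q (t 0) := by
    have := h.tri u (t 0) q hu hx hq
    rwa [h.comm (t 0) q hx hq] at this
  have h2 : ρ q (t 0) ≤ ρ (t 1) q + C := by
    have := h.tri q (t 1) (t 0) hq ha hx
    rw [h.comm q (t 1) hq ha] at this
    linarith
  set X := ρ u (t 0)
  set P := ρ q (t 0)
  have h3 : X * (P - C) ≤ s * C * (X + P) := by
    calc X * (P - C) ≤ X * ρ (t 1) q := by gcongr; linarith; linarith
      _ ≤ s * (ρ u q * ρ (t 1) (t 0)) := hcr
      _ ≤ s * ((X + P) * C) := by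
        gcongr; linarith
      _ = _ := by ring
  have h4 : P / 2 ≤ P - C := by linarith
  have h5 : X * (P / 2) ≤ s * C * (X + P) :=
    (mul_le_mul_of_nonneg_left h4 (by linarith)).trans h3
  have hX0 : 0 < X := by linarith
  have hP0 : 0 < P := by linarith
  nlinarith [mul_pos hX0 hP0]

end static

lemma homeo_nnreal_strictMono (η : NNReal ≃ₜ NNReal) : StrictMono η := by
  rcases η.continuous.strictMono_of_inj η.injective with h | h
  · exact h
  · obtain ⟨x, hx⟩ := η.surjective (η 0 + 1)
    have h1 : η x ≤ η 0 := h.antitone zero_le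
    rw [hx] at h1
    exact absurd h1 (not_le.2 (lt_add_one _))

lemma homeo_nnreal_zero (η : NNReal ≃ₜ NNReal) : η 0 = 0 := by
  obtain ⟨x, hx⟩ := η.surjective 0
  have h1 : η 0 ≤ η x := (homeo_nnreal_strictMono η).monotone zero_le
  rw [hx] at h1
  exact le_antisymm h1 zero_le

lemma monotone_inv_homeo_inv (η : NNReal ≃ₜ NNReal) :
    Monotone fun t : NNReal => (η t⁻¹)⁻¹ := by
  intro a b hab
  rcases eq_or_ne a 0 with rfl | ha
  · simp [homeo_nnreal_zero]
  have hb : 0 < b := lt_of_lt_of_le (pos_iff_ne_zero.2 ha) hab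
  have h3 : 0 < η b⁻¹ := by
    rw [← homeo_nnreal_zero η]
    exact homeo_nnreal_strictMono η (by positivity)
  exact inv_anti₀ h3
    ((homeo_nnreal_strictMono η).monotone (inv_anti₀ (pos_iff_ne_zero.2 ha) hab))

/-- The control function `t ↦ 1 / η⁻¹ (1 / t)` of the inverse of an `η`-quasi-Möbius map. -/
def dualHomeo (η : NNReal ≃ₜ NNReal) : NNReal ≃ₜ NNReal :=
  (((Equiv.inv NNReal).trans (η.symm.toEquiv.trans (Equiv.inv NNReal))).toOrderIso
    (monotone_inv_homeo_inv η.symm) (monotone_inv_homeo_inv η)).toHomeomorph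

lemma dualHomeo_apply (η : NNReal ≃ₜ NNReal) (t : NNReal) :
    dualHomeo η t = (η.symm t⁻¹)⁻¹ := rfl

/-- A homeomorphism of `[0, ∞)` as a control function on `ℝ`. -/
def gaugeOf (η : NNReal ≃ₜ NNReal) (t : ℝ) : ℝ := η t.toNNReal

lemma isGauge_gaugeOf (η : NNReal ≃ₜ NNReal) : IsGauge (gaugeOf η) := by
  refine ⟨fun a b hab => ?_, ?_, ?_⟩
  · exact NNReal.coe_le_coe.2 ((homeo_nnreal_strictMono η).monotone (Real.toNNReal_le_toNNReal hab))
  · exact NNReal.continuous_coe.comp (η.continuous.comp continuous_real_toNNReal)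
  · simp [gaugeOf, homeo_nnreal_zero]

lemma coe_crossRatio {Z : Type*} [MetricSpace Z] (a b c e : Z) :
    (crossRatio a b c e : ℝ) = realCross dist a b c e := by
  simp [crossRatio, realCross]

lemma IsQuasiMobius.realCross_le {X Y : Type*} [MetricSpace X] [MetricSpace Y]
    {η : NNReal ≃ₜ NNReal} {g : X → Y} (hg : IsQuasiMobius η g) {a b c e : X}
    (hab : a ≠ b) (hae : a ≠ e) (hbc : b ≠ c) (hce : c ≠ e) :
    realCross dist (g a) (g b) (g c) (g e) ≤ gaugeOf η (realCross dist a b c e) := by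
  by_cases hac : a = c
  · subst hac; simp [realCross, (isGauge_gaugeOf η).2.2]
  by_cases hbe : b = e
  · subst hbe; simp [realCross, (isGauge_gaugeOf η).2.2]
  rw [← coe_crossRatio, ← coe_crossRatio, gaugeOf, Real.toNNReal_coe]
  exact NNReal.coe_le_coe.2 (hg.2 a b c e hab hac hae hbc hbe hce)

lemma crossRatio_swap {Z : Type*} [MetricSpace Z] (a b c e : Z) :
    crossRatio a b e c = (crossRatio a b c e)⁻¹ := by
  rw [crossRatio, crossRatio, inv_div]

lemma IsQuasiMobius.realCross_le_dual {X Y : Type*} [MetricSpace X] [MetricSpace Y]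
    {η : NNReal ≃ₜ NNReal} {g : X → Y} (hg : IsQuasiMobius η g) {a b c e : X}
    (hab : a ≠ b) (hae : a ≠ e) (hbc : b ≠ c) (hce : c ≠ e) :
    realCross dist a b c e ≤ gaugeOf (dualHomeo η) (realCross dist (g a) (g b) (g c) (g e)) := by
  by_cases hac : a = c
  · subst hac; simp [realCross, (isGauge_gaugeOf _).2.2]
  by_cases hbe : b = e
  · subst hbe; simp [realCross, (isGauge_gaugeOf _).2.2]
  rw [← coe_crossRatio, ← coe_crossRatio, gaugeOf, Real.toNNReal_coe]
  refine NNReal.coe_le_coe.2 ?_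
  have h := hg.2 a b e c hab hae hac hbe hbc (Ne.symm hce)
  rw [crossRatio_swap, crossRatio_swap a b c e] at h
  rw [dualHomeo_apply]
  have h2 : η.symm (crossRatio (g a) (g b) (g c) (g e))⁻¹ ≤ (crossRatio a b c e)⁻¹ := by
    have := (homeo_nnreal_strictMono η.symm).monotone h
    rwa [Homeomorph.symm_apply_apply] at this
  have hpos : 0 < crossRatio (g a) (g b) (g c) (g e) := by
    have h13 : 0 < nndist (g a) (g c) := pos_iff_ne_zero.2 (by simpa using hg.1.ne hac)
    have h24 : 0 < nndist (g b) (g e) := pos_iff_ne_zero.2 (by simpa using hg.1.ne hbe)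
    have h14 : 0 < nndist (g a) (g e) := pos_iff_ne_zero.2 (by simpa using hg.1.ne hae)
    have h23 : 0 < nndist (g b) (g c) := pos_iff_ne_zero.2 (by simpa using hg.1.ne hbc)
    unfold crossRatio; positivity
  have h3 : 0 < η.symm (crossRatio (g a) (g b) (g c) (g e))⁻¹ := by
    rw [← homeo_nnreal_zero η.symm]
    exact homeo_nnreal_strictMono η.symm (by positivity)
  simpa using inv_anti₀ h3 h2

section blowup

variable {Z : Type*} [MetricSpace Z] {o : Z} {ρ : Z → Z → ℝ} {θ₁ θ₂ : ℝ → ℝ}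

lemma QMMetric.transport (h : QMMetric o ρ θ₁ θ₂) (h₂ : IsGauge θ₂)
    {η : NNReal ≃ₜ NNReal} {g : Z ≃ₜ Z} (hg : IsQuasiMobius η g) {r : ℝ} (hr : 0 < r) :
    QMMetric (g o) (fun u v => ρ (g.symm u) (g.symm v) / r)
      (gaugeOf η ∘ θ₁) (θ₂ ∘ gaugeOf (dualHomeo η)) := by
  have hne : ∀ u, u ≠ g o → g.symm u ≠ o := fun u hu hh => hu (by rw [← hh]; simp)
  have hcr : ∀ a b c e, realCross (fun u v => ρ (g.symm u) (g.symm v) / r) a b c e =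
      realCross ρ (g.symm a) (g.symm b) (g.symm c) (g.symm e) := by
    intro a b c e
    simp only [realCross]
    rw [div_mul_div_comm, div_mul_div_comm, div_div_div_cancel_right₀ (by positivity)]
  refine ⟨fun u hu => ?_, fun u v hu hv => ?_, fun u v w hu hv hw => ?_, fun u v hu hv huv => ?_,
    fun a b c e ha hb hc he hab hae hbc hce => ?_, fun a b c e ha hb hc he hab hae hbc hce => ?_⟩
  · simp [h.self _ (hne u hu)]
  · simp only [h.comm _ _ (hne u hu) (hne v hv)]
  · rw [← add_div]
    gcongr
    exact h.tri _ _ _ (hne u hu) (hne v hv) (hne w hw)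
  · exact div_pos (h.pos _ _ (hne u hu) (hne v hv) (g.symm.injective.ne huv)) hr
  · rw [hcr]
    have h1 := hg.realCross_le (g.symm.injective.ne hab) (g.symm.injective.ne hae)
      (g.symm.injective.ne hbc) (g.symm.injective.ne hce)
    simp only [Homeomorph.apply_symm_apply] at h1
    exact h1.trans ((isGauge_gaugeOf η).1 (h.lower _ _ _ _ (hne a ha) (hne b hb) (hne c hc)
      (hne e he) (g.symm.injective.ne hab) (g.symm.injective.ne hae)
      (g.symm.injective.ne hbc) (g.symm.injective.ne hce)))
  · rw [hcr]
    have h1 := hg.realCross_le_dual (g.symm.injective.ne hab) (g.symm.injective.ne hae)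
      (g.symm.injective.ne hbc) (g.symm.injective.ne hce)
    simp only [Homeomorph.apply_symm_apply] at h1
    exact (h.upper _ _ _ _ (hne a ha) (hne b hb) (hne c hc)
      (hne e he) (g.symm.injective.ne hab) (g.symm.injective.ne hae)
      (g.symm.injective.ne hbc) (g.symm.injective.ne hce)).trans (h₂.1 h1)

lemma QMMetric.exists_normTriple (h : QMMetric o ρ θ₁ θ₂) {t : Fin 3 → Z}
    (ht : Function.Injective t) (hto : ∀ i, t i ≠ o) :
    ∃ C > 0, ∃ δ > 0, NormTriple o ρ C δ t := by
  obtain ⟨M₁, hM₁⟩ := Finite.exists_le (fun q : Fin 3 × Fin 3 => ρ (t q.1) (t q.2))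
  obtain ⟨M₂, hM₂⟩ := Finite.exists_le (fun q : Fin 3 × Fin 3 => 1 / ρ (t q.1) (t q.2))
  obtain ⟨M₃, hM₃⟩ := Finite.exists_le (fun q : Fin 3 × Fin 3 => 1 / dist (t q.1) (t q.2))
  refine ⟨max (max M₁ M₂) 1, by positivity, 1 / max M₃ 1, by positivity, hto,
    fun i j hij => ?_, fun i j hij => ?_, fun i j hij => ?_⟩
  · have hp := h.pos _ _ (hto i) (hto j) (ht.ne hij)
    rw [div_le_comm₀ (by positivity) hp]
    exact (hM₂ (i, j)).trans ((le_max_right _ _).trans (le_max_left _ _))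
  · exact (hM₁ (i, j)).trans ((le_max_left _ _).trans (le_max_left _ _))
  · have hp := dist_pos.2 (ht.ne hij)
    rw [div_le_comm₀ (by positivity) hp]
    exact (hM₃ (i, j)).trans (le_max_left _ _)

lemma exists_tendsto_hyperfilter {E : Type*} [PseudoMetricSpace E] [ProperSpace E] {a : ℕ → E}
    {c : E} {M : ℝ} (h : ∀ᶠ k in (hyperfilter ℕ : Filter ℕ), dist (a k) c ≤ M) :
    ∃ l, Tendsto a (hyperfilter ℕ : Filter ℕ) (𝓝 l) := by
  obtain ⟨l, -, hl⟩ := (isCompact_closedBall c M).ultrafilter_le_nhds ((hyperfilter ℕ).map a)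
    (by rw [le_principal_iff]; exact h)
  exact ⟨l, hl⟩

lemma exists_dist_le [CompactSpace Z] : ∃ D, ∀ u v : Z, dist u v ≤ D :=
  ⟨Metric.diam (univ : Set Z), fun u v =>
    Metric.dist_le_diam_of_mem isCompact_univ.isBounded (mem_univ u) (mem_univ v)⟩

end blowup

/-- Blow-up of `(Z \ {o}, ρ)` at a point, realised on `Z \ {p}` by means of quasi-Möbius
homeomorphisms of `Z`. -/
theorem exists_blowup {Z : Type*} [MetricSpace Z] [CompactSpace Z] {o : Z} {ρ : Z → Z → ℝ}
    {θ₁ θ₂ : ℝ → ℝ} (h : QMMetric o ρ θ₁ θ₂) (h₁ : IsGauge θ₁) (h₂ : IsGauge θ₂)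
    (ho : (𝓝[≠] o).NeBot) {δ : ℝ} (hδ : 0 < δ) {η : NNReal ≃ₜ NNReal}
    (htriple : ∀ z₁ z₂ z₃ : Z, z₁ ≠ z₂ → z₁ ≠ z₃ → z₂ ≠ z₃ →
      ∃ g : Z ≃ₜ Z, IsQuasiMobius η g ∧
        δ ≤ dist (g z₁) (g z₂) ∧ δ ≤ dist (g z₁) (g z₃) ∧ δ ≤ dist (g z₂) (g z₃))
    {x₀ : Z} {C : ℝ} (hC : 0 < C) {s : ℕ → Fin 3 → Z} {r : ℕ → ℝ} (hs0 : ∀ k, s k 0 = x₀)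
    (hso : ∀ k i, s k i ≠ o) (hr : ∀ k, 0 < r k) (hr0 : Tendsto r atTop (𝓝 0))
    (hlow : ∀ k i j, i ≠ j → r k / C ≤ ρ (s k i) (s k j))
    (hhigh : ∀ k i j, i ≠ j → ρ (s k i) (s k j) ≤ C * r k) :
    ∃ (p : Z) (ρ' : Z → Z → ℝ) (g : ℕ → Z ≃ₜ Z),
      QMMetric p ρ' (gaugeOf η ∘ θ₁) (θ₂ ∘ gaugeOf (dualHomeo η)) ∧
      (∀ u, u ≠ p → ∃ M, ∀ᶠ k in (hyperfilter ℕ : Filter ℕ),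
        (g k).symm u ≠ o ∧ ρ ((g k).symm u) x₀ ≤ M * r k) ∧
      (∀ u v, u ≠ p → v ≠ p →
        Tendsto (fun k => ρ ((g k).symm u) ((g k).symm v) / r k) (hyperfilter ℕ : Filter ℕ)
          (𝓝 (ρ' u v))) ∧
      (∀ (w : ℕ → Z) (M : ℝ), (∀ᶠ k in (hyperfilter ℕ : Filter ℕ),
          w k ≠ o ∧ ρ (w k) x₀ ≤ M * r k) →
        ∃ u, u ≠ p ∧ Tendsto (fun k => ρ ((g k).symm u) (w k) / r k) (hyperfilter ℕ : Filter ℕ)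
          (𝓝 0)) := by
  obtain ⟨D, hD⟩ := exists_dist_le (Z := Z)
  have hsinj : ∀ k, Function.Injective (s k) := by
    intro k i j hij
    by_contra hne
    have h1 := hlow k i j hne
    rw [hij, h.self _ (hso k j)] at h1
    have := div_pos (hr k) hC
    linarith
  have hg : ∀ k, ∃ g : Z ≃ₜ Z, IsQuasiMobius η g ∧
      ∀ i j, i ≠ j → δ ≤ dist (g (s k i)) (g (s k j)) := by
    intro k
    obtain ⟨g, hg, h01, h02, h12⟩ := htriple (s k 0) (s k 1) (s k 2)
      ((hsinj k).ne (by decide)) ((hsinj k).ne (by decide)) ((hsinj k).ne (by decide))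
    refine ⟨g, hg, fun i j hij => ?_⟩
    fin_cases i <;> fin_cases j <;> first | exact absurd rfl hij | assumption | skip
    all_goals rw [dist_comm]; assumption
  choose g hgQ hgsep using hg
  set Θ₁ := gaugeOf η ∘ θ₁ with hΘ₁
  set Θ₂ := θ₂ ∘ gaugeOf (dualHomeo η) with hΘ₂
  have G₁ : IsGauge Θ₁ := (isGauge_gaugeOf η).comp h₁
  have G₂ : IsGauge Θ₂ := h₂.comp (isGauge_gaugeOf _)
  set σ : ℕ → Z → Z → ℝ := fun k u v => ρ ((g k).symm u) ((g k).symm v) / r k with hσ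
  have hQ : ∀ k, QMMetric (g k o) (σ k) Θ₁ Θ₂ := fun k => h.transport h₂ (hgQ k) (hr k)
  have hT : ∀ k, NormTriple (g k o) (σ k) C δ (fun i => g k (s k i)) := by
    intro k
    refine ⟨fun i => (g k).injective.ne (hso k i), fun i j hij => ?_, fun i j hij => ?_,
      fun i j hij => hgsep k i j hij⟩
    · simp only [hσ, Homeomorph.symm_apply_apply]
      rw [le_div_iff₀ (hr k)]
      have := hlow k i j hij
      rwa [div_mul_eq_mul_div, one_mul]
    · simp only [hσ, Homeomorph.symm_apply_apply]
      rw [div_le_iff₀ (hr k)]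
      exact hhigh k i j hij
  obtain ⟨p, hp⟩ := exists_tendsto_hyperfilter (a := fun k => g k o) (c := o) (M := D)
    (Eventually.of_forall fun k => hD _ _)
  have hcof : (hyperfilter ℕ : Filter ℕ) ≤ atTop := Nat.hyperfilter_le_atTop
  -- points tending to `p` whose `σ`-distance from the base point tends to infinity
  have hq : ∃ κ > 0, ∀ k : ℕ, ∃ c, c ≠ o ∧ dist (g k c) (g k o) < 1 / ((k : ℝ) + 1) ∧
      κ ≤ ρ c x₀ := by
    obtain ⟨C', hC', δ', hδ', hT'⟩ := h.exists_normTriple (hsinj 0) (hso 0)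
    have hx₀ : x₀ ≠ o := hs0 0 ▸ hso 0 0
    have hd : 0 < dist o x₀ / 2 := half_pos (dist_pos.2 hx₀.symm)
    obtain ⟨κ, hκ, hκ'⟩ := exists_dist_lt_of_rho_lt (θ₂ := θ₂) h₁ hC' hδ' hD hd
    refine ⟨κ, hκ, fun k => ?_⟩
    have e1 : ∀ᶠ c in 𝓝 o, dist (g k c) (g k o) < 1 / ((k : ℝ) + 1) :=
      (g k).continuous.continuousAt.eventually (Metric.ball_mem_nhds _ (by positivity))
    have e2 : ∀ᶠ c in 𝓝 o, dist c o < dist o x₀ / 2 := Metric.ball_mem_nhds _ hd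
    have e3 : ∀ᶠ c in 𝓝[≠] o, c ≠ o := self_mem_nhdsWithin
    obtain ⟨c, hc1, hc2, hc3⟩ :=
      ((e1.filter_mono nhdsWithin_le_nhds).and ((e2.filter_mono nhdsWithin_le_nhds).and e3)).exists
    refine ⟨c, hc3, hc1, ?_⟩
    by_contra! hlt
    have := hκ' o ρ (s 0) h hT' c x₀ hc3 hx₀ hlt
    have h4 := dist_triangle o c x₀
    rw [dist_comm o c] at h4
    linarith
  obtain ⟨κ, hκ, hq⟩ := hq
  choose c hco hcd hcκ using hq
  have hqp : Tendsto (fun k => g k (c k)) (hyperfilter ℕ : Filter ℕ) (𝓝 p) := by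
    refine hp.congr_dist ?_
    have h0 : Tendsto (fun k : ℕ => 1 / ((k : ℝ) + 1)) (hyperfilter ℕ : Filter ℕ) (𝓝 0) :=
      tendsto_one_div_add_atTop_nhds_zero_nat.mono_left hcof
    exact squeeze_zero (fun k => dist_nonneg)
      (fun k => by rw [dist_comm]; exact (hcd k).le) h0
  have hqinf : ∀ M : ℝ, ∀ᶠ k in (hyperfilter ℕ : Filter ℕ),
      M < σ k (g k (c k)) (g k (s k 0)) := by
    intro M
    have h1 : ∀ᶠ k in atTop, r k < κ / (|M| + 1) :=
      hr0.eventually (gt_mem_nhds (by positivity))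
    filter_upwards [hcof h1] with k hk
    simp only [hσ, Homeomorph.symm_apply_apply, hs0]
    rw [lt_div_iff₀ (by positivity)] at hk
    rw [lt_div_iff₀ (hr k)]
    nlinarith [hcκ k, hr k, le_abs_self M]
  have hqo : ∀ k, g k (c k) ≠ g k o := fun k => (g k).injective.ne (hco k)
  -- bounds for fixed points
  have hbound : ∀ u, u ≠ p → ∃ M, 0 ≤ M ∧ ∀ᶠ k in (hyperfilter ℕ : Filter ℕ),
      u ≠ g k o ∧ σ k u (g k (s k 0)) ≤ M := by
    intro u hu
    have hτ : 0 < dist u p / 2 := half_pos (dist_pos.2 hu)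
    obtain ⟨M, hM, hM'⟩ := exists_rho_le_of_far (θ₁ := Θ₁) G₂ hC hδ hD hτ
    refine ⟨M, hM.le, ?_⟩
    filter_upwards [hp.eventually (Metric.ball_mem_nhds p hτ),
      hqp.eventually (Metric.ball_mem_nhds p hτ), hqinf M] with k k1 k2 k3
    have hne : u ≠ g k o := by
      intro hh
      rw [← hh] at k1
      have : dist u p < dist u p / 2 := k1
      linarith
    refine ⟨hne, hM' _ _ _ (hQ k) (hT k) u (g k (c k)) hne (hqo k) k3 ?_⟩
    have h3 : dist (g k (c k)) p < dist u p / 2 := k2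
    linarith [dist_triangle u (g k (c k)) p]
  have hne : ∀ u, u ≠ p → ∀ᶠ k in (hyperfilter ℕ : Filter ℕ), u ≠ g k o := by
    intro u hu
    obtain ⟨M, -, hM⟩ := hbound u hu
    exact hM.mono fun k hk => hk.1
  have hlim : ∀ u v, u ≠ p → v ≠ p → ∃ l, Tendsto (fun k => σ k u v)
      (hyperfilter ℕ : Filter ℕ) (𝓝 l) := by
    intro u v hu hv
    obtain ⟨M, hM0, hM⟩ := hbound u hu
    obtain ⟨M', hM'0, hM'⟩ := hbound v hv
    refine exists_tendsto_hyperfilter (c := 0) (M := M + M') ?_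
    filter_upwards [hM, hM'] with k hk hk'
    have h0 := (hQ k).nonneg hk.1 hk'.1
    rw [Real.dist_eq, sub_zero, abs_of_nonneg h0]
    have := (hQ k).tri u (g k (s k 0)) v hk.1 ((hT k).ne 0) hk'.1
    rw [(hQ k).comm (g k (s k 0)) v ((hT k).ne 0) hk'.1] at this
    linarith [hk.2, hk'.2]
  set ρ' : Z → Z → ℝ := fun u v => limUnder (hyperfilter ℕ : Filter ℕ) (fun k => σ k u v) with hρ'
  have hT' : ∀ u v, u ≠ p → v ≠ p →
      Tendsto (fun k => σ k u v) (hyperfilter ℕ : Filter ℕ) (𝓝 (ρ' u v)) :=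
    fun u v hu hv => tendsto_nhds_limUnder (hlim u v hu hv)
  have hpos : ∀ u v, u ≠ p → v ≠ p → u ≠ v → 0 < ρ' u v := by
    intro u v hu hv huv
    obtain ⟨κ', hκ', hκ''⟩ := exists_dist_lt_of_rho_lt (θ₂ := Θ₂) G₁ hC hδ hD (dist_pos.2 huv)
    refine lt_of_lt_of_le hκ' (ge_of_tendsto (hT' u v hu hv) ?_)
    filter_upwards [hne u hu, hne v hv] with k k1 k2
    by_contra! hlt
    exact lt_irrefl _ (hκ'' _ _ _ (hQ k) (hT k) u v k1 k2 hlt)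
  have hcross : ∀ a b c e, a ≠ p → b ≠ p → c ≠ p → e ≠ p → a ≠ e → b ≠ c →
      Tendsto (fun k => realCross (σ k) a b c e) (hyperfilter ℕ : Filter ℕ)
        (𝓝 (realCross ρ' a b c e)) := by
    intro a b c e ha hb hc he hae hbc
    exact ((hT' a c ha hc).mul (hT' b e hb he)).div ((hT' a e ha he).mul (hT' b c hb hc))
      (mul_pos (hpos a e ha he hae) (hpos b c hb hc hbc)).ne'
  refine ⟨p, ρ', g, ⟨?_, ?_, ?_, hpos, ?_, ?_⟩, ?_, hT', ?_⟩
  · intro u hu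
    refine tendsto_nhds_unique (hT' u u hu hu) (tendsto_const_nhds.congr' ?_)
    filter_upwards [hne u hu] with k hk
    exact ((hQ k).self u hk).symm
  · intro u v hu hv
    refine tendsto_nhds_unique (hT' u v hu hv) ((hT' v u hv hu).congr' ?_)
    filter_upwards [hne u hu, hne v hv] with k hk hk'
    exact (hQ k).comm v u hk' hk
  · intro u v w hu hv hw
    refine le_of_tendsto_of_tendsto (hT' u w hu hw) ((hT' u v hu hv).add (hT' v w hv hw)) ?_
    filter_upwards [hne u hu, hne v hv, hne w hw] with k k1 k2 k3
    exact (hQ k).tri u v w k1 k2 k3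
  · intro a b c e ha hb hc he hab hae hbc hce
    refine ge_of_tendsto ((G₁.2.1.tendsto _).comp (hcross a b c e ha hb hc he hae hbc)) ?_
    filter_upwards [hne a ha, hne b hb, hne c hc, hne e he] with k k1 k2 k3 k4
    exact (hQ k).lower a b c e k1 k2 k3 k4 hab hae hbc hce
  · intro a b c e ha hb hc he hab hae hbc hce
    refine le_of_tendsto (hcross a b c e ha hb hc he hae hbc) ?_
    filter_upwards [hne a ha, hne b hb, hne c hc, hne e he] with k k1 k2 k3 k4
    exact (hQ k).upper a b c e k1 k2 k3 k4 hab hae hbc hce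
  · intro u hu
    obtain ⟨M, -, hM⟩ := hbound u hu
    refine ⟨M, hM.mono fun k hk => ⟨?_, ?_⟩⟩
    · intro hh; exact hk.1 (by rw [← hh]; simp)
    · have := hk.2
      simp only [hσ, Homeomorph.symm_apply_apply, hs0] at this
      rwa [div_le_iff₀ (hr k)] at this
  · intro w M hw
    obtain ⟨u, hu⟩ := exists_tendsto_hyperfilter (a := fun k => g k (w k)) (c := o) (M := D)
      (Eventually.of_forall fun k => hD _ _)
    have hwσ : ∀ᶠ k in (hyperfilter ℕ : Filter ℕ),
        g k (w k) ≠ g k o ∧ σ k (g k (w k)) (g k (s k 0)) ≤ |M| := by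
      filter_upwards [hw] with k hk
      refine ⟨(g k).injective.ne hk.1, ?_⟩
      simp only [hσ, Homeomorph.symm_apply_apply, hs0]
      rw [div_le_iff₀ (hr k)]
      exact hk.2.trans (mul_le_mul_of_nonneg_right (le_abs_self M) (hr k).le)
    have hup : u ≠ p := by
      rintro rfl
      obtain ⟨κ', hκ', hκ''⟩ := exists_rho_lt_of_dist_lt (θ₁ := Θ₁) G₂ hC hδ hD
        (abs_nonneg M) one_pos
      have hd : ∀ᶠ k in (hyperfilter ℕ : Filter ℕ), dist (g k (w k)) (g k (c k)) < κ' := by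
        have := hu.dist hqp
        rw [dist_self] at this
        exact this.eventually (gt_mem_nhds hκ')
      obtain ⟨k, k1, k2, k3⟩ := (hd.and (hwσ.and (hqinf (|M| + 1)))).exists
      have h4 := hκ'' _ _ _ (hQ k) (hT k) _ _ k2.1 (hqo k) k2.2 k1
      have h5 := (hQ k).tri (g k (c k)) (g k (w k)) (g k (s k 0)) (hqo k) k2.1 ((hT k).ne 0)
      rw [(hQ k).comm (g k (c k)) (g k (w k)) (hqo k) k2.1] at h5
      linarith [k2.2]
    refine ⟨u, hup, ?_⟩
    obtain ⟨Mu, hMu0, hMu⟩ := hbound u hup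
    rw [Metric.tendsto_nhds]
    intro ε hε
    obtain ⟨κ', hκ', hκ''⟩ := exists_rho_lt_of_dist_lt (θ₁ := Θ₁) G₂ hC hδ hD hMu0 hε
    have hd : ∀ᶠ k in (hyperfilter ℕ : Filter ℕ), dist u (g k (w k)) < κ' := by
      have := (tendsto_const_nhds (x := u)).dist hu
      rw [dist_self] at this
      exact this.eventually (gt_mem_nhds hκ')
    filter_upwards [hd, hMu, hwσ] with k k1 k2 k3
    have h4 := hκ'' _ _ _ (hQ k) (hT k) _ _ k2.1 k3.1 k2.2 k1
    have h0 := (hQ k).nonneg k2.1 k3.1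
    simp only [hσ, Homeomorph.symm_apply_apply] at h4 h0
    rw [Real.dist_eq, sub_zero, abs_of_nonneg h0]
    exact h4

section grid

variable {Z : Type*} [MetricSpace Z]

/-- `V` is an open set any two points of which are at distance less than `ε`. -/
def SmallOpen (ε : ℝ) (V : Set Z) : Prop := IsOpen V ∧ ∀ x ∈ V, ∀ y ∈ V, dist x y < ε

lemma SmallOpen.inter {ε : ℝ} {V W : Set Z} (hV : SmallOpen ε V) (hW : IsOpen W) :
    SmallOpen ε (V ∩ W) :=
  ⟨hV.1.inter hW, fun x hx y hy => hV.2 x hx.1 y hy.1⟩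

/-- `K` has arbitrarily fine open covers of order at most `n`. -/
def SmallOrder (n : ℕ) (K : Set Z) : Prop :=
  ∀ ε > 0, ∃ 𝒱 : Set (Set Z), (∀ V ∈ 𝒱, SmallOpen ε V) ∧ K ⊆ ⋃₀ 𝒱 ∧
    ∀ x, {V ∈ 𝒱 | x ∈ V}.encard ≤ n

lemma SmallOrder.covDimLE [CompactSpace Z] [Nonempty Z] {n : ℕ}
    (h : SmallOrder (n + 1) (univ : Set Z)) : covDimLE Z n := by
  intro 𝒰 h𝒰 hcov
  obtain ⟨ε, hε, hleb⟩ := lebesgue_number_lemma_of_metric_sUnion isCompact_univ h𝒰 hcov.ge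
  obtain ⟨𝒱, h𝒱, hc, hord⟩ := h ε hε
  refine ⟨{V ∈ 𝒱 | V.Nonempty}, fun V hV => (h𝒱 V hV.1).1, ?_, ?_, ?_⟩
  · refine eq_univ_of_forall fun x => ?_
    obtain ⟨V, hV, hx⟩ := hc (mem_univ x)
    exact ⟨V, ⟨hV, x, hx⟩, hx⟩
  · rintro V ⟨hV, x, hx⟩
    obtain ⟨U, hU, hb⟩ := hleb x (mem_univ x)
    exact ⟨U, hU, fun y hy => hb ((h𝒱 V hV).2 y hy x hx)⟩
  · intro x
    refine le_trans (encard_le_encard ?_) (hord x)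
    rintro V ⟨⟨hV, -⟩, hx⟩
    exact ⟨hV, hx⟩

/-- Distance to the nearest integer. -/
def distInt (t : ℝ) : ℝ := |t - round t|

lemma continuous_distInt : Continuous distInt := by
  have : distInt = fun t : ℝ => ‖(t : UnitAddCircle)‖ := by
    funext t; exact UnitAddCircle.norm_eq.symm
  rw [this]
  exact continuous_norm.comp (AddCircle.continuous_mk' 1)

lemma distInt_le (t : ℝ) : distInt t ≤ 1 / 2 := abs_sub_round t

lemma distInt_eq_half_iff {t : ℝ} : distInt t = 1 / 2 ↔ ∃ m : ℤ, t = m + 1 / 2 := by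
  constructor
  · intro h
    rcases abs_eq (by norm_num : (0 : ℝ) ≤ 1 / 2) |>.1 h with h | h
    · exact ⟨round t, by linarith⟩
    · exact ⟨round t - 1, by push_cast; linarith⟩
  · rintro ⟨m, rfl⟩
    have h1 := abs_sub_round ((m : ℝ) + 1 / 2)
    unfold distInt
    refine le_antisymm h1 ?_
    set k := round ((m : ℝ) + 1 / 2)
    by_contra! hlt
    rw [abs_lt] at hlt
    have h2 : (m : ℝ) < k := by linarith [hlt.2]
    have h3 : (k : ℝ) < m + 1 := by linarith [hlt.1]
    have h4 : m < k := by exact_mod_cast h2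
    have h5 : k < m + 1 := by exact_mod_cast h3
    omega

/-- An open piece of the grid decomposition of `ℝ^ι`, with label `(I, m)`. -/
def gridPiece {ι : Type*} (I : Finset ι) (m : ι → ℤ) : Set (ι → ℝ) :=
  {u | (∀ i ∈ I, |u i - m i| < 1 / 2) ∧ (∀ j ∉ I, m j < u j ∧ u j < m j + 1) ∧
    ∀ i ∈ I, ∀ j ∉ I, distInt (u i) < distInt (u j)}

lemma isOpen_gridPiece {ι : Type*} [Finite ι] (I : Finset ι) (m : ι → ℤ) :
    IsOpen (gridPiece I m) := by
  have e : gridPiece I m = (⋂ i ∈ I, {u : ι → ℝ | |u i - m i| < 1 / 2}) ∩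
      (⋂ j ∈ (I : Set ι)ᶜ, {u : ι → ℝ | m j < u j ∧ u j < m j + 1}) ∩
      (⋂ i ∈ I, ⋂ j ∈ (I : Set ι)ᶜ, {u : ι → ℝ | distInt (u i) < distInt (u j)}) := by
    ext u; simp [gridPiece, and_assoc]
  rw [e]
  refine ((isOpen_biInter_finset fun i _ => ?_).inter
    (Set.Finite.isOpen_biInter (toFinite _) fun j _ => ?_)).inter
    (isOpen_biInter_finset fun i _ => Set.Finite.isOpen_biInter (toFinite _) fun j _ => ?_)
  · exact isOpen_lt (by fun_prop) continuous_const
  · exact (isOpen_lt continuous_const (continuous_apply j)).inter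
      (isOpen_lt (continuous_apply j) continuous_const)
  · exact isOpen_lt (continuous_distInt.comp (continuous_apply i))
      (continuous_distInt.comp (continuous_apply j))

lemma abs_sub_lt_of_mem_gridPiece {ι : Type*} {I : Finset ι} {m : ι → ℤ} {u v : ι → ℝ}
    (hu : u ∈ gridPiece I m) (hv : v ∈ gridPiece I m) (i : ι) : |u i - v i| < 1 := by
  rw [abs_lt]
  by_cases hi : i ∈ I
  · have h1 := abs_lt.1 (hu.1 i hi)
    have h2 := abs_lt.1 (hv.1 i hi)
    constructor <;> linarith [h1.1, h1.2, h2.1, h2.2]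
  · have h1 := hu.2.1 i hi
    have h2 := hv.2.1 i hi
    constructor <;> linarith [h1.1, h1.2, h2.1, h2.2]

lemma gridPiece_label_unique {ι : Type*} {I I' : Finset ι} {m m' : ι → ℤ} {u : ι → ℝ}
    (hu : u ∈ gridPiece I m) (hu' : u ∈ gridPiece I' m') (hc : I.card = I'.card) :
    I = I' ∧ m = m' := by
  have hI : I = I' := by
    by_contra hne
    have h1 : ¬ I ⊆ I' := fun hs => hne (Finset.eq_of_subset_of_card_le hs hc.ge)
    have h2 : ¬ I' ⊆ I := fun hs => hne (Finset.eq_of_subset_of_card_le hs hc.le).symm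
    obtain ⟨i, hi, hi'⟩ := Finset.not_subset.1 h1
    obtain ⟨j, hj, hj'⟩ := Finset.not_subset.1 h2
    exact lt_asymm (hu.2.2 i hi j hj') (hu'.2.2 j hj i hi')
  subst hI
  refine ⟨rfl, funext fun i => ?_⟩
  by_cases hi : i ∈ I
  · have h1 := abs_lt.1 (hu.1 i hi)
    have h2 := abs_lt.1 (hu'.1 i hi)
    have h3 : (m i : ℝ) < m' i + 1 := by linarith [h1.1, h1.2, h2.1, h2.2]
    have h4 : (m' i : ℝ) < m i + 1 := by linarith [h1.1, h1.2, h2.1, h2.2]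
    have h5 : m i < m' i + 1 := by exact_mod_cast h3
    have h6 : m' i < m i + 1 := by exact_mod_cast h4
    omega
  · have h1 := hu.2.1 i hi
    have h2 := hu'.2.1 i hi
    have h3 : (m i : ℝ) < m' i + 1 := by linarith [h1.1, h1.2, h2.1, h2.2]
    have h4 : (m' i : ℝ) < m i + 1 := by linarith [h1.1, h1.2, h2.1, h2.2]
    have h5 : m i < m' i + 1 := by exact_mod_cast h3
    have h6 : m' i < m i + 1 := by exact_mod_cast h4
    omega

open Classical in
lemma exists_mem_gridPiece {ι : Type*} [Fintype ι] {n : ℕ} {u : ι → ℝ}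
    (hu : (Finset.univ.filter fun i => distInt (u i) = 1 / 2).card < n) :
    ∃ (I : Finset ι) (m : ι → ℤ), Fintype.card ι < I.card + n ∧ u ∈ gridPiece I m := by
  set I := Finset.univ.filter fun i => distInt (u i) < 1 / 2 with hI
  have hmem : ∀ i, i ∈ I ↔ distInt (u i) < 1 / 2 := fun i => by simp [hI]
  have hnot : ∀ i, i ∉ I → distInt (u i) = 1 / 2 := fun i hi =>
    le_antisymm (distInt_le _) (not_lt.1 fun h => hi ((hmem i).2 h))
  refine ⟨I, fun i => if i ∈ I then round (u i) else ⌊u i⌋, ?_, ?_, ?_, ?_⟩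
  · have h1 : Iᶜ ⊆ Finset.univ.filter fun i => distInt (u i) = 1 / 2 := fun i hi => by
      simp only [Finset.mem_filter, Finset.mem_univ, true_and]
      exact hnot i (Finset.mem_compl.1 hi)
    have h2 := Finset.card_le_card h1
    have h3 := Finset.card_add_card_compl I
    omega
  · intro i hi
    simp only [hi, if_true]
    exact (hmem i).1 hi
  · intro j hj
    simp only [hj, if_false]
    refine ⟨lt_of_le_of_ne (Int.floor_le _) fun h => ?_, Int.lt_floor_add_one _⟩
    have h1 := hnot j hj
    rw [distInt, ← h, round_intCast] at h1
    norm_num at h1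
  · intro i hi j hj
    rw [hnot j hj]
    exact (hmem i).1 hi

open Classical in
/-- A map to `ℝ^ι` with fewer than `n` half-integral coordinates on `K`, whose fibres over unit
cubes split into small pieces, yields small covers of order at most `n`. -/
lemma exists_cover_of_grid {ι : Type*} [Fintype ι] {n : ℕ} {K : Set Z} {Φ : Z → ι → ℝ}
    (hΦ : Continuous Φ)
    (hgen : ∀ x ∈ K, (Finset.univ.filter fun i => distInt (Φ x i) = 1 / 2).card < n)
    {ε : ℝ}
    (hsplit : ∀ y : ι → ℝ, ∃ 𝒲 : Set (Set Z), (∀ W ∈ 𝒲, SmallOpen ε W) ∧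
      (∀ W ∈ 𝒲, ∀ W' ∈ 𝒲, W ≠ W' → Disjoint W W') ∧
      {x ∈ K | ∀ i, |Φ x i - y i| < 1} ⊆ ⋃₀ 𝒲) :
    ∃ 𝒱 : Set (Set Z), (∀ V ∈ 𝒱, SmallOpen ε V) ∧ K ⊆ ⋃₀ 𝒱 ∧
      ∀ x, {V ∈ 𝒱 | x ∈ V}.encard ≤ n := by
  choose 𝒲 h𝒲o h𝒲d h𝒲c using hsplit
  have hy : ∀ (I : Finset ι) (m : ι → ℤ), ∃ y : ι → ℝ, ∀ u ∈ gridPiece I m, ∀ i,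
      |u i - y i| < 1 := by
    intro I m
    by_cases hne : (gridPiece I m).Nonempty
    · obtain ⟨y, hy⟩ := hne
      exact ⟨y, fun u hu i => abs_sub_lt_of_mem_gridPiece hu hy i⟩
    · exact ⟨0, fun u hu => absurd ⟨u, hu⟩ hne⟩
  choose y hy using hy
  set 𝒱 : Set (Set Z) := {V | ∃ (I : Finset ι) (m : ι → ℤ) (W : Set Z),
    Fintype.card ι < I.card + n ∧ W ∈ 𝒲 (y I m) ∧ V = W ∩ Φ ⁻¹' gridPiece I m} with h𝒱
  refine ⟨𝒱, ?_, ?_, fun x => ?_⟩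
  · rintro V ⟨I, m, W, -, hW, rfl⟩
    exact (h𝒲o _ W hW).inter ((isOpen_gridPiece I m).preimage hΦ)
  · intro x hx
    obtain ⟨I, m, hc, hm⟩ := exists_mem_gridPiece (hgen x hx)
    obtain ⟨W, hW, hxW⟩ := h𝒲c (y I m) ⟨hx, hy I m _ hm⟩
    exact ⟨_, ⟨I, m, W, hc, hW, rfl⟩, hxW, hm⟩
  · have hch : ∀ V : Set Z, ∃ c : ℕ, V ∈ 𝒱 → ∃ (I : Finset ι) (m : ι → ℤ) (W : Set Z),
        Fintype.card ι < I.card + n ∧ W ∈ 𝒲 (y I m) ∧ V = W ∩ Φ ⁻¹' gridPiece I m ∧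
        I.card = c := by
      intro V
      by_cases hV : V ∈ 𝒱
      · obtain ⟨I, m, W, h1, h2, h3⟩ := hV
        exact ⟨I.card, fun _ => ⟨I, m, W, h1, h2, h3, rfl⟩⟩
      · exact ⟨0, fun h => absurd h hV⟩
    choose c hc using hch
    have hmaps : MapsTo c {V ∈ 𝒱 | x ∈ V}
        (Finset.Icc (Fintype.card ι + 1 - n) (Fintype.card ι) : Finset ℕ) := by
      rintro V ⟨hV, -⟩
      obtain ⟨I, m, W, h1, -, -, h4⟩ := hc V hV
      have := Finset.card_le_univ I
      simp only [Finset.coe_Icc, mem_Icc]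
      omega
    have hinj : InjOn c {V ∈ 𝒱 | x ∈ V} := by
      rintro V ⟨hV, hxV⟩ V' ⟨hV', hxV'⟩ hcc
      obtain ⟨I, m, W, h1, h2, h3, h4⟩ := hc V hV
      obtain ⟨I', m', W', h1', h2', h3', h4'⟩ := hc V' hV'
      rw [h3] at hxV
      rw [h3'] at hxV'
      obtain ⟨rfl, rfl⟩ := gridPiece_label_unique hxV.2 hxV'.2 (by omega)
      have : W = W' := by
        by_contra hne
        exact Set.disjoint_left.1 (h𝒲d _ W h2 W' h2' hne) hxV.1 hxV'.1
      rw [h3, h3', this]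
    refine (encard_le_encard_of_injOn hmaps hinj).trans ?_
    rw [encard_coe_eq_coe_finsetCard, Nat.card_Icc]
    exact_mod_cast (by omega : Fintype.card ι + 1 - (Fintype.card ι + 1 - n) ≤ n)

end grid

section thin

variable {Z : Type*} [MetricSpace Z]

open Classical in
/-- In a class of maps in which one can always avoid a point with `n` coordinates by a small
perturbation, one can make fewer than `n` coordinates half-integral. -/
lemma exists_generic_perturbation [CompactSpace Z] {ι : Type*} [Fintype ι] {n : ℕ}
    {A : (Z → ι → ℝ) → Prop} (hAc : ∀ Φ, A Φ → Continuous Φ)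
    (hA : ∀ Φ, A Φ → ∀ (e : Fin n ↪ ι) (c : Fin n → ℝ), ∀ γ > 0, ∃ Ψ, A Ψ ∧
      (∀ x i, |Ψ x i - Φ x i| < γ) ∧ ∀ x, (fun j => Ψ x (e j)) ≠ c)
    {Φ : Z → ι → ℝ} (hΦ : A Φ) :
    ∃ Ψ, A Ψ ∧ (∀ x i, |Ψ x i - Φ x i| < 1) ∧
      ∀ x, (Finset.univ.filter fun i => distInt (Ψ x i) = 1 / 2).card < n := by
  have key : ∀ (S : Finset ((Fin n ↪ ι) × (Fin n → ℝ))), ∀ γ > 0, ∃ Ψ, A Ψ ∧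
      (∀ x i, |Ψ x i - Φ x i| < γ) ∧ ∃ β > 0, ∀ p ∈ S, ∀ x,
        β ≤ dist (fun j => Ψ x (p.1 j)) p.2 := by
    intro S
    induction S using Finset.induction_on with
    | empty => exact fun γ hγ => ⟨Φ, hΦ, fun x i => by simpa using hγ, 1, one_pos, by simp⟩
    | insert q S hq ih =>
      intro γ hγ
      obtain ⟨Ψ₀, hA₀, hd₀, β, hβ, hS⟩ := ih (γ / 2) (by positivity)
      obtain ⟨Ψ, hAΨ, hd, hne⟩ := hA Ψ₀ hA₀ q.1 q.2 (min (β / 2) (γ / 2)) (by positivity)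
      have hcont : Continuous fun x => dist (fun j => Ψ x (q.1 j)) q.2 := by
        have h1 : Continuous fun x => (fun j => Ψ x (q.1 j)) :=
          continuous_pi fun j => (continuous_apply (q.1 j)).comp (hAc Ψ hAΨ)
        exact h1.dist continuous_const
      obtain ⟨β₁, hβ₁, hq₁⟩ := isCompact_univ.exists_forall_le' hcont.continuousOn
        (fun x _ => dist_pos.2 (hne x))
      refine ⟨Ψ, hAΨ, fun x i => ?_, min (β / 2) β₁, by positivity, fun p hp x => ?_⟩
      · have h1 := (hd x i).trans_le (min_le_right _ _)
        have h2 := hd₀ x i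
        have h3 := abs_sub_le (Ψ x i) (Ψ₀ x i) (Φ x i)
        linarith
      · rcases Finset.mem_insert.1 hp with rfl | hp
        · exact (min_le_right _ _).trans (hq₁ x (mem_univ x))
        · refine (min_le_left _ _).trans ?_
          have h1 := hS p hp x
          have h2 : dist (fun j => Ψ₀ x (p.1 j)) (fun j => Ψ x (p.1 j)) ≤ β / 2 := by
            rw [dist_pi_le_iff (by positivity)]
            intro j
            rw [dist_comm, Real.dist_eq]
            exact (hd x (p.1 j)).le.trans (min_le_left _ _)
          have h3 := dist_triangle (fun j => Ψ₀ x (p.1 j)) (fun j => Ψ x (p.1 j)) p.2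
          linarith
  have hb : ∃ B : ℝ, ∀ x i, |Φ x i| ≤ B := by
    obtain ⟨B, hB⟩ := isCompact_univ.exists_bound_of_continuousOn (hAc Φ hΦ).continuousOn
    refine ⟨B, fun x i => ?_⟩
    rw [← Real.norm_eq_abs]
    exact (norm_le_pi_norm (Φ x) i).trans (hB x (mem_univ x))
  obtain ⟨B, hB⟩ := hb
  obtain ⟨k, hk⟩ := exists_nat_ge (B + 2)
  obtain ⟨Ψ, hAΨ, hd, β, hβ, hS⟩ := key (Finset.univ ×ˢ
    (Fintype.piFinset fun _ : Fin n => Finset.Icc (-(k : ℤ)) k).image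
      fun m j => (m j : ℝ) + 1 / 2) 1 one_pos
  refine ⟨Ψ, hAΨ, hd, fun x => ?_⟩
  by_contra! hcard
  obtain ⟨e⟩ : Nonempty (Fin n ↪ {i // i ∈ Finset.univ.filter fun i => distInt (Ψ x i) = 1 / 2}) :=
    Function.Embedding.nonempty_of_card_le (by
      rw [Fintype.card_coe, Fintype.card_fin]; exact hcard)
  have he : ∀ j, ∃ m : ℤ, Ψ x (e j).1 = m + 1 / 2 := fun j =>
    distInt_eq_half_iff.1 (by have := (e j).2; simpa using this)
  choose m hm using he
  have hmem : ((e.trans (Function.Embedding.subtype _), fun j => (m j : ℝ) + 1 / 2) :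
      (Fin n ↪ ι) × (Fin n → ℝ)) ∈ (Finset.univ ×ˢ
    (Fintype.piFinset fun _ : Fin n => Finset.Icc (-(k : ℤ)) k).image
      fun m j => (m j : ℝ) + 1 / 2) := by
    refine Finset.mem_product.2 ⟨Finset.mem_univ _, Finset.mem_image.2 ⟨m, ?_, rfl⟩⟩
    rw [Fintype.mem_piFinset]
    intro j
    have h1 := abs_lt.1 (hd x (e j).1)
    have h2 := abs_le.1 (hB x (e j).1)
    rw [hm j] at h1
    rw [Finset.mem_Icc]
    have h3 : (-(k : ℝ)) ≤ m j := by linarith [h1.1, h2.1]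
    have h4 : (m j : ℝ) ≤ k := by linarith [h1.2, h2.2]
    exact ⟨by exact_mod_cast h3, by exact_mod_cast h4⟩
  have h5 := hS _ hmem x
  have h6 : (fun j => Ψ x ((e.trans (Function.Embedding.subtype _)) j)) =
      fun j => (m j : ℝ) + 1 / 2 := funext fun j => hm j
  simp only at h5
  rw [h6, dist_self] at h5
  linarith

lemma smallOrder_univ_of_generic [CompactSpace Z] {n : ℕ} {A : ∀ t : Finset Z, (Z → t → ℝ) → Prop}
    (hAc : ∀ t Φ, A t Φ → Continuous Φ)
    (hA : ∀ t Φ, A t Φ → ∀ (e : Fin n ↪ t) (c : Fin n → ℝ), ∀ γ > 0, ∃ Ψ, A t Ψ ∧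
      (∀ x i, |Ψ x i - Φ x i| < γ) ∧ ∀ x, (fun j => Ψ x (e j)) ≠ c)
    (hdist : ∀ (t : Finset Z) (s : ℝ), A t fun x i => s * dist x i) :
    SmallOrder n (univ : Set Z) := by
  intro ε hε
  obtain ⟨t, -, ht⟩ := (isCompact_univ (X := Z)).elim_nhds_subcover (fun z => ball z (ε / 8))
    (fun z _ => ball_mem_nhds z (by positivity))
  obtain ⟨Ψ, hΨ, hd, hgen⟩ := exists_generic_perturbation (hAc t) (hA t) (hdist t (8 / ε))
  refine exists_cover_of_grid (hAc t Ψ hΨ) (fun x _ => hgen x) fun y =>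
    ⟨{{x | ∀ i, |Ψ x i - y i| < 1}}, ?_, ?_, ?_⟩
  · rintro W rfl
    refine ⟨?_, fun x hx x' hx' => ?_⟩
    · have : {x | ∀ i, |Ψ x i - y i| < 1} = ⋂ i, {x | |Ψ x i - y i| < 1} := by ext; simp
      rw [this]
      refine isOpen_iInter_of_finite fun i => isOpen_lt ?_ continuous_const
      exact (((continuous_apply i).comp (hAc t Ψ hΨ)).sub continuous_const).abs
    · obtain ⟨z, hz, hxz⟩ : ∃ z ∈ t, dist x z < ε / 8 := by simpa using ht (mem_univ x)
      have h1 := abs_lt.1 (hx ⟨z, hz⟩)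
      have h2 := abs_lt.1 (hx' ⟨z, hz⟩)
      have h3 := abs_lt.1 (hd x ⟨z, hz⟩)
      have h4 := abs_lt.1 (hd x' ⟨z, hz⟩)
      have h5 : 8 / ε * dist x' z < 8 / ε * dist x z + 4 := by
        linarith [h1.1, h1.2, h2.1, h2.2, h3.1, h3.2, h4.1, h4.2]
      have h6 : dist x' z < dist x z + ε / 2 := by
        have := mul_lt_mul_of_pos_left h5 (by positivity : 0 < ε / 8)
        have e1 : ε / 8 * (8 / ε * dist x' z) = dist x' z := by field_simp
        have e2 : ε / 8 * (8 / ε * dist x z + 4) = dist x z + ε / 2 := by field_simp; ring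
        rwa [e1, e2] at this
      have := dist_triangle_right x x' z
      linarith
  · rintro W rfl W' rfl hne
    exact absurd rfl hne
  · rintro x ⟨-, hx⟩
    exact ⟨_, rfl, hx⟩

/-- Every map to `ℝⁿ` can be pushed off the origin on `K` by an arbitrarily small perturbation. -/
def Thin (n : ℕ) (K : Set Z) : Prop :=
  ∀ f : Z → EuclideanSpace ℝ (Fin n), Continuous f → ∀ ε > 0,
    ∃ f' : Z → EuclideanSpace ℝ (Fin n), Continuous f' ∧ (∀ x, dist (f' x) (f x) < ε) ∧
      ∀ x ∈ K, f' x ≠ 0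

lemma Thin.mono {n : ℕ} {K K' : Set Z} (h : Thin n K) (hK : K' ⊆ K) : Thin n K' := by
  intro f hf ε hε
  obtain ⟨f', h1, h2, h3⟩ := h f hf ε hε
  exact ⟨f', h1, h2, fun x hx => h3 x (hK hx)⟩

lemma Thin.image {n : ℕ} {K : Set Z} (h : Thin n K) (g : Z ≃ₜ Z) : Thin n (g '' K) := by
  intro f hf ε hε
  obtain ⟨f', h1, h2, h3⟩ := h (f ∘ g) (hf.comp g.continuous) ε hε
  refine ⟨f' ∘ g.symm, h1.comp g.symm.continuous, fun x => ?_, ?_⟩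
  · simpa using h2 (g.symm x)
  · rintro _ ⟨x, hx, rfl⟩
    simpa using h3 x hx

lemma Thin.smallOrder_univ [CompactSpace Z] {n : ℕ} (h : Thin n (univ : Set Z)) :
    SmallOrder n (univ : Set Z) := by
  refine smallOrder_univ_of_generic (A := fun _ Φ => Continuous Φ) (fun _ _ h => h) ?_
    (fun t s => by fun_prop)
  intro t Φ hΦ e c γ hγ
  have hΦi : ∀ i, Continuous fun x => Φ x i := fun i => (continuous_apply i).comp hΦ
  set f : Z → EuclideanSpace ℝ (Fin n) := fun x => WithLp.toLp 2 fun j => Φ x (e j) - c j with hfd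
  have hf : Continuous f := by
    refine (PiLp.continuous_toLp 2 _).comp (continuous_pi fun j => (hΦi _).sub continuous_const)
  obtain ⟨f', hf', hd, hne⟩ := h f hf γ hγ
  have hf'j : ∀ j, Continuous fun x => f' x j := fun j =>
    (continuous_apply j).comp ((PiLp.continuous_ofLp 2 _).comp hf')
  refine ⟨fun x => Function.extend e (fun j => f' x j + c j) (Φ x), ?_, ?_, ?_⟩
  · refine continuous_pi fun i => ?_
    by_cases hi : ∃ j, e j = i
    · obtain ⟨j, rfl⟩ := hi
      simp only [e.injective.extend_apply]
      exact (hf'j j).add continuous_const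
    · simp only [Function.extend_apply' _ _ _ hi]
      exact hΦi i
  · intro x i
    by_cases hi : ∃ j, e j = i
    · obtain ⟨j, rfl⟩ := hi
      simp only [e.injective.extend_apply]
      have h1 := hd x
      rw [dist_eq_norm] at h1
      have h2 := PiLp.norm_apply_le (f' x - f x) j
      have e1 : f' x j + c j - Φ x (e j) = (f' x - f x) j := by simp [hfd]; ring
      rw [e1, ← Real.norm_eq_abs]
      exact h2.trans_lt h1
    · simp only [Function.extend_apply' _ _ _ hi]
      simpa using hγ
  · intro x hx
    refine hne x (mem_univ x) ?_
    ext j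
    have := congrFun hx j
    simp only [e.injective.extend_apply] at this
    simpa using this

/-- If all Lipschitz images in `ℝⁿ` are null, then there are small covers of order `n`. -/
lemma smallOrder_univ_of_null [CompactSpace Z] {n : ℕ}
    (h : ∀ f : Z → EuclideanSpace ℝ (Fin n), (∃ L, LipschitzWith L f) → volume (range f) = 0) :
    SmallOrder n (univ : Set Z) := by
  refine smallOrder_univ_of_generic (A := fun _ Φ => ∃ L, LipschitzWith L Φ)
    (fun _ _ h => h.elim fun L hL => hL.continuous) ?_ ?_
  · rintro t Φ ⟨L, hL⟩ e c γ hγ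
    set f : Z → EuclideanSpace ℝ (Fin n) := fun x => WithLp.toLp 2 fun j => Φ x (e j) with hf
    have hfL : ∃ L, LipschitzWith L f := by
      have h1 : LipschitzWith 1 fun u : t → ℝ => fun j => u (e j) :=
        LipschitzWith.mk_one fun u v => by
          rw [dist_pi_le_iff dist_nonneg]
          exact fun j => dist_le_pi_dist u v (e j)
      exact ⟨_, (PiLp.lipschitzWith_toLp 2 _).comp (h1.comp hL)⟩
    have hdense : Dense (range f)ᶜ :=
      Measure.dense_of_ae (measure_eq_zero_iff_ae_notMem.1 (h f hfL))
    set c' : EuclideanSpace ℝ (Fin n) := WithLp.toLp 2 c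
    obtain ⟨y, hy, hyd⟩ := Metric.dense_iff.1 hdense c' γ hγ
    refine ⟨fun x i => Φ x i + Function.extend e (fun j => c' j - y j) 0 i, ⟨L, ?_⟩, ?_, ?_⟩
    · refine LipschitzWith.of_dist_le_mul fun u v => ?_
      rw [dist_pi_le_iff (by positivity)]
      intro i
      rw [dist_add_right]
      exact (dist_le_pi_dist _ _ i).trans (hL.dist_le_mul u v)
    · intro x i
      rw [add_sub_cancel_left]
      by_cases hi : ∃ j, e j = i
      · obtain ⟨j, rfl⟩ := hi
        rw [e.injective.extend_apply]
        rw [mem_ball, dist_comm, dist_eq_norm] at hy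
        exact (PiLp.norm_apply_le (c' - y) j).trans_lt hy
      · simpa [Function.extend_apply' _ _ _ hi] using hγ
    · intro x hx
      refine hyd ⟨x, ?_⟩
      ext j
      have := congrFun hx j
      simp only [e.injective.extend_apply] at this
      simp only [hf]
      have e1 : c' j = c j := rfl
      rw [e1] at this
      linarith
  · intro t s
    refine ⟨‖s‖₊, LipschitzWith.of_dist_le_mul fun u v => ?_⟩
    rw [dist_pi_le_iff (by positivity)]
    intro i
    rw [Real.dist_eq, ← mul_sub, abs_mul, coe_nnnorm, Real.norm_eq_abs]
    gcongr
    exact abs_dist_sub_le u v _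

end thin

section thin

variable {Z : Type*} [MetricSpace Z]

open Classical in
lemma SmallOrder.thin [CompactSpace Z] {n : ℕ} {K : Set Z} (hK : IsClosed K)
    (h : SmallOrder n K) : Thin n K := by
  intro f hf ε hε
  obtain ⟨ω, hω, hfω⟩ := Metric.uniformContinuous_iff.1
    (CompactSpace.uniformContinuous_of_continuous hf) (ε / 2) (by positivity)
  obtain ⟨𝒱, h𝒱, hc, hord⟩ := h ω hω
  obtain ⟨T, hT𝒱, hTfin, hTc⟩ : ∃ T ⊆ 𝒱, T.Finite ∧ K ⊆ ⋃₀ T := by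
    obtain ⟨T, hT, hTf, hTc⟩ := hK.isCompact.elim_finite_subcover_image (b := 𝒱) (c := id)
      (fun V hV => (h𝒱 V hV).1) (by simpa [sUnion_eq_biUnion] using hc)
    exact ⟨T, hT, hTf, by simpa [sUnion_eq_biUnion] using hTc⟩
  have hTF : Fintype T := hTfin.fintype
  obtain ⟨P, hP⟩ := PartitionOfUnity.exists_isSubordinate hK (fun V : T => (V : Set Z))
    (fun V => (h𝒱 V (hT𝒱 V.2)).1) (by rw [← sUnion_eq_iUnion]; exact hTc)
  have hpt : ∀ V : T, ∃ z : EuclideanSpace ℝ (Fin n), ∀ x ∈ (V : Set Z), dist z (f x) < ε / 2 := by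
    intro V
    by_cases hne : (V : Set Z).Nonempty
    · obtain ⟨z, hz⟩ := hne
      exact ⟨f z, fun x hx => hfω ((h𝒱 V (hT𝒱 V.2)).2 z hz x hx)⟩
    · exact ⟨0, fun x hx => absurd ⟨x, hx⟩ hne⟩
  choose z hz using hpt
  have hPV : ∀ (V : T) x, P V x ≠ 0 → x ∈ (V : Set Z) := fun V x hx =>
    hP V (subset_tsupport _ hx)
  set f₁ : Z → EuclideanSpace ℝ (Fin n) := fun x => f x + ∑ V : T, P V x • (z V - f x) with hf₁
  have hf₁c : Continuous f₁ := by
    refine hf.add (continuous_finsetSum _ fun V _ => ?_)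
    exact (P V).continuous.smul (continuous_const.sub hf)
  have hf₁d : ∀ x, dist (f₁ x) (f x) ≤ ε / 2 := by
    intro x
    rw [dist_eq_norm]
    simp only [hf₁, add_sub_cancel_left]
    have hsum : ∑ V : T, P V x ≤ 1 := by
      have := P.sum_le_one x
      rwa [finsum_eq_sum_of_fintype] at this
    calc ‖∑ V : T, P V x • (z V - f x)‖ ≤ ∑ V : T, P V x * (ε / 2) := by
          refine norm_sum_le_of_le _ fun V _ => ?_
          rw [norm_smul, Real.norm_eq_abs, abs_of_nonneg (P.nonneg V x)]
          by_cases h0 : P V x = 0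
          · simp [h0]
          · gcongr
            · exact P.nonneg V x
            · rw [← dist_eq_norm]
              exact (hz V x (hPV V x h0)).le
      _ = (∑ V : T, P V x) * (ε / 2) := by rw [Finset.sum_mul]
      _ ≤ 1 * (ε / 2) := by gcongr
      _ = ε / 2 := one_mul _
  set B : Set (EuclideanSpace ℝ (Fin n)) := ⋃ S ∈ {S : Finset T | 0 < S.card ∧ S.card ≤ n},
    (affineSpan ℝ ((S.image z : Finset _) : Set (EuclideanSpace ℝ (Fin n))) : Set _) with hB
  have hBnull : volume B = 0 := by
    refine (measure_biUnion_null_iff (to_countable _)).2 fun S hS => ?_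
    refine Measure.addHaar_affineSubspace _ _ fun htop => ?_
    obtain ⟨k, hk⟩ : ∃ k, S.card = k + 1 := ⟨S.card - 1, by have := hS.1; omega⟩
    have h1 := finrank_vectorSpan_image_finset_le ℝ z S hk
    rw [← direction_affineSpan, htop, AffineSubspace.direction_top, finrank_top,
      finrank_euclideanSpace_fin] at h1
    have := hS.2
    omega
  have hmem : ∀ x ∈ K, f₁ x ∈ B := by
    intro x hx
    have hsum : ∑ V : T, P V x = 1 := by
      have := P.sum_eq_one hx
      rwa [finsum_eq_sum_of_fintype] at this
    set S : Finset T := Finset.univ.filter fun V => P V x ≠ 0 with hS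
    have hS1 : ∑ V ∈ S, P V x = 1 := by
      rw [hS, Finset.sum_filter_ne_zero, hsum]
    have hfx : f₁ x = ∑ V ∈ S, P V x • z V := by
      simp only [hf₁, smul_sub, Finset.sum_sub_distrib, ← Finset.sum_smul, hsum, one_smul]
      rw [hS, Finset.sum_filter_of_ne]
      · abel
      · intro V _ h0 h1
        exact h0 (by rw [h1, zero_smul])
    have hScard : S.card ≤ n := by
      have h1 : ((S.image fun V : T => (V : Set Z)) : Set (Set Z)) ⊆ {V ∈ 𝒱 | x ∈ V} := by
        intro V hV
        obtain ⟨W, hW, rfl⟩ := Finset.mem_image.1 (Finset.mem_coe.1 hV)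
        exact ⟨hT𝒱 W.2, hPV W x (by simpa [hS] using hW)⟩
      have h2 := (encard_le_encard h1).trans (hord x)
      rw [encard_coe_eq_coe_finsetCard,
        Finset.card_image_of_injective _ Subtype.val_injective] at h2
      exact_mod_cast h2
    have hSpos : 0 < S.card := by
      rw [Finset.card_pos]
      by_contra hne
      rw [Finset.not_nonempty_iff_eq_empty] at hne
      rw [hne] at hS1
      simp at hS1
    refine mem_biUnion (x := S) ⟨hSpos, hScard⟩ ?_
    rw [hfx]
    refine (AffineSubspace.convex _).sum_mem (fun V _ => P.nonneg V x) hS1 fun V hV => ?_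
    exact subset_affineSpan ℝ _ (by simpa using ⟨V.1, V.2, hV, rfl⟩)
  obtain ⟨v, hv, hvB⟩ := Metric.dense_iff.1
    (Measure.dense_of_ae (measure_eq_zero_iff_ae_notMem.1 hBnull)) 0 (ε / 2) (by positivity)
  refine ⟨fun x => f₁ x - v, hf₁c.sub continuous_const, fun x => ?_, fun x hx h0 => ?_⟩
  · have h1 : dist (f₁ x - v) (f₁ x) < ε / 2 := by
      rw [mem_ball, dist_zero_right] at hv
      simpa [dist_eq_norm] using hv
    linarith [dist_triangle (f₁ x - v) (f₁ x) (f x), hf₁d x]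
  · exact hvB (by rw [← sub_eq_zero.1 h0]; exact hmem x hx)

lemma exists_norm_add_ge {n : ℕ} (hn : 0 < n) (y : EuclideanSpace ℝ (Fin n)) {s : ℝ}
    (hs : 0 ≤ s) : ∃ v : EuclideanSpace ℝ (Fin n), ‖v‖ = s ∧ s ≤ ‖y + v‖ := by
  set e : EuclideanSpace ℝ (Fin n) := EuclideanSpace.single ⟨0, hn⟩ s with he
  have hne : ‖e‖ = s := by simp [he, abs_of_nonneg hs]
  by_contra! hcon
  have h1 := hcon e hne
  have h2 := hcon (-e) (by rw [norm_neg, hne])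
  have h3 := norm_sub_le (y + e) (y + -e)
  have e3 : y + e - (y + -e) = (2 : ℝ) • e := by rw [two_smul]; abel
  rw [e3, norm_smul, hne, Real.norm_eq_abs, abs_two] at h3
  linarith

/-- By triple transitivity, a thin ball forces the whole space to be thin. -/
lemma Thin.univ_of_closedBall [CompactSpace Z] {n : ℕ} (hn : 0 < n)
    {δ : ℝ} (hδ : 0 < δ) {η : NNReal ≃ₜ NNReal}
    (htriple : ∀ z₁ z₂ z₃ : Z, z₁ ≠ z₂ → z₁ ≠ z₃ → z₂ ≠ z₃ →
      ∃ g : Z ≃ₜ Z, IsQuasiMobius η g ∧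
        δ ≤ dist (g z₁) (g z₂) ∧ δ ≤ dist (g z₁) (g z₃) ∧ δ ≤ dist (g z₂) (g z₃))
    {x : Z} (hx : (𝓝[≠] x).NeBot) {r : ℝ} (hr : 0 < r) (h : Thin n (closedBall x r)) :
    Thin n (univ : Set Z) := by
  by_cases hall : closedBall x r = univ
  · rwa [hall] at h
  obtain ⟨b, hb⟩ := (ne_univ_iff_exists_notMem _).1 hall
  intro f hf ε hε
  obtain ⟨τ, hτ, hfτ⟩ := Metric.uniformContinuous_iff.1
    (CompactSpace.uniformContinuous_of_continuous hf) (ε / 8) (by positivity)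
  obtain ⟨D, hD⟩ := exists_dist_le (Z := Z)
  have hD0 : 0 ≤ D := dist_nonneg.trans (hD x b)
  obtain ⟨κ, hκ, hsmall⟩ := (isGauge_gaugeOf η).exists_small (A := D / (r / 2 * r))
    (ε := τ * δ / (D ^ 2 + 1)) (by positivity)
  obtain ⟨a, ha1, ha2⟩ : ∃ a, a ≠ x ∧ dist a x < min κ (r / 2) :=
    (show ∀ᶠ a in 𝓝[≠] x, a ≠ x ∧ dist a x < min κ (r / 2) from
      eventually_mem_nhdsWithin.and
        (nhdsWithin_le_nhds (ball_mem_nhds x (by positivity)))).exists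
  have hfar : ∀ u, u ∉ closedBall x r → r < dist x u ∧ r / 2 < dist u a := by
    intro u hu
    rw [mem_closedBall, not_le] at hu
    have h1 := ha2.trans_le (min_le_right _ _)
    have h2 := dist_triangle u a x
    rw [dist_comm x u]
    exact ⟨hu, by linarith⟩
  obtain ⟨g, hg, hgxa, -, -⟩ := htriple x a b ha1.symm
    (dist_pos.1 (hr.trans (hfar b hb).1)) (dist_pos.1 ((half_pos hr).trans
      (hfar b hb).2)).symm
  have hgK : ∀ z, z ∉ g '' closedBall x r → dist z (g b) < τ := by
    intro z hz
    obtain ⟨u, rfl⟩ := g.surjective z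
    have hu : u ∉ closedBall x r := fun hu => hz ⟨u, hu, rfl⟩
    obtain ⟨hu1, hu2⟩ := hfar u hu
    obtain ⟨hb1, hb2⟩ := hfar b hb
    have hxu : x ≠ u := dist_pos.1 (hr.trans hu1)
    have hxb : x ≠ b := dist_pos.1 (hr.trans hb1)
    have hua : u ≠ a := dist_pos.1 ((half_pos hr).trans hu2)
    have hba : b ≠ a := dist_pos.1 ((half_pos hr).trans hb2)
    have h1 := hg.realCross_le (a := u) (b := x) (c := b) (e := a) hxu.symm hua hxb hba
    have h2 : realCross dist u x b a ≤ D / (r / 2 * r) * dist a x := by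
      unfold realCross
      rw [div_mul_eq_mul_div, dist_comm x a]
      gcongr
      exact hD u b
    have h3 : realCross dist (g u) (g x) (g b) (g a) < τ * δ / (D ^ 2 + 1) :=
      h1.trans_lt (((isGauge_gaugeOf η).1 h2).trans_lt
        (hsmall _ dist_nonneg (ha2.trans_le (min_le_left _ _))))
    unfold realCross at h3
    have hden : 0 < dist (g u) (g a) * dist (g x) (g b) :=
      mul_pos (dist_pos.2 (g.injective.ne hua)) (dist_pos.2 (g.injective.ne hxb))
    have hdle : dist (g u) (g a) * dist (g x) (g b) ≤ D ^ 2 := by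
      rw [sq]; exact mul_le_mul (hD _ _) (hD _ _) dist_nonneg hD0
    rw [div_lt_iff₀ hden] at h3
    have h4 : τ * δ / (D ^ 2 + 1) * (dist (g u) (g a) * dist (g x) (g b)) < τ * δ := by
      rw [div_mul_eq_mul_div, div_lt_iff₀ (by positivity)]
      have : 0 < τ * δ := by positivity
      nlinarith
    have h5 : dist (g u) (g b) * δ ≤ dist (g u) (g b) * dist (g x) (g a) := by gcongr
    exact lt_of_mul_lt_mul_right (by linarith) hδ.le
  obtain ⟨v, hv, hvq⟩ := exists_norm_add_ge hn (f (g b)) (s := ε / 4) (by positivity)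
  obtain ⟨f', hf', hd, hne⟩ := h.image g (fun z => f z + v) (hf.add continuous_const) (ε / 8)
    (by positivity)
  refine ⟨f', hf', fun z => ?_, fun z _ h0 => ?_⟩
  · have h1 : dist (f z + v) (f z) = ε / 4 := by simp [hv]
    linarith [hd z, dist_triangle (f' z) (f z + v) (f z)]
  · have hz : z ∉ g '' closedBall x r := fun hz => hne z hz h0
    have h1 := hfτ (hgK z hz)
    have h2 := hd z
    rw [h0, dist_zero_left] at h2
    have h3 : ‖f (g b) + v‖ ≤ ‖f z + v‖ + dist (f z) (f (g b)) := by
      rw [dist_comm, dist_eq_norm]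
      have e1 : f (g b) + v = (f z + v) + (f (g b) - f z) := by abel
      calc ‖f (g b) + v‖ = ‖(f z + v) + (f (g b) - f z)‖ := by rw [← e1]
        _ ≤ _ := norm_add_le _ _
    linarith

end thin

section stable

variable {Z : Type*} [MetricSpace Z] {n : ℕ} {F : Z → EuclideanSpace ℝ (Fin n)}

/-- Near `x`, the value `F x` can be avoided by arbitrarily small local perturbations of `F`. -/
def Removable (F : Z → EuclideanSpace ℝ (Fin n)) (x : Z) : Prop :=
  ∀ U ∈ 𝓝 x, ∃ U' ∈ 𝓝 x, U' ⊆ U ∧ ∀ ε > 0, ∃ F' : Z → EuclideanSpace ℝ (Fin n),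
    Continuous F' ∧ (∀ z ∉ U', F' z = F z) ∧ (∀ z, dist (F' z) (F z) < ε) ∧
    ∀ z ∈ U', F' z ≠ F x

/-- Simultaneous perturbation avoiding finitely many values on `K`, when the finitely many
preimages in `K` are removable. -/
lemma exists_perturbation_avoiding [CompactSpace Z] (hF : Continuous F) {P : Finset Z}
    (hP : ∀ x ∈ P, Removable F x) {Y : Finset (EuclideanSpace ℝ (Fin n))} {K : Set Z}
    (hK : IsClosed K) (hKP : ∀ x ∈ K, F x ∈ Y → x ∈ P) {W : Set Z} (hW : IsOpen W)
    (hPW : ∀ x ∈ P, x ∈ W) {ε : ℝ} (hε : 0 < ε) :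
    ∃ F₁ : Z → EuclideanSpace ℝ (Fin n), Continuous F₁ ∧ (∀ z ∉ W, F₁ z = F z) ∧
      (∀ z, dist (F₁ z) (F z) < ε) ∧ ∀ z ∈ K, F₁ z ∉ Y := by
  classical
  obtain ⟨U, hU, hUd⟩ := P.finite_toSet.t2_separation
  have hρ : ∀ x, ∃ ρ > 0, ball (F x) ρ ⊆ ((Y.erase (F x) : Finset _) : Set _)ᶜ := fun x =>
    Metric.isOpen_iff.1 (Y.erase (F x)).finite_toSet.isClosed.isOpen_compl (F x) (by simp)
  choose ρ hρ0 hρY using hρ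
  have hnb : ∀ x ∈ P, ∃ U' ∈ 𝓝 x, U' ⊆ U x ∩ W ∩ F ⁻¹' ball (F x) (ρ x / 2) ∧
      ∀ ε > 0, ∃ F' : Z → EuclideanSpace ℝ (Fin n), Continuous F' ∧ (∀ z ∉ U', F' z = F z) ∧
        (∀ z, dist (F' z) (F z) < ε) ∧ ∀ z ∈ U', F' z ≠ F x := fun x hx =>
    hP x hx _ (inter_mem (inter_mem ((hU x).2.mem_nhds (hU x).1) (hW.mem_nhds (hPW x hx)))
      (hF.continuousAt.preimage_mem_nhds (ball_mem_nhds _ (half_pos (hρ0 x)))))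
  choose! U' hU'n hU's hU'F using hnb
  have hK' : IsCompact (K \ ⋃ x ∈ P, interior (U' x)) :=
    (hK.sdiff (isOpen_biUnion fun x _ => isOpen_interior)).isCompact
  obtain ⟨β, hβ, hβK⟩ := (hK'.image hF).exists_thickening_subset_open
    Y.finite_toSet.isClosed.isOpen_compl (by
      rintro _ ⟨z, ⟨hzK, hz⟩, rfl⟩ hzY
      exact hz (mem_biUnion (hKP z hzK hzY) (mem_interior_iff_mem_nhds.2 (hU'n z (hKP z hzK hzY)))))
  have hF' : ∀ x ∈ P, ∃ F' : Z → EuclideanSpace ℝ (Fin n), Continuous F' ∧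
      (∀ z ∉ U' x, F' z = F z) ∧ (∀ z, dist (F' z) (F z) < min (min ε β) (ρ x / 2)) ∧
      ∀ z ∈ U' x, F' z ≠ F x := fun x hx =>
    hU'F x hx _ (by have := hρ0 x; positivity)
  choose! F' hF'c hF'off hF'd hF'ne using hF'
  set F₁ : Z → EuclideanSpace ℝ (Fin n) := fun z => F z + ∑ x ∈ P, (F' x z - F z) with hF₁
  have hin : ∀ x ∈ P, ∀ z ∈ U' x, F₁ z = F' x z := by
    intro x hx z hz
    simp only [hF₁]
    rw [Finset.sum_eq_single_of_mem x hx, add_sub_cancel]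
    intro x' hx' hne
    rw [hF'off x' hx', sub_self]
    intro hz'
    exact Set.disjoint_left.1 (hUd hx hx' hne.symm) (hU's x hx hz).1.1 (hU's x' hx' hz').1.1
  have hout : ∀ z, (∀ x ∈ P, z ∉ U' x) → F₁ z = F z := by
    intro z hz
    simp only [hF₁]
    rw [Finset.sum_eq_zero, add_zero]
    intro x hx
    rw [hF'off x hx z (hz x hx), sub_self]
  refine ⟨F₁, hF.add (continuous_finsetSum _ fun x hx => (hF'c x hx).sub hF), ?_, ?_, ?_⟩
  · intro z hz
    exact hout z fun x hx hzx => hz (hU's x hx hzx).1.2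
  · intro z
    by_cases hz : ∃ x ∈ P, z ∈ U' x
    · obtain ⟨x, hx, hzx⟩ := hz
      rw [hin x hx z hzx]
      exact (hF'd x hx z).trans_le ((min_le_left _ _).trans (min_le_left _ _))
    · push Not at hz
      rw [hout z hz, dist_self]
      exact hε
  · intro z hzK hzY
    by_cases hz : ∃ x ∈ P, z ∈ U' x
    · obtain ⟨x, hx, hzx⟩ := hz
      rw [hin x hx z hzx] at hzY
      have h1 := (hF'd x hx z).trans_le (min_le_right _ _)
      have h2 : dist (F z) (F x) < ρ x / 2 := (hU's x hx hzx).2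
      have h3 : F' x z ∈ ball (F x) (ρ x) := by
        rw [mem_ball]
        linarith [dist_triangle (F' x z) (F z) (F x)]
      exact hρY x h3 (Finset.mem_coe.2 (Finset.mem_erase.2 ⟨hF'ne x hx z hzx, hzY⟩))
    · have hz' : ∀ x ∈ P, z ∉ U' x := by push Not at hz; exact hz
      have hzK' : z ∈ K \ ⋃ x ∈ P, interior (U' x) := by
        refine ⟨hzK, fun hm => ?_⟩
        obtain ⟨x, hx, hzx⟩ := mem_iUnion₂.1 hm
        exact hz' x hx (interior_subset hzx)
      rw [hout z hz'] at hzY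
      exact hβK (self_subset_thickening hβ _ ⟨z, hzK', rfl⟩) hzY

/-- Preimages of small balls under a map with finite fibres split into small pieces. -/
lemma exists_split [CompactSpace Z] (hF : Continuous F) {K : Set Z} (hK : IsClosed K)
    (hfin : ∀ y, {x ∈ K | F x = y}.Finite) {ε : ℝ} (hε : 0 < ε) :
    ∃ s > 0, ∀ y, ∃ 𝒲 : Set (Set Z), (∀ W ∈ 𝒲, SmallOpen ε W) ∧
      (∀ W ∈ 𝒲, ∀ W' ∈ 𝒲, W ≠ W' → Disjoint W W') ∧
      {x ∈ K | dist (F x) y < s} ⊆ ⋃₀ 𝒲 := by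
  have hloc : ∀ y, ∃ O, IsOpen O ∧ y ∈ O ∧ ∃ 𝒲 : Set (Set Z), (∀ W ∈ 𝒲, SmallOpen ε W) ∧
      (∀ W ∈ 𝒲, ∀ W' ∈ 𝒲, W ≠ W' → Disjoint W W') ∧ {x ∈ K | F x ∈ O} ⊆ ⋃₀ 𝒲 := by
    intro y
    obtain ⟨U, hU, hUd⟩ := (hfin y).t2_separation
    set 𝒲 : Set (Set Z) := (fun x => U x ∩ ball x (ε / 2)) '' {x ∈ K | F x = y} with h𝒲
    have hop : ∀ W ∈ 𝒲, SmallOpen ε W := by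
      rintro _ ⟨x, hx, rfl⟩
      refine ⟨(hU x).2.inter isOpen_ball, fun a ha b hb => ?_⟩
      have h1 := mem_ball.1 ha.2
      have h2 := mem_ball.1 hb.2
      linarith [dist_triangle_right a b x]
    have hcl : IsClosed (F '' (K \ ⋃₀ 𝒲)) :=
      ((hK.sdiff (isOpen_sUnion fun W hW => (hop W hW).1)).isCompact.image hF).isClosed
    refine ⟨(F '' (K \ ⋃₀ 𝒲))ᶜ, hcl.isOpen_compl, ?_, 𝒲, hop, ?_, ?_⟩
    · rintro ⟨x, ⟨hxK, hx⟩, hxy⟩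
      exact hx ⟨_, ⟨x, ⟨hxK, hxy⟩, rfl⟩, (hU x).1, mem_ball_self (by positivity)⟩
    · rintro _ ⟨x, hx, rfl⟩ _ ⟨x', hx', rfl⟩ hne
      have hxx : x ≠ x' := by rintro rfl; exact hne rfl
      exact (hUd hx hx' hxx).mono inter_subset_left inter_subset_left
    · rintro x ⟨hxK, hx⟩
      by_contra hn
      exact hx ⟨x, ⟨hxK, hn⟩, rfl⟩
  choose O hO hyO 𝒲 h𝒲o h𝒲d h𝒲c using hloc
  obtain ⟨s, hs, hleb⟩ := lebesgue_number_lemma_of_metric (hK.isCompact.image hF) hO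
    (fun y _ => mem_iUnion.2 ⟨y, hyO y⟩)
  refine ⟨s / 2, half_pos hs, fun y => ?_⟩
  by_cases hne : ∃ x₀ ∈ K, dist (F x₀) y < s / 2
  · obtain ⟨x₀, hx₀, hd⟩ := hne
    obtain ⟨i, hi⟩ := hleb _ ⟨x₀, hx₀, rfl⟩
    refine ⟨𝒲 i, h𝒲o i, h𝒲d i, fun x hx => h𝒲c i ⟨hx.1, hi ?_⟩⟩
    rw [mem_ball]
    linarith [dist_triangle_right (F x) (F x₀) y, hx.2]
  · refine ⟨∅, by simp, by simp, fun x hx => absurd ⟨x, hx.1, hx.2⟩ hne⟩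

lemma smallOrder_of_removable [CompactSpace Z] (hF : Continuous F) {K : Set Z} (hK : IsClosed K)
    (hfin : ∀ y, {x ∈ K | F x = y}.Finite) (hrem : ∀ x ∈ K, Removable F x) :
    SmallOrder n K := by
  classical
  intro ε hε
  obtain ⟨s, hs, hsplit⟩ := exists_split hF hK hfin hε
  obtain ⟨B, hB⟩ := isCompact_univ.exists_bound_of_continuousOn hF.continuousOn
  set lam : ℝ := 2 * (Real.sqrt n + 1) / s with hlam
  have hl : 0 < lam := by positivity
  obtain ⟨k, hk⟩ := exists_nat_ge (lam * (B + s) + 2)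
  set Y : Finset (EuclideanSpace ℝ (Fin n)) :=
    (Fintype.piFinset fun _ : Fin n => Finset.Icc (-(k : ℤ)) k).image
      fun m => WithLp.toLp 2 fun j => ((m j : ℝ) + 1 / 2) / lam with hY
  have hPfin : {x ∈ K | F x ∈ Y}.Finite := by
    have : {x ∈ K | F x ∈ Y} = ⋃ y ∈ Y, {x ∈ K | F x = y} := by ext; simp
    rw [this]
    exact Y.finite_toSet.biUnion fun y _ => hfin y
  obtain ⟨F₁, hF₁, -, hd, hav⟩ := exists_perturbation_avoiding hF (P := hPfin.toFinset)
    (fun x hx => hrem x ((hPfin.mem_toFinset.1 hx).1)) (Y := Y) hK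
    (fun x hx hxY => hPfin.mem_toFinset.2 ⟨hx, hxY⟩) isOpen_univ (fun _ _ => mem_univ _)
    (half_pos hs)
  have hF₁i : ∀ i, Continuous fun x => F₁ x i := fun i =>
    (continuous_apply i).comp ((PiLp.continuous_ofLp 2 _).comp hF₁)
  refine exists_cover_of_grid (Φ := fun x i => lam * F₁ x i)
    (continuous_pi fun i => continuous_const.mul (hF₁i i)) ?_ ?_
  · intro x hx
    by_contra! hcard
    have huniv : (Finset.univ.filter fun i => distInt (lam * F₁ x i) = 1 / 2) = Finset.univ :=
      Finset.eq_univ_of_card _ (le_antisymm (Finset.card_le_univ _) (by simpa using hcard))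
    have hm : ∀ i, ∃ m : ℤ, lam * F₁ x i = m + 1 / 2 := fun i =>
      distInt_eq_half_iff.1 (by have := huniv.ge (Finset.mem_univ i); simpa using this)
    choose m hm using hm
    refine hav x hx (Finset.mem_image.2 ⟨m, ?_, ?_⟩)
    · rw [Fintype.mem_piFinset]
      intro i
      have h1 : |F₁ x i| ≤ B + s := by
        have h2 : ‖F₁ x‖ ≤ ‖F x‖ + dist (F₁ x) (F x) := by
          rw [dist_eq_norm]
          linarith [norm_sub_norm_le (F₁ x) (F x)]
        have h3 := hd x
        have h4 := hB x (mem_univ x)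
        have h5 := PiLp.norm_apply_le (F₁ x) i
        rw [Real.norm_eq_abs] at h5
        linarith
      have h6 : |lam * F₁ x i| ≤ lam * (B + s) := by
        rw [abs_mul, abs_of_pos hl]
        gcongr
      rw [hm i] at h6
      have h7 := abs_le.1 h6
      rw [Finset.mem_Icc]
      have h3 : (-(k : ℝ)) ≤ m i := by linarith [h7.1]
      have h4 : (m i : ℝ) ≤ k := by linarith [h7.2]
      exact ⟨by exact_mod_cast h3, by exact_mod_cast h4⟩
    · ext i
      simp only
      rw [← hm i]
      field_simp
  · intro y
    obtain ⟨𝒲, h1, h2, h3⟩ := hsplit (WithLp.toLp 2 fun i => y i / lam)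
    refine ⟨𝒲, h1, h2, fun x hx => h3 ⟨hx.1, ?_⟩⟩
    have h4 : dist (F₁ x) (WithLp.toLp 2 fun i => y i / lam) ≤ s / 2 := by
      rw [EuclideanSpace.dist_eq]
      have h5 : ∀ i, dist (F₁ x i) (y i / lam) ^ 2 ≤ (1 / lam) ^ 2 := by
        intro i
        have h6 := (hx.2 i).le
        have e1 : lam * F₁ x i - y i = lam * (F₁ x i - y i / lam) := by field_simp
        rw [e1, abs_mul, abs_of_pos hl] at h6
        rw [Real.dist_eq]
        gcongr
        rw [le_div_iff₀ hl]
        linarith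
      calc √(∑ i, dist (F₁ x i) (y i / lam) ^ 2) ≤ √(∑ i : Fin n, (1 / lam) ^ 2) :=
            Real.sqrt_le_sqrt (Finset.sum_le_sum fun i _ => h5 i)
        _ = √n * (1 / lam) := by
            rw [Finset.sum_const, Finset.card_univ, Fintype.card_fin, nsmul_eq_mul,
              Real.sqrt_mul (Nat.cast_nonneg n), Real.sqrt_sq (by positivity)]
        _ ≤ s / 2 := by
            rw [hlam]
            have : 0 ≤ √(n : ℝ) := Real.sqrt_nonneg _
            rw [one_div_div, ← mul_div_assoc, div_le_div_iff₀ (by positivity) (by positivity)]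
            nlinarith
    have h5 := hd x
    rw [dist_comm] at h5
    linarith [dist_triangle (F x) (F₁ x) (WithLp.toLp 2 fun i => y i / lam)]

end stable

section stable

variable {Z : Type*} [MetricSpace Z] {n : ℕ} {F : Z → EuclideanSpace ℝ (Fin n)}

/-- Values near the value at a non-removable point are attained at nearby non-removable points. -/
lemma eventually_exists_not_removable [CompactSpace Z] (hF : Continuous F) {Ω : Set Z}
    (hΩ : IsOpen Ω) (hfin : ∀ y, {x ∈ Ω | F x = y}.Finite) {x : Z} (hx : x ∈ Ω)
    (hst : ¬ Removable F x) {U : Set Z} (hU : U ∈ 𝓝 x) :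
    ∀ᶠ y in 𝓝 (F x), ∃ z ∈ U, ¬ Removable F z ∧ F z = y := by
  unfold Removable at hst
  push Not at hst
  obtain ⟨U₀, hU₀, hst⟩ := hst
  have hiso : ({z ∈ Ω | F z = F x} \ {x})ᶜ ∈ 𝓝 x :=
    ((hfin (F x)).subset sdiff_subset).isClosed.isOpen_compl.mem_nhds (by simp)
  obtain ⟨κ', hκ', hball⟩ := Metric.mem_nhds_iff.1
    (inter_mem (inter_mem hU hU₀) (inter_mem (hΩ.mem_nhds hx) hiso))
  set κ := κ' / 3 with hκd
  have hκ : 0 < κ := by positivity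
  have hcb : closedBall x (2 * κ) ⊆ (U ∩ U₀) ∩ (Ω ∩ ({z ∈ Ω | F z = F x} \ {x})ᶜ) :=
    (closedBall_subset_ball (by linarith)).trans hball
  obtain ⟨ε, hε, hst⟩ := hst (ball x (2 * κ)) (ball_mem_nhds x (by positivity))
    fun z hz => (hcb (ball_subset_closedBall hz)).1.2
  have hAc : IsCompact (closedBall x (2 * κ) \ ball x κ) :=
    (isClosed_closedBall.sdiff isOpen_ball).isCompact
  obtain ⟨β, hβ, hβA⟩ := hAc.exists_forall_le' (f := fun z => dist (F z) (F x))
    (hF.dist continuous_const).continuousOn (a := 0) (fun z hz => by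
      refine dist_pos.2 fun h0 => ?_
      have h1 := hcb hz.1
      refine h1.2.2 ⟨⟨h1.2.1, h0⟩, ?_⟩
      rintro rfl
      exact hz.2 (mem_ball_self hκ))
  filter_upwards [ball_mem_nhds (F x) (by positivity : 0 < min ε β / 2)] with y hy
  by_contra! hcon
  have hPfin : {z ∈ closedBall x κ | F z = y}.Finite := by
    refine (hfin y).subset fun z hz => ⟨?_, hz.2⟩
    exact (hcb (closedBall_subset_closedBall (by linarith) hz.1)).2.1
  obtain ⟨F₁, hF₁, hoff, hd, hav⟩ := exists_perturbation_avoiding hF (P := hPfin.toFinset)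
    (fun z hz => by
      have hz' := hPfin.mem_toFinset.1 hz
      by_contra hnr
      exact hcon z (hcb (closedBall_subset_closedBall (by linarith) hz'.1)).1.1 hnr hz'.2)
    (Y := {y}) (isClosed_closedBall (x := x) (ε := κ))
    (fun z hz hzy => hPfin.mem_toFinset.2 ⟨hz, by simpa using hzy⟩)
    (isOpen_ball (x := x) (ε := 2 * κ)) (fun z hz => by
      have hz' := mem_closedBall.1 (hPfin.mem_toFinset.1 hz).1
      rw [mem_ball]
      linarith)
    (ε := min ε β / 2) (by positivity)
  set χ : Z → ℝ := fun z => max 0 (min 1 (2 - dist z x / κ)) with hχ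
  have hχc : Continuous χ := by
    refine continuous_const.max (continuous_const.min (continuous_const.sub ?_))
    exact (continuous_id.dist continuous_const).div_const κ
  have hχ1 : ∀ z, dist z x ≤ κ → χ z = 1 := by
    intro z hz
    have : dist z x / κ ≤ 1 := (div_le_one hκ).2 hz
    simp only [hχ]
    rw [min_eq_left (by linarith), max_eq_right zero_le_one]
  have hχ0 : ∀ z, 2 * κ ≤ dist z x → χ z = 0 := by
    intro z hz
    have : 2 ≤ dist z x / κ := (le_div_iff₀ hκ).2 hz
    simp only [hχ]
    rw [max_eq_left ((min_le_right _ _).trans (by linarith))]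
  have hχn : ∀ z, ‖χ z‖ ≤ 1 := by
    intro z
    rw [Real.norm_eq_abs, abs_of_nonneg (le_max_left _ _)]
    exact max_le zero_le_one (min_le_left _ _)
  set F₂ : Z → EuclideanSpace ℝ (Fin n) := fun z => F₁ z + χ z • (F x - y) with hF₂
  have hd₂ : ∀ z, dist (F₂ z) (F z) < min ε β := by
    intro z
    have h1 : dist (F₂ z) (F₁ z) ≤ dist y (F x) := by
      rw [dist_eq_norm, dist_comm, dist_eq_norm]
      simp only [hF₂, add_sub_cancel_left, norm_smul]
      exact mul_le_of_le_one_left (norm_nonneg _) (hχn z)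
    have h2 := mem_ball.1 hy
    linarith [dist_triangle (F₂ z) (F₁ z) (F z), hd z]
  obtain ⟨z, hz, hzx⟩ := hst F₂ (hF₁.add (hχc.smul continuous_const))
    (fun z hz => by
      simp only [hF₂]
      rw [hoff z hz, hχ0 z (not_lt.1 hz), zero_smul, add_zero])
    (fun z => (hd₂ z).trans_le (min_le_left _ _))
  by_cases hzκ : dist z x < κ
  · refine hav z (ball_subset_closedBall hzκ) ?_
    simp only [hF₂, hχ1 z hzκ.le, one_smul] at hzx
    have : F₁ z = y := by
      have h5 : F₁ z - y = 0 := by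
        have : F₁ z + (F x - y) - F x = 0 := by rw [hzx, sub_self]
        rw [← this]; abel
      exact sub_eq_zero.1 h5
    simp [this]
  · have h1 := hβA z ⟨ball_subset_closedBall hz, hzκ⟩
    have h2 := (hd₂ z).trans_le (min_le_right _ _)
    rw [hzx, dist_comm] at h2
    linarith

/-- A map with uniformly finite fibres on an open subset of a space that is nowhere of small order
admits a local continuous inverse somewhere. -/
theorem exists_local_inverse [CompactSpace Z] (hF : Continuous F) {Ω : Set Z} (hΩ : IsOpen Ω)
    (hΩne : Ω.Nonempty) {N : ℕ}
    (hfib : ∀ (y : EuclideanSpace ℝ (Fin n)) (T : Finset Z), (∀ u ∈ T, u ∈ Ω ∧ F u = y) →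
      T.card ≤ N)
    (hK : ∀ K : Set Z, IsClosed K → (interior K).Nonempty → ¬ SmallOrder n K) :
    ∃ x ∈ Ω, ∃ V, IsOpen V ∧ x ∈ V ∧ V ⊆ Ω ∧ ∃ s > 0, ∃ σ : EuclideanSpace ℝ (Fin n) → Z,
      ContinuousOn σ (ball (F x) s) ∧ (∀ y ∈ ball (F x) s, σ y ∈ V ∧ F (σ y) = y) ∧
      ∀ z ∈ V, F z ∈ ball (F x) s ∧ σ (F z) = z := by
  classical
  have hfin : ∀ y, {x ∈ Ω | F x = y}.Finite := by
    intro y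
    by_contra hinf
    obtain ⟨T, hT, hc⟩ := Set.Infinite.exists_subset_card_eq hinf (N + 1)
    have := hfib y T fun u hu => hT hu
    omega
  have hdense : ∀ O, IsOpen O → O ⊆ Ω → O.Nonempty → ∃ z ∈ O, ¬ Removable F z := by
    rintro O hO hOΩ ⟨z, hz⟩
    obtain ⟨κ, hκ, hb⟩ := Metric.isOpen_iff.1 hO z hz
    have hcb : closedBall z (κ / 2) ⊆ O := (closedBall_subset_ball (by linarith)).trans hb
    by_contra! hcon
    refine hK (closedBall z (κ / 2)) isClosed_closedBall
      ⟨z, ball_subset_interior_closedBall (mem_ball_self (by positivity))⟩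
      (smallOrder_of_removable hF isClosed_closedBall (fun y => ?_) fun x hx => hcon x (hcb hx))
    exact (hfin y).subset fun x hx => ⟨hOΩ (hcb hx.1), hx.2⟩
  set S : Set ℕ := {c | ∃ (y : EuclideanSpace ℝ (Fin n)) (T : Finset Z),
    (∀ u ∈ T, u ∈ Ω ∧ F u = y ∧ ¬ Removable F u) ∧ T.card = c} with hS
  have hSb : BddAbove S := ⟨N, by
    rintro c ⟨y, T, hT, rfl⟩
    exact hfib y T fun u hu => ⟨(hT u hu).1, (hT u hu).2.1⟩⟩
  have hS1 : 1 ∈ S := by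
    obtain ⟨z, hz, hzs⟩ := hdense Ω hΩ Subset.rfl hΩne
    exact ⟨F z, {z}, by simpa using ⟨hz, hzs⟩, by simp⟩
  obtain ⟨y₀, T, hT, hTc⟩ := Nat.sSup_mem ⟨1, hS1⟩ hSb
  have hTmax : ∀ c ∈ S, c ≤ T.card := fun c hc => hTc ▸ le_csSup hSb hc
  obtain ⟨x, hxT⟩ : T.Nonempty := Finset.card_pos.1 (hTmax 1 hS1)
  obtain ⟨U, hU, hUd⟩ := T.finite_toSet.t2_separation
  have hFx : F x = y₀ := (hT x hxT).2.1
  have hev : ∀ᶠ y in 𝓝 y₀, ∀ t ∈ T, ∃ z ∈ U t ∩ Ω, ¬ Removable F z ∧ F z = y := by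
    rw [Filter.eventually_all_finset]
    intro t ht
    have := eventually_exists_not_removable hF hΩ hfin (hT t ht).1 (hT t ht).2.2
      (inter_mem ((hU t).2.mem_nhds (hU t).1) (hΩ.mem_nhds (hT t ht).1))
    rwa [(hT t ht).2.1] at this
  obtain ⟨s, hs, hball⟩ := Metric.eventually_nhds_iff_ball.1 hev
  have huniq : ∀ z₁ ∈ U x ∩ Ω, ∀ z₂ ∈ U x ∩ Ω, ¬ Removable F z₁ → ¬ Removable F z₂ →
      F z₁ = F z₂ → F z₁ ∈ ball y₀ s → z₁ = z₂ := by
    intro z₁ h₁ z₂ h₂ hr₁ hr₂ hFz hb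
    by_contra hne
    have hp := hball _ hb
    choose! p hpU hpr hpF using hp
    have hinj : InjOn p (T.erase x) := by
      intro a ha b hb hab
      by_contra hne'
      have ha' := Finset.mem_of_mem_erase (Finset.mem_coe.1 ha)
      have hb' := Finset.mem_of_mem_erase (Finset.mem_coe.1 hb)
      exact Set.disjoint_left.1 (hUd ha' hb' hne') (hpU a ha').1 (hab ▸ (hpU b hb').1)
    have hnot : ∀ z ∈ U x, z ∉ (T.erase x).image p := by
      intro z hz hm
      obtain ⟨a, ha, rfl⟩ := Finset.mem_image.1 hm
      have ha' := Finset.mem_of_mem_erase ha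
      exact Set.disjoint_left.1 (hUd hxT ha' (Finset.ne_of_mem_erase ha).symm) hz (hpU a ha').1
    have hmem : (insert z₁ (insert z₂ ((T.erase x).image p))).card ∈ S := by
      refine ⟨F z₁, _, fun u hu => ?_, rfl⟩
      rcases Finset.mem_insert.1 hu with rfl | hu
      · exact ⟨h₁.2, rfl, hr₁⟩
      rcases Finset.mem_insert.1 hu with rfl | hu
      · exact ⟨h₂.2, hFz.symm, hr₂⟩
      obtain ⟨a, ha, rfl⟩ := Finset.mem_image.1 hu
      have ha' := Finset.mem_of_mem_erase ha
      exact ⟨(hpU a ha').2, hpF a ha', hpr a ha'⟩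
    have hle := hTmax _ hmem
    rw [Finset.card_insert_of_notMem, Finset.card_insert_of_notMem (hnot z₂ h₂.1),
      Finset.card_image_of_injOn hinj, Finset.card_erase_of_mem hxT] at hle
    · have : 0 < T.card := Finset.card_pos.2 ⟨x, hxT⟩
      omega
    · rw [Finset.mem_insert, not_or]
      exact ⟨hne, hnot z₁ h₁.1⟩
  set V : Set Z := (U x ∩ Ω) ∩ F ⁻¹' ball y₀ s with hV
  have hVo : IsOpen V := ((hU x).2.inter hΩ).inter (isOpen_ball.preimage hF)
  have hVst : ∀ z ∈ V, ¬ Removable F z := by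
    intro z hz hrem
    obtain ⟨w, hw, hwr, hwF⟩ := hball _ hz.2 x hxT
    have hzw : z ≠ w := by rintro rfl; exact hwr hrem
    obtain ⟨Oz, Ow, hOz, hOw, hzO, hwO, hdis⟩ := t2_separation hzw
    have hev2 := eventually_exists_not_removable hF hΩ hfin hw.2 hwr
      (inter_mem (hOw.mem_nhds hwO) (((hU x).2.inter hΩ).mem_nhds hw))
    rw [hwF] at hev2
    have hnb := hF.continuousAt.eventually hev2
    obtain ⟨O, hOsub, hO, hzO'⟩ := _root_.mem_nhds_iff.1 hnb
    obtain ⟨z', hz', hz'r⟩ := hdense (O ∩ Oz ∩ V) ((hO.inter hOz).inter hVo)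
      (fun a ha => ha.2.1.2) ⟨z, ⟨hzO', hzO⟩, hz⟩
    obtain ⟨w', hw', hw'r, hw'F⟩ := hOsub hz'.1.1
    have heq := huniq z' hz'.2.1 w' hw'.2 hz'r hw'r hw'F.symm hz'.2.2
    exact Set.disjoint_left.1 hdis hz'.1.2 (heq ▸ hw'.1)
  have hσ : ∀ y, ∃ z, y ∈ ball y₀ s → z ∈ V ∧ F z = y := by
    intro y
    by_cases hy : y ∈ ball y₀ s
    · obtain ⟨z, hz, -, hzF⟩ := hball y hy x hxT
      exact ⟨z, fun _ => ⟨⟨hz, by rw [mem_preimage, hzF]; exact hy⟩, hzF⟩⟩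
    · exact ⟨x, fun h => absurd h hy⟩
  choose σ hσ using hσ
  have hσF : ∀ z ∈ V, σ (F z) = z := fun z hz =>
    huniq _ (hσ _ hz.2).1.1 z hz.1 (hVst _ (hσ _ hz.2).1) (hVst z hz) (hσ _ hz.2).2
      (hσ _ hz.2).1.2
  refine ⟨x, (hT x hxT).1, V, hVo, ⟨⟨(hU x).1, (hT x hxT).1⟩, ?_⟩, fun z hz => hz.1.2, s, hs, σ,
    ?_, ?_, ?_⟩
  · rw [mem_preimage, hFx]
    exact mem_ball_self hs
  · rw [hFx]
    intro y hy
    refine ContinuousAt.continuousWithinAt ?_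
    intro O hO
    have hσy := hσ y hy
    have := eventually_exists_not_removable hF hΩ hfin hσy.1.1.2 (hVst _ hσy.1)
      (inter_mem hO (hVo.mem_nhds hσy.1))
    rw [hσy.2] at this
    refine this.mono fun y' hy' => ?_
    obtain ⟨z, hz, -, rfl⟩ := hy'
    rw [hσF z hz.2]
    exact hz.1
  · rw [hFx]
    exact fun y hy => hσ y hy
  · rw [hFx]
    exact fun z hz => ⟨hz.2, hσF z hz⟩

end stable

section density

variable {n : ℕ}

/-- A finite measure on `ℝⁿ` is uniformly bounded by a multiple of volume on balls centred at the
points of a set meeting any set of positive volume in a set of positive volume. -/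
lemma exists_ball_bound (ν : Measure (EuclideanSpace ℝ (Fin n))) [IsFiniteMeasure ν]
    {A : Set (EuclideanSpace ℝ (Fin n))} (hA : 0 < volume A) :
    ∃ k : ℕ, 0 < volume (A ∩ {y | ∀ r, 0 < r → r < 1 / ((k : ℝ) + 1) →
      ν (closedBall y r) ≤ k * volume (closedBall y r)}) := by
  set S : ℕ → Set (EuclideanSpace ℝ (Fin n)) := fun k => {y | ∀ r, 0 < r → r < 1 / ((k : ℝ) + 1) →
      ν (closedBall y r) ≤ k * volume (closedBall y r)} with hS
  have hae : ∀ᵐ y ∂(volume : Measure (EuclideanSpace ℝ (Fin n))), y ∈ ⋃ k, S k := by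
    filter_upwards [Besicovitch.ae_tendsto_rnDeriv ν volume, ν.rnDeriv_lt_top volume] with y h1 h2
    obtain ⟨k₁, hk₁⟩ := ENNReal.exists_nat_gt h2.ne
    have h3 := h1.eventually (gt_mem_nhds hk₁)
    obtain ⟨τ, hτ, hτ'⟩ := Metric.mem_nhdsWithin_iff.1 h3
    obtain ⟨k₂, hk₂⟩ := exists_nat_one_div_lt hτ
    refine mem_iUnion.2 ⟨max k₁ k₂, fun r hr0 hr => ?_⟩
    have hrτ : r < τ := by
      refine hr.trans (lt_of_le_of_lt ?_ hk₂)
      gcongr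
      exact le_max_right _ _
    have h4 : ν (closedBall y r) / volume (closedBall y r) < k₁ :=
      hτ' ⟨by rw [mem_ball, Real.dist_eq, sub_zero, abs_of_pos hr0]; exact hrτ, hr0⟩
    have h5 : ν (closedBall y r) ≤ k₁ * volume (closedBall y r) :=
      (ENNReal.div_le_iff_le_mul (Or.inl (measure_closedBall_pos _ _ hr0).ne')
        (Or.inl measure_closedBall_lt_top.ne)).1 h4.le
    refine h5.trans ?_
    gcongr
    exact le_max_left _ _
  by_contra! hcon
  have h0 : volume (⋃ k, A ∩ S k) = 0 :=
    measure_iUnion_null fun k => le_antisymm (hcon k) zero_le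
  rw [← inter_iUnion] at h0
  have h1 : volume A ≤ volume (A ∩ ⋃ k, S k) + volume (⋃ k, S k)ᶜ := by
    refine (measure_mono fun y hy => ?_).trans (measure_union_le _ _)
    by_cases h : y ∈ ⋃ k, S k
    · exact Or.inl ⟨hy, h⟩
    · exact Or.inr h
  have h2 : volume (⋃ k, S k)ᶜ = 0 := hae
  rw [h0, h2, add_zero] at h1
  exact absurd hA (not_lt.2 h1)

/-- Near a density point, a set meets every ball of proportional radius. -/
lemma exists_density_point {A : Set (EuclideanSpace ℝ (Fin n))} (hA : 0 < volume A) :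
    ∃ y₀ ∈ A, ∀ (y : EuclideanSpace ℝ (Fin n)) (r : ℝ), 0 < r → ∀ᶠ t in 𝓝[>] (0 : ℝ),
      ∃ y₁ ∈ A, dist y₁ (y₀ + t • y) ≤ r * t := by
  have hG := Besicovitch.ae_tendsto_measure_inter_div
    (volume : Measure (EuclideanSpace ℝ (Fin n))) A
  have hex : ∃ y₀ ∈ A, Tendsto (fun r => volume (A ∩ closedBall y₀ r) / volume (closedBall y₀ r))
      (𝓝[>] 0) (𝓝 1) := by
    by_contra! hcon
    have h1 := Measure.le_restrict_apply (μ := volume) A {x | ¬ Tendsto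
      (fun r => volume (A ∩ closedBall x r) / volume (closedBall x r)) (𝓝[>] 0) (𝓝 1)}
    have h2 : A ⊆ {x | ¬ Tendsto
      (fun r => volume (A ∩ closedBall x r) / volume (closedBall x r)) (𝓝[>] 0) (𝓝 1)} ∩ A :=
      fun x hx => ⟨hcon x hx, hx⟩
    have h3 := (measure_mono h2).trans h1
    rw [ae_iff] at hG
    rw [hG] at h3
    exact absurd hA (not_lt.2 h3)
  obtain ⟨y₀, hy₀, hden⟩ := hex
  refine ⟨y₀, hy₀, fun y r hr => ?_⟩
  set R := ‖y‖ + r with hR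
  have hR0 : 0 < R := by positivity
  set q : ENNReal := ENNReal.ofReal ((r / R) ^ n) with hq
  have hq0 : 0 < q := ENNReal.ofReal_pos.2 (by positivity)
  have hlt : 1 - q < 1 := ENNReal.sub_lt_self ENNReal.one_ne_top one_ne_zero hq0.ne'
  have h1 := hden.eventually (lt_mem_nhds hlt)
  have htend : Tendsto (fun t : ℝ => R * t) (𝓝[>] 0) (𝓝[>] 0) := by
    refine tendsto_nhdsWithin_iff.2 ⟨?_, ?_⟩
    · have : Tendsto (fun t : ℝ => R * t) (𝓝 0) (𝓝 (R * 0)) := by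
        exact (continuous_const.mul continuous_id).tendsto 0
      rw [mul_zero] at this
      exact this.mono_left nhdsWithin_le_nhds
    · filter_upwards [self_mem_nhdsWithin] with t ht
      exact mul_pos hR0 ht
  filter_upwards [htend.eventually h1, self_mem_nhdsWithin] with t ht ht0
  have ht0 : 0 < t := ht0
  by_contra! hcon
  have hsub : closedBall (y₀ + t • y) (r * t) ⊆ closedBall y₀ (R * t) := by
    refine closedBall_subset_closedBall' ?_
    rw [dist_self_add_left, norm_smul, Real.norm_eq_abs, abs_of_pos ht0, hR]
    linarith
  have hsub2 : A ∩ closedBall y₀ (R * t) ⊆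
      closedBall y₀ (R * t) \ closedBall (y₀ + t • y) (r * t) := fun z hz =>
    ⟨hz.2, fun hz' => absurd (mem_closedBall.1 hz') (not_le.2 (hcon z hz.1))⟩
  have hvol : volume (closedBall (y₀ + t • y) (r * t)) = q * volume (closedBall y₀ (R * t)) := by
    rw [Measure.addHaar_closedBall _ _ (by positivity), Measure.addHaar_closedBall _ _ (by positivity),
      hq, ← mul_assoc, ← ENNReal.ofReal_mul (by positivity), finrank_euclideanSpace_fin]
    congr 2
    rw [← mul_pow]
    congr 1
    field_simp
  have h2 := measure_mono (μ := volume) hsub2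
  rw [measure_sdiff hsub measurableSet_closedBall.nullMeasurableSet measure_closedBall_lt_top.ne,
    hvol] at h2
  have hpos : volume (closedBall y₀ (R * t)) ≠ 0 :=
    (measure_closedBall_pos _ _ (by positivity)).ne'
  have hfin : volume (closedBall y₀ (R * t)) ≠ ⊤ := measure_closedBall_lt_top.ne
  refine absurd ht (not_lt.2 ?_)
  rw [ENNReal.div_le_iff_le_mul (Or.inl hpos) (Or.inl hfin), ENNReal.sub_mul (fun _ _ => hfin),
    one_mul]
  exact h2

variable {Z : Type*} [MetricSpace Z] [MeasurableSpace Z] [BorelSpace Z]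

/-- A Lipschitz map with image of positive volume is regular on all small scales near some point. -/
lemma exists_regular_point {m : Measure Z} [IsFiniteMeasure m] {C d : ℝ} (hC : 0 < C) (hd : 0 < d)
    (hm : ∀ (z : Z) (R : ℝ), 0 < R → R ≤ d → ENNReal.ofReal (R ^ n / C) ≤ m (ball z R))
    {f : Z → EuclideanSpace ℝ (Fin n)} {L : NNReal} (hf : LipschitzWith L f)
    (hvol : 0 < volume (range f)) :
    ∃ (x₀ : Z) (N : ℕ), ∀ (y : EuclideanSpace ℝ (Fin n)) (r : ℝ), 0 < r →
      ∀ᶠ t in 𝓝[>] (0 : ℝ), ∀ T : Finset Z, (∀ b ∈ T, dist (f b) (f x₀ + t • y) ≤ 2 * (r * t)) →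
        (∀ b ∈ T, ∀ b' ∈ T, b ≠ b' → r * t / 2 ≤ dist b b') → T.card ≤ N := by
  have hfm : Measurable f := hf.continuous.measurable
  obtain ⟨k, hk⟩ := exists_ball_bound (m.map f) hvol
  obtain ⟨y₀, ⟨⟨x₀, rfl⟩, hy₀⟩, hden⟩ := exists_density_point hk
  set v := (volume (ball (0 : EuclideanSpace ℝ (Fin n)) 1)).toReal with hv
  set B : ℝ := k * ((3 + L) ^ n * v) * (4 ^ n * C) with hB
  obtain ⟨N, hN⟩ := exists_nat_ge B
  refine ⟨x₀, N, fun y r hr => ?_⟩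
  have hsm : ∀ a : ℝ, 0 < a → ∀ᶠ t in 𝓝[>] (0 : ℝ), t < a := fun a ha =>
    nhdsWithin_le_nhds (gt_mem_nhds ha)
  filter_upwards [hden y r hr, self_mem_nhdsWithin, hsm (d / r) (by positivity),
    hsm (1 / ((k : ℝ) + 1) / ((3 + L) * r)) (by positivity)] with t ht ht0 htd htk T hT hsep
  have ht0 : 0 < t := ht0
  obtain ⟨y₁, ⟨-, hy₁⟩, hyd⟩ := ht
  rw [lt_div_iff₀ hr] at htd
  rw [lt_div_iff₀ (by positivity)] at htk
  set R := (3 + L) * (r * t) with hR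
  have hR0 : 0 < R := by positivity
  have hbd := hy₁ R hR0 (by rw [hR]; linarith)
  have hsub : ∀ b ∈ T, ball b (r * t / 4) ⊆ f ⁻¹' closedBall y₁ R := by
    intro b hb z hz
    rw [mem_preimage, mem_closedBall]
    have h1 := hf.dist_le_mul z b
    have h2 : (L : ℝ) * dist z b ≤ L * (r * t) := by
      gcongr
      have := mem_ball.1 hz
      have h3 : 0 < r * t := by positivity
      linarith
    have h3 := hT b hb
    have h4 := dist_triangle (f z) (f b) y₁
    have h5 := dist_triangle_right (f b) y₁ (f x₀ + t • y)
    rw [hR]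
    linarith
  have hdisj : (T : Set Z).PairwiseDisjoint fun b => ball b (r * t / 4) := by
    intro b hb b' hb' hne
    refine ball_disjoint_ball ?_
    have := hsep b hb b' hb' hne
    linarith
  have hsum : (T.card : ENNReal) * ENNReal.ofReal ((r * t / 4) ^ n / C) ≤
      (m.map f) (closedBall y₁ R) := by
    rw [Measure.map_apply hfm measurableSet_closedBall]
    calc (T.card : ENNReal) * ENNReal.ofReal ((r * t / 4) ^ n / C)
        = ∑ b ∈ T, ENNReal.ofReal ((r * t / 4) ^ n / C) := by
          rw [Finset.sum_const, nsmul_eq_mul]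
      _ ≤ ∑ b ∈ T, m (ball b (r * t / 4)) := Finset.sum_le_sum fun b _ =>
          hm b _ (by positivity) (by have : 0 < r * t := by positivity
                                     linarith)
      _ = m (⋃ b ∈ T, ball b (r * t / 4)) :=
          (measure_biUnion_finset hdisj fun b _ => measurableSet_ball).symm
      _ ≤ m (f ⁻¹' closedBall y₁ R) := measure_mono (iUnion₂_subset hsub)
  have hfin := hsum.trans hbd
  rw [Measure.addHaar_closedBall _ _ hR0.le, finrank_euclideanSpace_fin,
    ← ENNReal.ofReal_toReal (measure_ball_lt_top (μ := volume)
      (x := (0 : EuclideanSpace ℝ (Fin n))) (r := 1)).ne, ← hv,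
    ← ENNReal.ofReal_natCast, ← ENNReal.ofReal_natCast k, ← ENNReal.ofReal_mul (by positivity),
    ← ENNReal.ofReal_mul (by positivity), ← ENNReal.ofReal_mul (by positivity),
    ENNReal.ofReal_le_ofReal_iff (by positivity)] at hfin
  have hfin2 : (T.card : ℝ) ≤ B := by
    have hp : 0 < (r * t) ^ n / (4 ^ n * C) := by positivity
    have e1 : (T.card : ℝ) * ((r * t / 4) ^ n / C) = T.card * ((r * t) ^ n / (4 ^ n * C)) := by
      rw [div_pow, div_div]
    have e2 : (k : ℝ) * (R ^ n * v) = B * ((r * t) ^ n / (4 ^ n * C)) := by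
      rw [hR, hB, mul_pow]
      field_simp
    rw [e1, e2] at hfin
    exact le_of_mul_le_mul_right hfin hp
  exact_mod_cast hfin2.trans hN

end density

section prelim

variable {Z : Type*} [MetricSpace Z] {n : ℕ}

lemma not_smallOrder_univ_of_topDim [CompactSpace Z] [Nonempty Z] (hn : 0 < n)
    (hdim : topDim Z = (n : ℕ∞)) : ¬ SmallOrder n (univ : Set Z) := by
  obtain ⟨m, rfl⟩ := Nat.exists_eq_add_of_le' hn
  intro h
  have h1 : topDim Z ≤ (m : ℕ∞) := iInf₂_le m h.covDimLE
  rw [hdim] at h1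
  exact absurd (Nat.cast_le.1 h1) (by omega)

lemma exists_lipschitz_volume_range_pos [CompactSpace Z] (h : ¬ SmallOrder n (univ : Set Z)) :
    ∃ (f : Z → EuclideanSpace ℝ (Fin n)) (L : NNReal), LipschitzWith L f ∧
      0 < volume (range f) := by
  by_contra! hcon
  exact h (smallOrder_univ_of_null fun f ⟨L, hL⟩ => le_antisymm (hcon f L hL) bot_le)

lemma not_smallOrder_of_interior_nonempty [CompactSpace Z] (hn : 0 < n) {δ : ℝ} (hδ : 0 < δ)
    {η : NNReal ≃ₜ NNReal}
    (htriple : ∀ z₁ z₂ z₃ : Z, z₁ ≠ z₂ → z₁ ≠ z₃ → z₂ ≠ z₃ →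
      ∃ g : Z ≃ₜ Z, IsQuasiMobius η g ∧
        δ ≤ dist (g z₁) (g z₂) ∧ δ ≤ dist (g z₁) (g z₃) ∧ δ ≤ dist (g z₂) (g z₃))
    (hperf : ∀ x : Z, (𝓝[≠] x).NeBot) (huniv : ¬ SmallOrder n (univ : Set Z))
    {K : Set Z} (hK : IsClosed K) (hKi : (interior K).Nonempty) : ¬ SmallOrder n K := by
  obtain ⟨x, hx⟩ := hKi
  obtain ⟨r, hr, hrK⟩ := Metric.nhds_basis_closedBall.mem_iff.1 (mem_interior_iff_mem_nhds.1 hx)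
  intro h
  exact huniv (((h.thin hK).mono hrK).univ_of_closedBall hn hδ htriple (hperf x) hr).smallOrder_univ

end prelim

section regular

variable {Z : Type*} [MetricSpace Z] [MeasurableSpace Z] [BorelSpace Z] {n : ℕ}

lemma AhlforsRegular.isFiniteMeasure [CompactSpace Z] (h : AhlforsRegular (n : ℝ) Z) :
    IsFiniteMeasure (μH[(n : ℝ)] : Measure Z) := by
  obtain ⟨-, -, hd, C, -, hC⟩ := h
  have : IsFiniteMeasureOnCompacts (μH[(n : ℝ)] : Measure Z) := by
    have : IsLocallyFiniteMeasure (μH[(n : ℝ)] : Measure Z) := ⟨fun z =>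
      ⟨ball z _, ball_mem_nhds z hd, (hC z _ hd le_rfl).2.trans_lt ENNReal.ofReal_lt_top⟩⟩
    infer_instance
  exact ⟨isCompact_univ.measure_lt_top⟩

lemma AhlforsRegular.exists_mem_annulus (h : AhlforsRegular (n : ℝ) Z) :
    ∃ lam : ℝ, 1 < lam ∧ ∀ (z : Z) (R : ℝ), 0 < R → R ≤ Metric.diam (univ : Set Z) →
      ∃ w, R / lam ≤ dist w z ∧ dist w z < R := by
  obtain ⟨hn, -, hd, C, hC1, hC⟩ := h
  have hn0 : n ≠ 0 := by rintro rfl; simp at hn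
  refine ⟨2 * C ^ 2, by nlinarith, fun z R hR hRd => ?_⟩
  by_contra! hcon
  have hsub : ball z R ⊆ ball z (R / (2 * C ^ 2)) := fun w hw => by
    by_contra hw'
    exact absurd (hcon w (not_lt.1 hw')) (not_le.2 hw)
  have hlt : R / (2 * C ^ 2) ≤ R := div_le_self hR.le (by nlinarith)
  have h1 := ((hC z R hR hRd).1.trans (measure_mono hsub)).trans
    (hC z (R / (2 * C ^ 2)) (by positivity) (hlt.trans hRd)).2
  rw [ENNReal.ofReal_le_ofReal_iff (by positivity), Real.rpow_natCast, Real.rpow_natCast, div_pow,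
    mul_div_assoc', div_le_div_iff₀ (by positivity) (by positivity)] at h1
  have h2 : 2 * C ^ 2 ≤ (2 * C ^ 2) ^ n := le_self_pow₀ (by nlinarith) hn0
  have h3 : 0 < R ^ n := by positivity
  have h4 := mul_le_mul_of_nonneg_left h2 h3.le
  have h5 : 0 < R ^ n * C ^ 2 := by positivity
  nlinarith

lemma AhlforsRegular.exists_triple (h : AhlforsRegular (n : ℝ) Z) :
    ∃ C : ℝ, 0 < C ∧ ∀ (z : Z) (R : ℝ), 0 < R → R ≤ Metric.diam (univ : Set Z) →
      ∃ s : Fin 3 → Z, s 0 = z ∧ (∀ i j, i ≠ j → R / C ≤ dist (s i) (s j)) ∧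
        ∀ i j, dist (s i) (s j) ≤ C * R := by
  obtain ⟨lam, hlam, hann⟩ := h.exists_mem_annulus
  refine ⟨2 * lam ^ 2, by positivity, fun z R hR hRd => ?_⟩
  obtain ⟨a, ha1, ha2⟩ := hann z R hR hRd
  obtain ⟨b, hb1, hb2⟩ := hann z (R / (2 * lam)) (by positivity)
    ((div_le_self hR.le (by linarith)).trans hRd)
  have e0 : R / (2 * lam ^ 2) = R / (2 * lam) / lam := by field_simp
  have e1 : R / (2 * lam) = R / lam / 2 := by field_simp
  have hl : R / (2 * lam) ≤ R := div_le_self hR.le (by linarith)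
  have h0 : R / (2 * lam) / lam ≤ R / (2 * lam) := div_le_self (by positivity) hlam.le
  have hab := dist_triangle a b z
  have hab' := dist_triangle_right a b z
  have hbig : 2 * R ≤ 2 * lam ^ 2 * R := by
    have : 1 ≤ lam ^ 2 := one_le_pow₀ hlam.le
    nlinarith
  have hp : 0 < R / lam := by positivity
  refine ⟨![z, a, b], rfl, fun i j hij => ?_, fun i j => ?_⟩
  · rw [e0]
    fin_cases i <;> fin_cases j <;>
      simp [dist_comm z a, dist_comm z b, dist_comm b a] at hij ⊢ <;> linarith
  · fin_cases i <;> fin_cases j <;>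
      simp [dist_comm z a, dist_comm z b, dist_comm b a] <;> first | positivity | linarith

lemma AhlforsRegular.neBot (h : AhlforsRegular (n : ℝ) Z) (x : Z) : (𝓝[≠] x).NeBot := by
  obtain ⟨lam, hlam, hann⟩ := h.exists_mem_annulus
  rw [← mem_closure_iff_nhdsWithin_neBot, Metric.mem_closure_iff]
  intro r hr
  have hm := lt_min hr h.2.2.1
  obtain ⟨w, hw1, hw2⟩ := hann x (min r (Metric.diam (univ : Set Z))) hm (min_le_right _ _)
  refine ⟨w, dist_pos.1 (lt_of_lt_of_le (by positivity) hw1), ?_⟩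
  rw [dist_comm]
  exact hw2.trans_le (min_le_left _ _)

end regular

lemma qmMetric_dist {Z : Type*} [MetricSpace Z] (o : Z) :
    QMMetric o (dist : Z → Z → ℝ) (fun t => t) (fun t => t) where
  self u _ := dist_self u
  comm u v _ _ := dist_comm u v
  tri u v w _ _ _ := dist_triangle u v w
  pos _ _ _ _ h := dist_pos.2 h
  lower _ _ _ _ _ _ _ _ _ _ _ _ := le_rfl
  upper _ _ _ _ _ _ _ _ _ _ _ _ := le_rfl

lemma dist_add_smul_eq {E : Type*} [NormedAddCommGroup E] [NormedSpace ℝ E] {t : ℝ} (ht : 0 < t)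
    (a b y : E) : dist a (b + t • y) = t * dist (t⁻¹ • (a - b)) y := by
  have : a - (b + t • y) = t • (t⁻¹ • (a - b) - y) := by
    rw [smul_sub, smul_inv_smul₀ ht.ne']; abel
  rw [dist_eq_norm, this, norm_smul, Real.norm_of_nonneg ht.le, dist_eq_norm]

lemma dist_smul_sub_eq {E : Type*} [NormedAddCommGroup E] [NormedSpace ℝ E] {t : ℝ} (ht : 0 < t)
    (a b c : E) : dist (t⁻¹ • (a - c)) (t⁻¹ • (b - c)) = dist a b / t := by
  rw [dist_smul₀, dist_sub_right, Real.norm_of_nonneg (by positivity)]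
  field_simp

/-- Blowing up a Lipschitz map with image of positive volume yields a regular map on the
complement of a point. -/
theorem exists_regular_blowup {Z : Type*} [MetricSpace Z] [CompactSpace Z] [MeasurableSpace Z]
    [BorelSpace Z] {n : ℕ} (hreg : AhlforsRegular (n : ℝ) Z)
    (hdim : ¬ SmallOrder n (univ : Set Z))
    {δ : ℝ} (hδ : 0 < δ) {η : NNReal ≃ₜ NNReal}
    (htriple : ∀ z₁ z₂ z₃ : Z, z₁ ≠ z₂ → z₁ ≠ z₃ → z₂ ≠ z₃ →
      ∃ g : Z ≃ₜ Z, IsQuasiMobius η g ∧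
        δ ≤ dist (g z₁) (g z₂) ∧ δ ≤ dist (g z₁) (g z₃) ∧ δ ≤ dist (g z₂) (g z₃)) :
    ∃ (p : Z) (ρ : Z → Z → ℝ) (F : Z → EuclideanSpace ℝ (Fin n)) (L : NNReal) (N : ℕ),
      QMMetric p ρ (gaugeOf η) (gaugeOf (dualHomeo η)) ∧
      (∀ u v, u ≠ p → v ≠ p → dist (F u) (F v) ≤ L * ρ u v) ∧
      ∀ (y : EuclideanSpace ℝ (Fin n)) (r : ℝ), 0 < r → ∀ T : Finset Z,
        (∀ u ∈ T, u ≠ p ∧ dist (F u) y ≤ r) →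
        (∀ u ∈ T, ∀ v ∈ T, u ≠ v → r ≤ ρ u v) → T.card ≤ N := by
  classical
  obtain ⟨f, L, hf, hvol⟩ := exists_lipschitz_volume_range_pos hdim
  have hfin := hreg.isFiniteMeasure
  obtain ⟨x₀, N, hN⟩ : ∃ (x₀ : Z) (N : ℕ), ∀ (y : EuclideanSpace ℝ (Fin n)) (r : ℝ), 0 < r →
      ∀ᶠ t in 𝓝[>] (0 : ℝ), ∀ T : Finset Z, (∀ b ∈ T, dist (f b) (f x₀ + t • y) ≤ 2 * (r * t)) →
        (∀ b ∈ T, ∀ b' ∈ T, b ≠ b' → r * t / 2 ≤ dist b b') → T.card ≤ N := by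
    obtain ⟨-, -, hd, C, hC1, hC⟩ := hreg
    refine exists_regular_point (m := μH[(n : ℝ)]) (C := C) (by linarith) hd (fun z R hR hRd => ?_)
      hf hvol
    simpa using (hC z R hR hRd).1
  obtain ⟨C, hC, htr⟩ := hreg.exists_triple
  have hperf := hreg.neBot
  obtain ⟨o, ho⟩ : ∃ o, o ≠ x₀ := by
    have := hperf x₀
    exact (self_mem_nhdsWithin (a := x₀) (s := {x₀}ᶜ) |> Filter.nonempty_of_mem)
  set d := min (Metric.diam (univ : Set Z)) (dist o x₀ / (2 * C)) with hdd
  have hd : 0 < d := lt_min hreg.2.2.1 (by have := dist_pos.2 ho; positivity)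
  set r : ℕ → ℝ := fun k => d * (1 / ((k : ℝ) + 1)) with hrdef
  have hr : ∀ k, 0 < r k := fun k => by positivity
  have hrd : ∀ k, r k ≤ d := fun k => by
    have : 1 / ((k : ℝ) + 1) ≤ 1 := by
      rw [div_le_one (by positivity)]; linarith [k.cast_nonneg (α := ℝ)]
    exact mul_le_of_le_one_right hd.le this
  have hr0 : Tendsto r atTop (𝓝 0) := by
    simpa [hrdef] using tendsto_one_div_add_atTop_nhds_zero_nat.const_mul d
  choose s hs0 hlow hhigh using fun k => htr x₀ (r k) (hr k) ((hrd k).trans (min_le_left _ _))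
  have hso : ∀ k i, s k i ≠ o := by
    rintro k i rfl
    have h1 := hhigh k i 0
    rw [hs0] at h1
    have h2 := (hrd k).trans (min_le_right _ _)
    rw [le_div_iff₀ (by positivity)] at h2
    have := dist_pos.2 ho
    nlinarith
  obtain ⟨p, ρ, g, hρ, hbd, hlim, -⟩ := exists_blowup (qmMetric_dist o) IsGauge.id IsGauge.id
    (hperf o) hδ htriple hC hs0 hso hr hr0 hlow (fun k i j _ => hhigh k i j)
  have hrω : Tendsto r (hyperfilter ℕ : Filter ℕ) (𝓝[>] 0) := by
    refine tendsto_nhdsWithin_iff.2 ⟨hr0.mono_left ?_, .of_forall hr⟩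
    exact Nat.cofinite_eq_atTop ▸ hyperfilter_le_cofinite
  have hFex : ∀ u, ∃ l, u ≠ p → Tendsto (fun k => (r k)⁻¹ • (f ((g k).symm u) - f x₀))
      (hyperfilter ℕ : Filter ℕ) (𝓝 l) := by
    intro u
    by_cases hu : u = p
    · exact ⟨0, fun h => absurd hu h⟩
    obtain ⟨M, hM⟩ := hbd u hu
    obtain ⟨l, hl⟩ := exists_tendsto_hyperfilter
      (a := fun k => (r k)⁻¹ • (f ((g k).symm u) - f x₀)) (c := 0) (M := L * M) (by
        filter_upwards [hM] with k hk
        have := dist_smul_sub_eq (hr k) (f ((g k).symm u)) (f x₀) (f x₀)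
        rw [sub_self, smul_zero] at this
        rw [this, div_le_iff₀ (hr k), mul_assoc]
        exact (hf.dist_le_mul _ _).trans (mul_le_mul_of_nonneg_left hk.2 L.2))
    exact ⟨l, fun _ => hl⟩
  choose F hF using hFex
  refine ⟨p, ρ, F, L, N, hρ, fun u v hu hv => ?_, fun y t ht T hT hTsep => ?_⟩
  · refine le_of_tendsto_of_tendsto' ((hF u hu).dist (hF v hv)) ((hlim u v hu hv).const_mul _)
      fun k => ?_
    rw [dist_smul_sub_eq (hr k), mul_div_assoc']
    exact div_le_div_of_nonneg_right (hf.dist_le_mul _ _) (hr k).le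
  · have h1 : ∀ᶠ k in (hyperfilter ℕ : Filter ℕ), ∀ u ∈ T,
        dist ((r k)⁻¹ • (f ((g k).symm u) - f x₀)) y < 2 * t :=
      (Finset.eventually_all T).2 fun u hu =>
        ((hF u (hT u hu).1).dist tendsto_const_nhds).eventually_lt_const
          (by linarith [(hT u hu).2])
    have h2 : ∀ᶠ k in (hyperfilter ℕ : Filter ℕ), ∀ u ∈ T, ∀ v ∈ T, u ≠ v →
        t / 2 < dist ((g k).symm u) ((g k).symm v) / r k :=
      (Finset.eventually_all T).2 fun u hu => (Finset.eventually_all T).2 fun v hv => by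
        by_cases huv : u = v
        · exact .of_forall fun k h => absurd huv h
        filter_upwards [(hlim u v (hT u hu).1 (hT v hv).1).eventually_const_lt
          (show t / 2 < ρ u v by linarith [hTsep u hu v hv huv])] with k hk _ using hk
    obtain ⟨k, hk, hk1, hk2⟩ := ((hrω.eventually (hN y t ht)).and (h1.and h2)).exists
    have hcard := hk (T.image (g k).symm) (fun b hb => by
      obtain ⟨u, hu, rfl⟩ := Finset.mem_image.1 hb
      rw [dist_add_smul_eq (hr k)]
      nlinarith [hk1 u hu, hr k]) (fun b hb b' hb' hne => by
      obtain ⟨u, hu, rfl⟩ := Finset.mem_image.1 hb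
      obtain ⟨v, hv, rfl⟩ := Finset.mem_image.1 hb'
      have := hk2 u hu v hv fun h => hne (by rw [h])
      rw [lt_div_iff₀ (hr k)] at this
      linarith)
    rwa [Finset.card_image_of_injective _ (g k).symm.injective] at hcard

section topology

variable {Z : Type*} [MetricSpace Z] {o : Z} {ρ : Z → Z → ℝ} {θ₁ θ₂ : ℝ → ℝ}

lemma exists_injective_triple_ne (ho : (𝓝[≠] o).NeBot) :
    ∃ t : Fin 3 → Z, Function.Injective t ∧ ∀ i, t i ≠ o := by
  have h1 : ({o}ᶜ : Set Z).Infinite := by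
    rw [compl_eq_univ_sdiff]
    exact (infinite_of_mem_nhds o univ_mem).sdiff (finite_singleton o)
  exact ⟨fun i => h1.natEmbedding _ i, fun i j hij =>
    Fin.ext ((h1.natEmbedding _).injective (Subtype.ext hij)), fun i => (h1.natEmbedding _ i).2⟩

lemma QMMetric.exists_dist_lt [CompactSpace Z] (h : QMMetric o ρ θ₁ θ₂) (h₁ : IsGauge θ₁)
    (ho : (𝓝[≠] o).NeBot) {ε : ℝ} (hε : 0 < ε) :
    ∃ κ > 0, ∀ u v, u ≠ o → v ≠ o → ρ u v < κ → dist u v < ε := by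
  obtain ⟨t, ht, hto⟩ := exists_injective_triple_ne ho
  obtain ⟨C, hC, δ, hδ, hnt⟩ := h.exists_normTriple ht hto
  obtain ⟨D, hD⟩ := exists_dist_le (Z := Z)
  obtain ⟨κ, hκ, hh⟩ := exists_dist_lt_of_rho_lt (θ₂ := θ₂) h₁ hC hδ hD hε
  exact ⟨κ, hκ, hh o ρ t h hnt⟩

lemma QMMetric.exists_rho_lt [CompactSpace Z] (h : QMMetric o ρ θ₁ θ₂) (h₂ : IsGauge θ₂)
    (ho : (𝓝[≠] o).NeBot) {u : Z} (hu : u ≠ o) {ε : ℝ} (hε : 0 < ε) :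
    ∃ κ > 0, ∀ v, v ≠ o → dist u v < κ → ρ u v < ε := by
  obtain ⟨t, ht, hto⟩ := exists_injective_triple_ne ho
  obtain ⟨C, hC, δ, hδ, hnt⟩ := h.exists_normTriple ht hto
  obtain ⟨D, hD⟩ := exists_dist_le (Z := Z)
  obtain ⟨κ, hκ, hh⟩ := exists_rho_lt_of_dist_lt (θ₁ := θ₁) h₂ hC hδ hD (h.nonneg hu (hto 0)) hε
  exact ⟨κ, hκ, fun v hv => hh o ρ t h hnt u v hu hv le_rfl⟩

lemma QMMetric.abs_sub_le (h : QMMetric o ρ θ₁ θ₂) {a u v : Z} (ha : a ≠ o) (hu : u ≠ o)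
    (hv : v ≠ o) : |ρ a u - ρ a v| ≤ ρ u v := by
  rw [abs_le]
  have h1 := h.tri a u v ha hu hv
  have h2 := h.tri a v u ha hv hu
  rw [h.comm v u hv hu] at h2
  constructor <;> linarith

lemma QMMetric.continuousOn_of_lipschitz [CompactSpace Z] (h : QMMetric o ρ θ₁ θ₂)
    (h₂ : IsGauge θ₂) (ho : (𝓝[≠] o).NeBot) {E : Type*} [PseudoMetricSpace E] {F : Z → E}
    {L : NNReal} (hF : ∀ u v, u ≠ o → v ≠ o → dist (F u) (F v) ≤ L * ρ u v) :
    ContinuousOn F {o}ᶜ := by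
  refine Metric.continuousOn_iff.2 fun u hu ε hε => ?_
  obtain ⟨κ, hκ, hh⟩ := h.exists_rho_lt h₂ ho hu (ε := ε / (L + 1)) (by positivity)
  refine ⟨κ, hκ, fun v hv hvu => ?_⟩
  rw [dist_comm] at hvu ⊢
  have h1 := hh v hv hvu
  rw [lt_div_iff₀ (by positivity)] at h1
  have := h.nonneg hu hv
  linarith [hF u v hu hv]

lemma QMMetric.continuousOn [CompactSpace Z] (h : QMMetric o ρ θ₁ θ₂) (h₂ : IsGauge θ₂)
    (ho : (𝓝[≠] o).NeBot) {a : Z} (ha : a ≠ o) : ContinuousOn (ρ a) {o}ᶜ :=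
  h.continuousOn_of_lipschitz (L := 1) h₂ ho fun u v hu hv => by
    simpa [Real.dist_eq] using h.abs_sub_le ha hu hv

/-- A section of a regular map along a ball is Lipschitz. -/
lemma QMMetric.rho_le_of_regular [CompactSpace Z] (h : QMMetric o ρ θ₁ θ₂) (h₂ : IsGauge θ₂)
    (ho : (𝓝[≠] o).NeBot) {n N : ℕ} {F : Z → EuclideanSpace ℝ (Fin n)}
    (hreg : ∀ (y : EuclideanSpace ℝ (Fin n)) (r : ℝ), 0 < r → ∀ T : Finset Z,
      (∀ u ∈ T, u ≠ o ∧ dist (F u) y ≤ r) →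
      (∀ u ∈ T, ∀ v ∈ T, u ≠ v → r ≤ ρ u v) → T.card ≤ N)
    {y₀ : EuclideanSpace ℝ (Fin n)} {s : ℝ} {σ : EuclideanSpace ℝ (Fin n) → Z}
    (hσ : ContinuousOn σ (ball y₀ s)) (hσF : ∀ y ∈ ball y₀ s, σ y ≠ o ∧ F (σ y) = y)
    {y₁ y₂ : EuclideanSpace ℝ (Fin n)} (h1 : y₁ ∈ ball y₀ s) (h2 : y₂ ∈ ball y₀ s) :
    ρ (σ y₁) (σ y₂) ≤ N * dist y₁ y₂ := by
  classical
  by_contra! hcon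
  have hy : y₁ ≠ y₂ := by
    rintro rfl
    rw [h.self _ (hσF y₁ h1).1, dist_self, mul_zero] at hcon
    exact lt_irrefl _ hcon
  set d := dist y₁ y₂ with hd
  have hd0 : 0 < d := dist_pos.2 hy
  set γ : ℝ → EuclideanSpace ℝ (Fin n) := fun t => AffineMap.lineMap y₁ y₂ t with hγ
  have hγb : ∀ t ∈ Icc (0 : ℝ) 1, γ t ∈ ball y₀ s := fun t ht =>
    (convex_ball y₀ s).segment_subset h1 h2 (segment_eq_image_lineMap ℝ y₁ y₂ ▸
      mem_image_of_mem _ ht)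
  have hγc : Continuous γ := AffineMap.lineMap_continuous
  have hφ : ContinuousOn (fun t => ρ (σ y₁) (σ (γ t))) (Icc 0 1) :=
    (h.continuousOn h₂ ho (hσF y₁ h1).1).comp (hσ.comp hγc.continuousOn hγb)
      fun t ht => (hσF _ (hγb t ht)).1
  have hivt : ∀ i : Fin (N + 1), ∃ t ∈ Icc (0 : ℝ) 1, ρ (σ y₁) (σ (γ t)) = i * d := by
    intro i
    refine intermediate_value_Icc zero_le_one hφ ⟨?_, ?_⟩
    · simp only [hγ, AffineMap.lineMap_apply_zero, h.self _ (hσF y₁ h1).1]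
      positivity
    · simp only [hγ, AffineMap.lineMap_apply_one]
      refine le_trans (mul_le_mul_of_nonneg_right ?_ hd0.le) hcon.le
      exact_mod_cast Nat.lt_succ_iff.1 i.2
  choose t ht htv using hivt
  have hsep : ∀ i j, i ≠ j → d ≤ ρ (σ (γ (t i))) (σ (γ (t j))) := by
    intro i j hij
    refine le_trans ?_ (h.abs_sub_le (hσF y₁ h1).1 (hσF _ (hγb _ (ht i))).1
      (hσF _ (hγb _ (ht j))).1)
    rw [htv, htv, ← sub_mul, abs_mul, abs_of_pos hd0]
    refine le_mul_of_one_le_left hd0.le ?_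
    have : ((i : ℕ) : ℤ) - (j : ℕ) ≠ 0 := by
      rw [sub_ne_zero]; exact_mod_cast fun h => hij (Fin.ext h)
    exact_mod_cast Int.one_le_abs this
  have hinj : Function.Injective fun i => σ (γ (t i)) := by
    intro i j hij
    by_contra hne
    have := hsep i j hne
    simp only at hij
    rw [hij, h.self _ (hσF _ (hγb _ (ht j))).1] at this
    exact absurd hd0 (not_lt.2 this)
  have hcard := hreg y₁ d hd0 (Finset.univ.image fun i => σ (γ (t i))) (fun u hu => by
    obtain ⟨i, -, rfl⟩ := Finset.mem_image.1 hu
    refine ⟨(hσF _ (hγb _ (ht i))).1, ?_⟩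
    rw [(hσF _ (hγb _ (ht i))).2, dist_lineMap_left, Real.norm_of_nonneg (ht i).1]
    exact mul_le_of_le_one_left hd0.le (ht i).2) (fun u hu v hv huv => by
    obtain ⟨i, -, rfl⟩ := Finset.mem_image.1 hu
    obtain ⟨j, -, rfl⟩ := Finset.mem_image.1 hv
    exact hsep i j fun hij => huv (by rw [hij]))
  rw [Finset.card_image_of_injective _ hinj] at hcard
  simp at hcard

/-- Near some point a regular map is a bi-Lipschitz chart. -/
lemma QMMetric.exists_chart [CompactSpace Z] (h : QMMetric o ρ θ₁ θ₂) (h₁ : IsGauge θ₁)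
    (h₂ : IsGauge θ₂)
    (ho : (𝓝[≠] o).NeBot) {n N : ℕ} {F : Z → EuclideanSpace ℝ (Fin n)} {L : NNReal}
    (hF : ∀ u v, u ≠ o → v ≠ o → dist (F u) (F v) ≤ L * ρ u v)
    (hreg : ∀ (y : EuclideanSpace ℝ (Fin n)) (r : ℝ), 0 < r → ∀ T : Finset Z,
      (∀ u ∈ T, u ≠ o ∧ dist (F u) y ≤ r) →
      (∀ u ∈ T, ∀ v ∈ T, u ≠ v → r ≤ ρ u v) → T.card ≤ N)
    (hK : ∀ K : Set Z, IsClosed K → (interior K).Nonempty → ¬ SmallOrder n K) :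
    ∃ x, x ≠ o ∧ ∃ s > 0, ∃ σ : EuclideanSpace ℝ (Fin n) → Z,
      (∀ y ∈ ball (F x) s, σ y ≠ o ∧ F (σ y) = y) ∧
      (∀ y₁ ∈ ball (F x) s, ∀ y₂ ∈ ball (F x) s, ρ (σ y₁) (σ y₂) ≤ N * dist y₁ y₂) ∧
      ∃ κ > 0, ∀ z, z ≠ o → ρ z x < κ → F z ∈ ball (F x) s ∧ σ (F z) = z := by
  obtain ⟨w, hw⟩ : ∃ w, w ≠ o :=
    Filter.nonempty_of_mem (self_mem_nhdsWithin (a := o) (s := {o}ᶜ))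
  set c := dist w o / 2 with hc
  have hc0 : 0 < c := by have := dist_pos.2 hw; positivity
  have hFc := h.continuousOn_of_lipschitz h₂ ho hF
  set χ : Z → ℝ := fun z => max 0 (min 1 (2 / c * dist z o - 1)) with hχ
  have hχc : Continuous χ := by fun_prop
  have hχ1 : ∀ z, c < dist z o → χ z = 1 := fun z hz => by
    have : 1 ≤ 2 / c * dist z o - 1 := by
      have : 2 ≤ 2 / c * dist z o := by
        rw [div_mul_eq_mul_div, le_div_iff₀ hc0]; linarith
      linarith
    simp [hχ, min_eq_left this]
  have hχ0 : ∀ z, dist z o < c / 2 → χ z = 0 := fun z hz => by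
    have : 2 / c * dist z o - 1 ≤ 0 := by
      have : 2 / c * dist z o ≤ 1 := by
        rw [div_mul_eq_mul_div, div_le_iff₀ hc0]; linarith
      linarith
    exact max_eq_left ((min_le_right _ _).trans this)
  have hcont : Continuous fun z => χ z • F z := by
    refine continuous_iff_continuousAt.2 fun z => ?_
    by_cases hz : z = o
    · subst hz
      refine (continuousAt_const (y := 0)).congr ?_
      filter_upwards [ball_mem_nhds z (half_pos hc0)] with u hu
      simp [hχ0 u hu]
    · exact hχc.continuousAt.smul (hFc.continuousAt (isOpen_compl_singleton.mem_nhds hz))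
  have hΩne : ∀ z, c < dist z o → z ≠ o := by
    rintro z hz rfl
    rw [dist_self] at hz
    exact absurd hz hc0.not_gt
  obtain ⟨x, hx, V, hV, hxV, hVΩ, s, hs, σ, hσc, hσ, hσ'⟩ := exists_local_inverse (N := N) hcont
    (Ω := {z | c < dist z o}) (isOpen_lt continuous_const (by fun_prop)) ⟨w, by
      simp only [mem_ofPred_eq, hc]; linarith⟩ (fun y T hT => by
      obtain ⟨r, hr, hr0⟩ : ∃ r : ℝ, (∀ u ∈ T, ∀ v ∈ T, u ≠ v → r ≤ ρ u v) ∧ 0 < r := by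
        refine Eventually.exists (f := 𝓝[>] 0) (.and ?_ self_mem_nhdsWithin)
        refine (Finset.eventually_all T).2 fun u hu => (Finset.eventually_all T).2 fun v hv => ?_
        by_cases huv : u = v
        · exact .of_forall fun k h => absurd huv h
        filter_upwards [Ioo_mem_nhdsGT
          (h.pos u v (hΩne u (hT u hu).1) (hΩne v (hT v hv).1) huv)] with r hr _ using hr.2.le
      refine hreg y r hr0 T (fun u hu => ⟨hΩne u (hT u hu).1, ?_⟩) hr
      have := (hT u hu).2
      rw [hχ1 u (hT u hu).1, one_smul] at this
      rw [this, dist_self]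
      exact hr0.le) hK
  have hFV : ∀ z ∈ V, χ z • F z = F z := fun z hz => by rw [hχ1 z (hVΩ hz), one_smul]
  simp only [hFV x hxV] at hσc hσ hσ'
  have hσ2 : ∀ y ∈ ball (F x) s, σ y ≠ o ∧ F (σ y) = y := fun y hy =>
    ⟨hΩne _ (hVΩ (hσ y hy).1), by rw [← hFV _ (hσ y hy).1]; exact (hσ y hy).2⟩
  obtain ⟨ε, hε, hεV⟩ := Metric.isOpen_iff.1 hV x hxV
  obtain ⟨κ, hκ, hκd⟩ := h.exists_dist_lt h₁ ho hε
  refine ⟨x, hΩne x hx, s, hs, σ, hσ2, fun y₁ h1 y₂ h2 =>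
    h.rho_le_of_regular h₂ ho hreg hσc hσ2 h1 h2, κ, hκ, fun z hz hzx => ?_⟩
  have hzV : z ∈ V := hεV (hκd z x hz (hΩne x hx) hzx)
  have := hσ' z hzV
  rwa [hFV z hzV] at this

end topology

/-- Blowing up once more at the centre of a bi-Lipschitz chart gives a global bi-Lipschitz
parametrisation of the complement of a point by Euclidean space. -/
theorem QMMetric.exists_bilipschitz {Z : Type*} [MetricSpace Z] [CompactSpace Z] {o : Z}
    {ρ : Z → Z → ℝ} {θ₁ θ₂ : ℝ → ℝ} (h : QMMetric o ρ θ₁ θ₂) (h₁ : IsGauge θ₁) (h₂ : IsGauge θ₂)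
    (ho : (𝓝[≠] o).NeBot) {δ : ℝ} (hδ : 0 < δ) {η : NNReal ≃ₜ NNReal}
    (htriple : ∀ z₁ z₂ z₃ : Z, z₁ ≠ z₂ → z₁ ≠ z₃ → z₂ ≠ z₃ →
      ∃ g : Z ≃ₜ Z, IsQuasiMobius η g ∧
        δ ≤ dist (g z₁) (g z₂) ∧ δ ≤ dist (g z₁) (g z₃) ∧
          δ ≤ dist (g z₂) (g z₃))
    {n N : ℕ} (hn : 0 < n) {F : Z → EuclideanSpace ℝ (Fin n)} {L : NNReal}
    (hF : ∀ u v, u ≠ o → v ≠ o → dist (F u) (F v) ≤ L * ρ u v)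
    {x : Z} (hx : x ≠ o) {s : ℝ} (hs : 0 < s) {σ : EuclideanSpace ℝ (Fin n) → Z}
    (hσ : ∀ y ∈ ball (F x) s, σ y ≠ o ∧ F (σ y) = y)
    (hσN : ∀ y₁ ∈ ball (F x) s, ∀ y₂ ∈ ball (F x) s, ρ (σ y₁) (σ y₂) ≤ N * dist y₁ y₂)
    {κ : ℝ} (hκ : 0 < κ)
    (hσF : ∀ z, z ≠ o → ρ z x < κ → F z ∈ ball (F x) s ∧ σ (F z) = z) :
    ∃ (p : Z) (ρ' : Z → Z → ℝ) (F' : Z → EuclideanSpace ℝ (Fin n)),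
      QMMetric p ρ' (gaugeOf η ∘ θ₁) (θ₂ ∘ gaugeOf (dualHomeo η)) ∧
      (∀ u v, u ≠ p → v ≠ p → dist (F' u) (F' v) ≤ L * ρ' u v) ∧
      (∀ u v, u ≠ p → v ≠ p → ρ' u v ≤ N * dist (F' u) (F' v)) ∧
      ∀ y, ∃ u, u ≠ p ∧ F' u = y := by
  have hσx : σ (F x) = x := (hσF x hx (by rwa [h.self x hx])).2
  set e : EuclideanSpace ℝ (Fin n) := EuclideanSpace.single ⟨0, hn⟩ 1 with he
  have hen : ‖e‖ = 1 := by simp [he]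
  set r : ℕ → ℝ := fun k => s / 2 * (1 / ((k : ℝ) + 1)) with hrdef
  have hr : ∀ k, 0 < r k := fun k => by positivity
  have hrs : ∀ k, r k < s := fun k => by
    have : 1 / ((k : ℝ) + 1) ≤ 1 := by
      rw [div_le_one (by positivity)]; linarith [k.cast_nonneg (α := ℝ)]
    have := mul_le_of_le_one_right (half_pos hs).le this
    simp only [hrdef]
    linarith
  have hr0 : Tendsto r atTop (𝓝 0) := by
    simpa [hrdef] using tendsto_one_div_add_atTop_nhds_zero_nat.const_mul (s / 2)
  set c : Fin 3 → ℝ := ![0, 1, -1] with hc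
  have hc1 : ∀ i j, i ≠ j → 1 ≤ |c i - c j| := by
    intro i j hij
    fin_cases i <;> fin_cases j <;> simp [hc] at hij ⊢ <;> norm_num [abs_of_pos, abs_of_neg]
  have hc2 : ∀ i j, |c i - c j| ≤ 2 := by
    intro i j
    fin_cases i <;> fin_cases j <;> simp [hc] <;> norm_num [abs_of_pos, abs_of_neg]
  have hc3 : ∀ i, |c i| ≤ 1 := by
    intro i
    fin_cases i <;> simp [hc]
  set Y : ℕ → Fin 3 → EuclideanSpace ℝ (Fin n) := fun k i => F x + (r k * c i) • e with hY
  have hYb : ∀ k i, Y k i ∈ ball (F x) s := by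
    intro k i
    rw [mem_ball, dist_eq_norm, hY, add_sub_cancel_left, norm_smul, hen, mul_one, norm_mul,
      Real.norm_of_nonneg (hr k).le, Real.norm_eq_abs]
    exact (mul_le_of_le_one_right (hr k).le (hc3 i)).trans_lt (hrs k)
  have hYd : ∀ k i j, dist (Y k i) (Y k j) = r k * |c i - c j| := by
    intro k i j
    rw [hY, dist_add_left, dist_eq_norm, ← sub_smul, ← mul_sub, norm_smul, hen, mul_one, norm_mul,
      Real.norm_of_nonneg (hr k).le, Real.norm_eq_abs]
  set C : ℝ := 2 * N + L + 1 with hC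
  have hC0 : 0 < C := by positivity
  obtain ⟨p, ρ', g, hρ, hbd, hlim, hw⟩ := exists_blowup (x₀ := x) (C := C) (r := r)
    (s := fun k i => σ (Y k i)) h h₁ h₂ ho hδ htriple hC0 (fun k => by simp [hY, hc, hσx])
    (fun k i => (hσ _ (hYb k i)).1) hr hr0 (fun k i j hij => by
      have hpos := h.nonneg (hσ _ (hYb k i)).1 (hσ _ (hYb k j)).1
      have h1 := hF _ _ (hσ _ (hYb k i)).1 (hσ _ (hYb k j)).1
      rw [(hσ _ (hYb k i)).2, (hσ _ (hYb k j)).2, hYd] at h1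
      have h2 := mul_le_mul_of_nonneg_left (hc1 i j hij) (hr k).le
      rw [div_le_iff₀ hC0]
      have h3 : 0 ≤ ρ (σ (Y k i)) (σ (Y k j)) * (2 * N) := by positivity
      nlinarith) (fun k i j hij => by
      have h1 := hσN _ (hYb k i) _ (hYb k j)
      rw [hYd] at h1
      have h2 : (N : ℝ) * (r k * |c i - c j|) ≤ N * (r k * 2) := by
        gcongr
        exact hc2 i j
      have h3 : 0 ≤ (L + 1) * r k := by have := (hr k).le; positivity
      nlinarith)
  have hrω : Tendsto r (hyperfilter ℕ : Filter ℕ) (𝓝 0) :=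
    hr0.mono_left (Nat.cofinite_eq_atTop ▸ hyperfilter_le_cofinite)
  have hsmall : ∀ M ε : ℝ, 0 < ε → ∀ᶠ k in (hyperfilter ℕ : Filter ℕ), M * r k < ε := by
    intro M ε hε
    have := hrω.const_mul M
    rw [mul_zero] at this
    exact this.eventually_lt_const hε
  have hFex : ∀ u, ∃ l, u ≠ p → Tendsto (fun k => (r k)⁻¹ • (F ((g k).symm u) - F x))
      (hyperfilter ℕ : Filter ℕ) (𝓝 l) := by
    intro u
    by_cases hu : u = p
    · exact ⟨0, fun h => absurd hu h⟩
    obtain ⟨M, hM⟩ := hbd u hu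
    obtain ⟨l, hl⟩ := exists_tendsto_hyperfilter
      (a := fun k => (r k)⁻¹ • (F ((g k).symm u) - F x)) (c := 0) (M := L * M) (by
        filter_upwards [hM] with k hk
        have := dist_smul_sub_eq (hr k) (F ((g k).symm u)) (F x) (F x)
        rw [sub_self, smul_zero] at this
        rw [this, div_le_iff₀ (hr k), mul_assoc]
        exact (hF _ _ hk.1 hx).trans (mul_le_mul_of_nonneg_left hk.2 L.2))
    exact ⟨l, fun _ => hl⟩
  choose F' hF' using hFex
  refine ⟨p, ρ', F', hρ, fun u v hu hv => ?_, fun u v hu hv => ?_, fun y => ?_⟩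
  · refine le_of_tendsto_of_tendsto ((hF' u hu).dist (hF' v hv)) ((hlim u v hu hv).const_mul _) ?_
    obtain ⟨M, hM⟩ := hbd u hu
    obtain ⟨M', hM'⟩ := hbd v hv
    filter_upwards [hM, hM'] with k hk hk'
    rw [dist_smul_sub_eq (hr k), mul_div_assoc']
    exact div_le_div_of_nonneg_right (hF _ _ hk.1 hk'.1) (hr k).le
  · refine le_of_tendsto_of_tendsto (hlim u v hu hv)
      (((hF' u hu).dist (hF' v hv)).const_mul (N : ℝ)) ?_
    obtain ⟨M, hM⟩ := hbd u hu
    obtain ⟨M', hM'⟩ := hbd v hv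
    filter_upwards [hM, hM', hsmall M κ hκ, hsmall M' κ hκ] with k hk hk' hκ1 hκ2
    rw [dist_smul_sub_eq (hr k), mul_div_assoc']
    have h1 := hσF _ hk.1 (hk.2.trans_lt hκ1)
    have h2 := hσF _ hk'.1 (hk'.2.trans_lt hκ2)
    have h3 := hσN _ h1.1 _ h2.1
    rw [h1.2, h2.2] at h3
    exact div_le_div_of_nonneg_right h3 (hr k).le
  · have hball : ∀ᶠ k in (hyperfilter ℕ : Filter ℕ), F x + r k • y ∈ ball (F x) s := by
      filter_upwards [hsmall ‖y‖ s hs] with k hk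
      rw [mem_ball, dist_eq_norm, add_sub_cancel_left, norm_smul, Real.norm_of_nonneg (hr k).le,
        mul_comm]
      exact hk
    obtain ⟨u, hu, hlu⟩ := hw (fun k => σ (F x + r k • y)) (N * ‖y‖) (by
      filter_upwards [hball] with k hk
      refine ⟨(hσ _ hk).1, ?_⟩
      have h1 := hσN _ hk _ (mem_ball_self hs)
      rw [hσx, dist_eq_norm, add_sub_cancel_left, norm_smul, Real.norm_of_nonneg (hr k).le] at h1
      linarith)
    refine ⟨u, hu, tendsto_nhds_unique (hF' u hu) ?_⟩
    rw [tendsto_iff_dist_tendsto_zero]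
    have hL := hlu.const_mul (L : ℝ)
    rw [mul_zero] at hL
    refine squeeze_zero' (.of_forall fun _ => dist_nonneg) ?_ hL
    obtain ⟨M, hM⟩ := hbd u hu
    filter_upwards [hM, hball] with k hk hkb
    have h1 := hF _ _ hk.1 (hσ _ hkb).1
    rw [(hσ _ hkb).2, dist_add_smul_eq (hr k)] at h1
    rw [mul_div_assoc', le_div_iff₀ (hr k)]
    linarith

section stereographic

variable {E : Type*} [NormedAddCommGroup E] [InnerProductSpace ℝ E] {n : ℕ}
  [Fact (Module.finrank ℝ E = n + 1)]

lemma exists_stereographic'_symm_eq (v : sphere (0 : E) 1) :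
    ∃ U : EuclideanSpace ℝ (Fin n) →ₗᵢ[ℝ] E, (∀ x, inner ℝ (U x) (v : E) = 0) ∧
      ∀ x, ((stereographic' n v).symm x : E) =
        (‖x‖ ^ 2 + 4)⁻¹ • ((4 : ℝ) • U x + (‖x‖ ^ 2 - 4) • (v : E)) := by
  set U := (OrthonormalBasis.fromOrthogonalSpanSingleton (𝕜 := ℝ) n
    (ne_zero_of_mem_unit_sphere v)).repr with hU
  refine ⟨(Submodule.subtypeₗᵢ _).comp U.symm.toLinearIsometry, fun x => ?_, fun x => ?_⟩
  · exact Submodule.mem_orthogonal_singleton_iff_inner_left.1 (U.symm x).2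
  · rw [stereographic'_symm_apply, smul_add]
    have hn : ‖(U.symm x : E)‖ = ‖x‖ := U.symm.norm_map x
    simp only [← hU, hn]
    rfl

lemma sq_dist_sphere (P Q : sphere (0 : E) 1) :
    dist P Q ^ 2 = 2 - 2 * inner ℝ (P : E) (Q : E) := by
  rw [Subtype.dist_eq, dist_eq_norm, norm_sub_sq_real, norm_eq_of_mem_sphere,
    norm_eq_of_mem_sphere]
  ring

lemma dist_stereographic'_symm (v : sphere (0 : E) 1) (x y : EuclideanSpace ℝ (Fin n)) :
    dist ((stereographic' n v).symm x) ((stereographic' n v).symm y) =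
      4 * dist x y * ((√(‖x‖ ^ 2 + 4))⁻¹ * (√(‖y‖ ^ 2 + 4))⁻¹) := by
  obtain ⟨U, hU, hst⟩ := exists_stereographic'_symm_eq (n := n) v
  refine (sq_eq_sq₀ dist_nonneg (by positivity)).1 ?_
  have hx : 0 < ‖x‖ ^ 2 + 4 := by positivity
  have hy : 0 < ‖y‖ ^ 2 + 4 := by positivity
  have hvv : inner ℝ (v : E) (v : E) = 1 := by
    rw [real_inner_self_eq_norm_sq, norm_eq_of_mem_sphere]; norm_num
  have hd : dist x y ^ 2 = ‖x‖ ^ 2 - 2 * inner ℝ x y + ‖y‖ ^ 2 := by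
    rw [dist_eq_norm, norm_sub_sq_real]
  rw [sq_dist_sphere, hst, hst, mul_pow, mul_pow, mul_pow, inv_pow, inv_pow, Real.sq_sqrt hx.le,
    Real.sq_sqrt hy.le, hd]
  simp only [inner_smul_left, inner_smul_right, inner_add_left, inner_add_right, hU,
    real_inner_comm (U y) (v : E), hvv, U.inner_map_map, RCLike.conj_to_real]
  field_simp
  ring

lemma dist_stereographic'_symm_pole (v : sphere (0 : E) 1) (x : EuclideanSpace ℝ (Fin n)) :
    dist ((stereographic' n v).symm x) v = 4 * (√(‖x‖ ^ 2 + 4))⁻¹ := by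
  obtain ⟨U, hU, hst⟩ := exists_stereographic'_symm_eq (n := n) v
  refine (sq_eq_sq₀ dist_nonneg (by positivity)).1 ?_
  have hx : 0 < ‖x‖ ^ 2 + 4 := by positivity
  have hvv : inner ℝ (v : E) (v : E) = 1 := by
    rw [real_inner_self_eq_norm_sq, norm_eq_of_mem_sphere]; norm_num
  rw [sq_dist_sphere, hst, mul_pow, inv_pow, Real.sq_sqrt hx.le]
  simp only [inner_smul_left, inner_add_left, hU, hvv, RCLike.conj_to_real]
  field_simp
  ring

end stereographic

section extension

lemma continuousAt_realCross {Z : Type*} [MetricSpace Z] {a b c e : Z} (hae : a ≠ e)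
    (hbc : b ≠ c) :
    ContinuousAt (fun x : Z × Z × Z × Z => realCross dist x.1 x.2.1 x.2.2.1 x.2.2.2)
      (a, b, c, e) :=
  ContinuousAt.div (by fun_prop) (by fun_prop)
    (mul_ne_zero (dist_ne_zero.2 hae) (dist_ne_zero.2 hbc))

lemma realCross_le_of_dense {X Y : Type*} [MetricSpace X] [MetricSpace Y] {D : Set X}
    (hD : Dense D) {H : X → Y} (hH : Continuous H) (hinj : Function.Injective H) {θ : ℝ → ℝ}
    (hθ : Continuous θ)
    (hle : ∀ a ∈ D, ∀ b ∈ D, ∀ c ∈ D, ∀ e ∈ D, a ≠ b → a ≠ e → b ≠ c → c ≠ e →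
      realCross dist (H a) (H b) (H c) (H e) ≤ θ (realCross dist a b c e))
    {a b c e : X} (hab : a ≠ b) (hae : a ≠ e) (hbc : b ≠ c) (hce : c ≠ e) :
    realCross dist (H a) (H b) (H c) (H e) ≤ θ (realCross dist a b c e) := by
  have hD4 : Dense (D ×ˢ D ×ˢ D ×ˢ D) := hD.prod (hD.prod (hD.prod hD))
  have hne : (𝓝[D ×ˢ D ×ˢ D ×ˢ D] (a, b, c, e)).NeBot :=
    mem_closure_iff_nhdsWithin_neBot.1 (hD4 (a, b, c, e))
  have h1 : ContinuousAt (fun x : X × X × X × X => realCross dist (H x.1) (H x.2.1) (H x.2.2.1)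
      (H x.2.2.2)) (a, b, c, e) :=
    ContinuousAt.comp (f := fun x : X × X × X × X => (H x.1, H x.2.1, H x.2.2.1, H x.2.2.2))
      (continuousAt_realCross (hinj.ne hae) (hinj.ne hbc)) (by fun_prop)
  have h2 : ContinuousAt (fun x : X × X × X × X => θ (realCross dist x.1 x.2.1 x.2.2.1 x.2.2.2))
      (a, b, c, e) := ContinuousAt.comp hθ.continuousAt (continuousAt_realCross hae hbc)
  refine le_of_tendsto_of_tendsto (b := 𝓝[D ×ˢ D ×ˢ D ×ˢ D] (a, b, c, e))
    (h1.mono_left nhdsWithin_le_nhds) (h2.mono_left nhdsWithin_le_nhds) ?_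
  have hop : ∀ f g : X × X × X × X → X, Continuous f → Continuous g →
      f (a, b, c, e) ≠ g (a, b, c, e) →
      ∀ᶠ x in 𝓝[D ×ˢ D ×ˢ D ×ˢ D] (a, b, c, e), f x ≠ g x := fun f g hf hg hfg =>
    nhdsWithin_le_nhds ((isOpen_ne_fun hf hg).mem_nhds hfg)
  filter_upwards [self_mem_nhdsWithin,
    hop (fun x => x.1) (fun x => x.2.1) (by fun_prop) (by fun_prop) hab,
    hop (fun x => x.1) (fun x => x.2.2.2) (by fun_prop) (by fun_prop) hae,
    hop (fun x => x.2.1) (fun x => x.2.2.1) (by fun_prop) (by fun_prop) hbc,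
    hop (fun x => x.2.2.1) (fun x => x.2.2.2) (by fun_prop) (by fun_prop) hce]
    with x hx h1 h2 h3 h4
  exact hle _ hx.1 _ hx.2.1 _ hx.2.2.1 _ hx.2.2.2 h1 h2 h3 h4

end extension

/-- A metric on the complement of a point that is bi-Lipschitz to Euclidean space yields a
quasi-Möbius homeomorphism onto the sphere. -/
theorem QMMetric.exists_homeomorph_sphere {Z : Type*} [MetricSpace Z] [CompactSpace Z] {p : Z}
    {ρ : Z → Z → ℝ} {θ₁ θ₂ : ℝ → ℝ} (h : QMMetric p ρ θ₁ θ₂) (h₁ : IsGauge θ₁) (h₂ : IsGauge θ₂)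
    (hp : (𝓝[≠] p).NeBot) {n N : ℕ} {F : Z → EuclideanSpace ℝ (Fin n)} {L : NNReal}
    (hF : ∀ u v, u ≠ p → v ≠ p → dist (F u) (F v) ≤ L * ρ u v)
    (hFN : ∀ u v, u ≠ p → v ≠ p → ρ u v ≤ N * dist (F u) (F v))
    (hsurj : ∀ y, ∃ u, u ≠ p ∧ F u = y) :
    ∃ H : Z ≃ₜ StdSphere n, ∀ a b c e, a ≠ b → a ≠ e → b ≠ c → c ≠ e →
      realCross dist (H a) (H b) (H c) (H e) ≤
        ((L * N) ^ 2 + 1) * θ₂ (realCross dist a b c e) := by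
  classical
  have hfact := Fact.mk (@finrank_euclideanSpace_fin ℝ _ (n + 1))
  set v : StdSphere n := ⟨EuclideanSpace.single 0 1, by simp⟩ with hv
  set ψ : EuclideanSpace ℝ (Fin n) → StdSphere n := fun y => (stereographic' n v).symm y with hψ
  have hψc : Continuous ψ := by
    have := (stereographic' n v).continuousOn_symm
    rwa [stereographic'_target, continuousOn_univ] at this
  have hψv : ∀ y, ψ y ≠ v := fun y => by
    have := (stereographic' n v).map_target (x := y) (by simp)
    simpa using this
  have hψsurj : ∀ q, q ≠ v → ∃ y, ψ y = q := fun q hq =>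
    ⟨stereographic' n v q, (stereographic' n v).left_inv (by simpa using hq)⟩
  have hψinj : Function.Injective ψ := by
    intro x y hxy
    have hr := fun x => (stereographic' n v).right_inv (x := x) (by simp)
    rw [← hr x, ← hr y]
    exact congrArg _ hxy
  have hFinj : ∀ u w, u ≠ p → w ≠ p → F u = F w → u = w := by
    intro u w hu hw huw
    by_contra hne
    have h1 := hFN u w hu hw
    rw [huw, dist_self, mul_zero] at h1
    exact absurd (h.pos u w hu hw hne) (not_lt.2 h1)
  have hFc := h.continuousOn_of_lipschitz h₂ hp hF
  choose G hGp hG using hsurj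
  have hGc : Continuous G := by
    refine Metric.continuous_iff.2 fun y ε hε => ?_
    obtain ⟨κ, hκ, hh⟩ := h.exists_dist_lt h₁ hp hε
    refine ⟨κ / (N + 1), by positivity, fun z hz => hh _ _ (hGp z) (hGp y) ?_⟩
    rw [lt_div_iff₀ (by positivity)] at hz
    have h1 := hFN _ _ (hGp z) (hGp y)
    rw [hG, hG] at h1
    linarith [dist_nonneg (x := z) (y := y)]
  have hfar : ∀ R : ℝ, ∀ᶠ u in 𝓝 p, u ≠ p → R < ‖F u‖ := by
    intro R
    have hcl : IsClosed (G '' closedBall 0 R) :=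
      ((isCompact_closedBall 0 R).image hGc).isClosed
    have hpn : p ∈ (G '' closedBall 0 R)ᶜ := by
      rintro ⟨y, -, hy⟩
      exact hGp y hy
    filter_upwards [hcl.isOpen_compl.mem_nhds hpn] with u hu hup
    by_contra! hle
    exact hu ⟨F u, by simpa using hle, hFinj _ _ (hGp _) hup (hG _)⟩
  set H : Z → StdSphere n := fun u => if u = p then v else ψ (F u) with hH
  have hHp : H p = v := if_pos rfl
  have hHne : ∀ u, u ≠ p → H u = ψ (F u) := fun u hu => if_neg hu
  have hHinj : Function.Injective H := by
    intro u w huw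
    by_cases hu : u = p <;> by_cases hw : w = p
    · rw [hu, hw]
    · rw [hu, hHp, hHne w hw] at huw
      exact absurd huw.symm (hψv _)
    · rw [hw, hHp, hHne u hu] at huw
      exact absurd huw (hψv _)
    · rw [hHne u hu, hHne w hw] at huw
      exact hFinj u w hu hw (hψinj huw)
  have hHsurj : Function.Surjective H := by
    intro q
    by_cases hq : q = v
    · exact ⟨p, hHp.trans hq.symm⟩
    · obtain ⟨y, rfl⟩ := hψsurj q hq
      exact ⟨G y, by rw [hHne _ (hGp y), hG]⟩
  have hHc : Continuous H := by
    refine continuous_iff_continuousAt.2 fun u => ?_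
    by_cases hu : u = p
    · subst hu
      rw [Metric.continuousAt_iff']
      intro ε hε
      filter_upwards [hfar (4 / ε)] with w hw
      by_cases hwp : w = u
      · rw [hwp, dist_self]; exact hε
      rw [hHp, hHne w hwp, hψ, dist_stereographic'_symm_pole, ← div_eq_mul_inv,
        div_lt_iff₀ (by positivity)]
      have h1 := hw hwp
      have h2 : ‖F w‖ ≤ √(‖F w‖ ^ 2 + 4) := Real.le_sqrt_of_sq_le (by linarith)
      rw [div_lt_iff₀ hε] at h1
      nlinarith
    · have hn := isOpen_compl_singleton.mem_nhds hu
      refine ContinuousAt.congr (f := fun u => ψ (F u))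
        (hψc.continuousAt.comp (hFc.continuousAt hn)) ?_
      filter_upwards [hn] with w hw
      exact (hHne w hw).symm
  refine ⟨hHc.homeoOfEquivCompactToT2 (f := Equiv.ofBijective H ⟨hHinj, hHsurj⟩), ?_⟩
  intro a b c e hab hae hbc hce
  refine realCross_le_of_dense (D := {p}ᶜ) (dense_compl_singleton p) hHc hHinj
    (θ := fun t => ((L * N) ^ 2 + 1) * θ₂ t) (continuous_const.mul h₂.2.1) ?_ hab hae hbc hce
  intro a ha b hb c hc e he hab hae hbc hce
  set m : Z → ℝ := fun u => (√(‖F u‖ ^ 2 + 4))⁻¹ with hm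
  have hm0 : ∀ u, 0 < m u := fun u => by positivity
  have hd : ∀ u w, u ≠ p → w ≠ p →
      dist (H u) (H w) = 4 * dist (F u) (F w) * (m u * m w) := by
    intro u w hu hw
    rw [hHne u hu, hHne w hw]
    exact dist_stereographic'_symm v _ _
  have hpae := h.pos a e ha he hae
  have hpbc := h.pos b c hb hc hbc
  have hdae : 0 < dist (F a) (F e) := dist_pos.2 fun hh => hae (hFinj a e ha he hh)
  have hdbc : 0 < dist (F b) (F c) := dist_pos.2 fun hh => hbc (hFinj b c hb hc hh)
  have hnac := h.nonneg ha hc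
  have hnbe := h.nonneg hb he
  calc realCross dist (H a) (H b) (H c) (H e)
      = dist (F a) (F c) * dist (F b) (F e) /
          (dist (F a) (F e) * dist (F b) (F c)) := by
        have h1 := (hm0 a).ne'
        have h2 := (hm0 b).ne'
        have h3 := (hm0 c).ne'
        have h4 := (hm0 e).ne'
        rw [realCross, hd a c ha hc, hd b e hb he, hd a e ha he, hd b c hb hc]
        field_simp
    _ ≤ (L * N) ^ 2 * realCross ρ a b c e := by
        rw [realCross, mul_div_assoc', div_le_div_iff₀ (by positivity) (by positivity)]
        calc _ ≤ (L * ρ a c) * (L * ρ b e) *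
              ((N * dist (F a) (F e)) * (N * dist (F b) (F c))) := by
              gcongr
              exacts [hF a c ha hc, hF b e hb he, hFN a e ha he, hFN b c hb hc]
          _ = _ := by ring
    _ ≤ ((L * N) ^ 2 + 1) * θ₂ (realCross dist a b c e) := by
        have h0 : 0 ≤ realCross ρ a b c e := by unfold realCross; positivity
        have h1 := h.upper a b c e ha hb hc he hab hae hbc hce
        nlinarith [sq_nonneg ((L : ℝ) * N)]

lemma gaugeOf_comp_gaugeOf (η ζ : NNReal ≃ₜ NNReal) :
    gaugeOf η ∘ gaugeOf ζ = gaugeOf (ζ.trans η) := by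
  funext t
  simp [gaugeOf]

lemma exists_forall_not_of_subsingleton {P : Fin 3 → Fin 4 → Prop}
    (h : ∀ m i j, i ≠ j → P m i → ¬ P m j) : ∃ i, ∀ m, ¬ P m i := by
  by_contra! hcon
  choose m hm using hcon
  obtain ⟨i, j, hij, hmm⟩ := Fintype.exists_ne_map_eq_of_card_lt m (by simp)
  exact h (m i) i j hij (hm i) (hmm ▸ hm j)

/-- A quasi-Möbius homeomorphism between infinite compact spaces is quasi-symmetric. -/
lemma exists_isQuasiSymmetric {X Y : Type*} [MetricSpace X] [CompactSpace X] [Infinite X]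
    [MetricSpace Y] [CompactSpace Y] (H : X ≃ₜ Y) {ζ : NNReal ≃ₜ NNReal} {A : ℝ} (hA : 0 < A)
    (hH : ∀ a b c e, a ≠ b → a ≠ e → b ≠ c → c ≠ e →
      realCross dist (H a) (H b) (H c) (H e) ≤ A * gaugeOf ζ (realCross dist a b c e)) :
    ∃ η' : NNReal ≃ₜ NNReal, IsQuasiSymmetric η' H := by
  obtain ⟨D₁, hD₁⟩ := exists_dist_le (Z := X)
  obtain ⟨D₂, hD₂⟩ := exists_dist_le (Z := Y)
  set w : Fin 4 → X := fun i => Infinite.natEmbedding X i with hw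
  have hwinj : Function.Injective w := fun i j hij =>
    Fin.ext ((Infinite.natEmbedding X).injective hij)
  obtain ⟨τ, hτ1, hτ⟩ : ∃ τ : ℝ, (∀ i j, i ≠ j → τ ≤ dist (w i) (w j) ∧
      τ ≤ dist (H (w i)) (H (w j))) ∧ 0 < τ := by
    refine Eventually.exists (f := 𝓝[>] 0) (.and ?_ self_mem_nhdsWithin)
    refine eventually_all.2 fun i => eventually_all.2 fun j => ?_
    by_cases hij : i = j
    · exact .of_forall fun k h => absurd hij h
    filter_upwards [Ioo_mem_nhdsGT (dist_pos.2 (hwinj.ne hij)),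
      Ioo_mem_nhdsGT (dist_pos.2 (H.injective.ne (hwinj.ne hij)))] with r h1 h2 _
    exact ⟨h1.2.le, h2.2.le⟩
  set D := max (max D₁ D₂) 1 with hD
  have hD0 : 0 < D := lt_max_of_lt_right one_pos
  have hDX : ∀ u v : X, dist u v ≤ D := fun u v =>
    (hD₁ u v).trans ((le_max_left _ _).trans (le_max_left _ _))
  have hDY : ∀ u v : Y, dist u v ≤ D := fun u v =>
    (hD₂ u v).trans ((le_max_right _ _).trans (le_max_left _ _))
  set B : ℝ := D / (τ / 2) with hB
  have hB0 : 0 < B := by positivity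
  set B' : NNReal := B.toNNReal with hB'
  have hB'c : (B' : ℝ) = B := Real.coe_toNNReal _ hB0.le
  have hB'0 : B' ≠ 0 := by rw [hB']; simpa using hB0
  set A' : NNReal := (B * A).toNNReal with hA'
  have hA'c : (A' : ℝ) = B * A := Real.coe_toNNReal _ (by positivity)
  have hA'0 : A' ≠ 0 := by rw [hA']; simpa using mul_pos hB0 hA
  refine ⟨((Homeomorph.mulLeft₀ B' hB'0).trans ζ).trans (Homeomorph.mulLeft₀ A' hA'0),
    H.injective, fun u v x huv hux hvx => ?_⟩
  obtain ⟨i, hi⟩ := exists_forall_not_of_subsingleton (P := ![fun i => w i = u,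
    fun i => dist (w i) v < τ / 2, fun i => dist (H (w i)) (H x) < τ / 2]) (by
      intro m i j hij
      fin_cases m
      · exact fun h1 h2 => hij (hwinj (h1.trans h2.symm))
      · intro h1 h2
        simp only [Fin.mk_one, Matrix.cons_val_one, Matrix.cons_val_zero] at h1 h2
        linarith [dist_triangle_right (w i) (w j) v, (hτ1 i j hij).1]
      · intro h1 h2
        simp at h1 h2
        linarith [dist_triangle_right (H (w i)) (H (w j)) (H x), (hτ1 i j hij).2])
  set z := w i with hz
  have hzu : z ≠ u := hi 0
  have hzv : τ / 2 ≤ dist z v := not_lt.1 (hi 1)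
  have hzx : τ / 2 ≤ dist (H z) (H x) := not_lt.1 (hi 2)
  have hzv0 : 0 < dist z v := by linarith
  have hzx0 : 0 < dist (H z) (H x) := by linarith
  have hux0 : 0 < dist u x := dist_pos.2 hux
  have hHux0 : 0 < dist (H u) (H x) := dist_pos.2 (H.injective.ne hux)
  have hHzv0 : 0 < dist (H z) (H v) := dist_pos.2 (H.injective.ne (dist_pos.1 hzv0))
  have key := hH u z v x hzu.symm hux (dist_pos.1 hzv0) hvx
  have hmono : gaugeOf ζ (realCross dist u z v x) ≤ gaugeOf ζ (B * (dist u v / dist u x)) := by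
    refine (isGauge_gaugeOf ζ).1 ?_
    have h1 : dist z x / dist z v ≤ B := div_le_div₀ hD0.le (hDX _ _) (by positivity) hzv
    calc realCross dist u z v x = dist z x / dist z v * (dist u v / dist u x) := by
          rw [realCross]; field_simp
      _ ≤ _ := mul_le_mul_of_nonneg_right h1 (by positivity)
  have hfin : dist (H u) (H v) / dist (H u) (H x) ≤
      B * A * gaugeOf ζ (B * (dist u v / dist u x)) := by
    have h1 : dist (H z) (H v) / dist (H z) (H x) ≤ B :=
      div_le_div₀ hD0.le (hDY _ _) (by positivity) hzx
    have h0 : 0 ≤ realCross dist (H u) (H z) (H v) (H x) := by unfold realCross; positivity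
    calc dist (H u) (H v) / dist (H u) (H x)
        = dist (H z) (H v) / dist (H z) (H x) * realCross dist (H u) (H z) (H v) (H x) := by
          rw [realCross]; field_simp
      _ ≤ B * (A * gaugeOf ζ (B * (dist u v / dist u x))) :=
          mul_le_mul h1 (key.trans (mul_le_mul_of_nonneg_left hmono hA.le)) h0 hB0.le
      _ = _ := by ring
  rw [← NNReal.coe_le_coe]
  have harg : (B * (dist u v / dist u x)).toNNReal = B' * (nndist u v / nndist u x) :=
    NNReal.coe_injective (by rw [Real.coe_toNNReal _ (by positivity)]; simp [hB'c])
  simp only [Homeomorph.trans_apply, Homeomorph.coe_mulLeft₀, NNReal.coe_mul, NNReal.coe_div,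
    coe_nndist, hA'c]
  rwa [gaugeOf, harg] at hfin

/-- **Bonk–Kleiner, Theorem 6.1.** A compact Ahlfors `n`-regular space of topological
dimension `n` in which every triple of distinct points can be mapped to a uniformly
separated triple by a uniform quasi-Möbius self-homeomorphism is quasi-symmetrically
homeomorphic to the standard sphere `Sⁿ`. -/
theorem qs_sphere_of_uniformly_qm_triple_transitive (n : ℕ) (Z : Type) [MetricSpace Z]
    [CompactSpace Z] [MeasurableSpace Z] [BorelSpace Z]
    (hreg : AhlforsRegular (n : ℝ) Z) (hdim : topDim Z = (n : ℕ∞))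
    (δ : ℝ) (hδ : 0 < δ) (η : NNReal ≃ₜ NNReal)
    (htriple : ∀ z₁ z₂ z₃ : Z, z₁ ≠ z₂ → z₁ ≠ z₃ → z₂ ≠ z₃ →
      ∃ g : Z ≃ₜ Z, IsQuasiMobius η g ∧
        δ ≤ dist (g z₁) (g z₂) ∧ δ ≤ dist (g z₁) (g z₃) ∧ δ ≤ dist (g z₂) (g z₃)) :
    ∃ (η' : NNReal ≃ₜ NNReal) (h : Z ≃ₜ StdSphere n), IsQuasiSymmetric η' h := by
  have hn : 0 < n := by exact_mod_cast hreg.1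
  have hperf := hreg.neBot
  have hne : Nonempty Z := by
    by_contra hemp
    rw [not_nonempty_iff] at hemp
    have := hreg.2.2.1
    rw [univ_eq_empty_iff.2 hemp, Metric.diam_empty] at this
    exact lt_irrefl _ this
  have hinf : Infinite Z := by
    obtain ⟨x⟩ := hne
    have := hperf x
    exact infinite_univ_iff.1 (infinite_of_mem_nhds x univ_mem)
  have huniv := not_smallOrder_univ_of_topDim hn hdim
  have hη := isGauge_gaugeOf η
  have hη' := isGauge_gaugeOf (dualHomeo η)
  obtain ⟨o, ρ, F, L, N, hρ, hF, hFN⟩ := exists_regular_blowup hreg huniv hδ htriple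
  obtain ⟨x, hx, s, hs, σ, hσ, hσN, κ, hκ, hσF⟩ := hρ.exists_chart hη hη' (hperf o) hF hFN
    fun K hK hKi => not_smallOrder_of_interior_nonempty hn hδ htriple hperf huniv hK hKi
  obtain ⟨p, ρ', F', hρ', hF', hFN', hsurj⟩ := hρ.exists_bilipschitz hη hη' (hperf o) hδ htriple
    hn hF hx hs hσ hσN hκ hσF
  obtain ⟨H, hH⟩ := hρ'.exists_homeomorph_sphere (hη.comp hη) (hη'.comp hη') (hperf p) hF' hFN'
    hsurj
  rw [gaugeOf_comp_gaugeOf] at hH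
  obtain ⟨η', hη'⟩ := exists_isQuasiSymmetric H (by positivity) hH
  exact ⟨η', H, hη'⟩

end
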